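/- For every δ > 0 and every real p > 1 there exist constants C > 0 and T₀ ≥ 3 such that for all T ≥ T₀, ∫_T^{T+δ} |ζ(1+it)|^p dt ≤ C · (log log T) · (log T)^{(2/3)(p−1)}. -/

import Mathlib

namespace ZetaMoment

section Linnik

open Finset

/-- Families with equal power sums of orders `1, …, k` have equal elementary symmetric functions,
provided `1, …, k` are invertible. -/
theorem aeval_esymm_eq_of_power_sums_eq {R : Type*} [CommRing R] {k : ℕ} (x y : Fin k → R)
    (hu : ∀ j, 1 ≤ j → j ≤ k → IsUnit (j : R))
    (h : ∀ j, 1 ≤ j → j ≤ k → ∑ i, x i ^ j = ∑ i, y i ^ j) (j : ℕ) (hj : j ≤ k) :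
    MvPolynomial.aeval x (MvPolynomial.esymm (Fin k) ℤ j)
      = MvPolynomial.aeval y (MvPolynomial.esymm (Fin k) ℤ j) := by
  induction j using Nat.strong_induction_on with
  | _ j ih =>
    rcases Nat.eq_zero_or_pos j with rfl | hpos
    · simp
    · have key := MvPolynomial.mul_esymm_eq_sum (Fin k) ℤ j
      have hx := congrArg (MvPolynomial.aeval x) key
      have hy := congrArg (MvPolynomial.aeval y) key
      simp only [map_mul, map_natCast, map_sum, map_pow, map_neg, map_one,
        MvPolynomial.psum, MvPolynomial.aeval_X] at hx hy
      apply (hu j hpos hj).mul_left_cancel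
      rw [hx, hy]
      congr 1
      apply sum_congr rfl
      intro a ha
      simp only [mem_filter, HasAntidiagonal.mem_antidiagonal] at ha
      rw [ih a.1 ha.2 (by omega), h a.2 (by omega) (by omega)]

theorem prod_sub_eq_of_power_sums_eq {R : Type*} [CommRing R] {k : ℕ} (x y : Fin k → R)
    (hu : ∀ j, 1 ≤ j → j ≤ k → IsUnit (j : R))
    (h : ∀ j, 1 ≤ j → j ≤ k → ∑ i, x i ^ j = ∑ i, y i ^ j) (z : R) :
    ∏ i, (z - x i) = ∏ i, (z - y i) := by
  have aux : ∀ w : Fin k → R, ∏ i, (z + w i) = ∑ j ∈ range (k + 1),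
      MvPolynomial.aeval w (MvPolynomial.esymm (Fin k) ℤ j) * z ^ (k - j) := by
    intro w
    have := congrArg (Polynomial.eval₂ (MvPolynomial.aeval w : MvPolynomial (Fin k) ℤ →ₐ[ℤ] R).toRingHom z)
      (MvPolynomial.prod_C_add_X_eq_sum_esymm ℤ (Fin k))
    simpa [Polynomial.eval₂_finsetProd, Polynomial.eval₂_finsetSum] using this
  simp only [sub_eq_add_neg]
  rw [aux (fun i => -x i), aux (fun i => -y i)]
  apply sum_congr rfl
  intro j hj
  rw [aeval_esymm_eq_of_power_sums_eq (fun i => -x i) (fun i => -y i) hu ?_ j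
    (by simp at hj; omega)]
  intro j h1 h2
  have hneg : ∀ w : Fin k → R, ∑ i, (-w i) ^ j = (-1) ^ j * ∑ i, w i ^ j := by
    intro w
    rw [mul_sum]
    exact sum_congr rfl fun i _ => neg_pow _ _
  rw [hneg, hneg, h j h1 h2]

/-- If two tuples of residues modulo a prime power have equal power sums and the entries of the
first are distinct modulo the prime, then each entry of the second is an entry of the first. -/
theorem exists_eq_of_power_sums_eq {p k : ℕ} (hp : p.Prime) (hkp : k < p) {n : ℕ}
    (x y : Fin k → ℤ) (hx : ∀ i j, i ≠ j → ¬ x i ≡ x j [ZMOD p])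
    (h : ∀ j, 1 ≤ j → j ≤ k → ∑ i, x i ^ j ≡ ∑ i, y i ^ j [ZMOD (p ^ n : ℕ)]) (i : Fin k) :
    ∃ j, y i ≡ x j [ZMOD (p ^ n : ℕ)] := by
  have hu : ∀ j, 1 ≤ j → j ≤ k → IsUnit ((j : ℕ) : ZMod (p ^ n)) := by
    intro j h1 h2
    rw [ZMod.isUnit_iff_coprime]
    exact (Nat.coprime_of_lt_prime (n := j) (by omega) (by omega) hp).symm.pow_right n
  have key := prod_sub_eq_of_power_sums_eq (R := ZMod (p ^ n)) (fun i => (x i : ZMod (p ^ n)))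
    (fun i => (y i : ZMod (p ^ n))) hu (by
      intro j h1 h2
      have := (ZMod.intCast_eq_intCast_iff _ _ _).2 (h j h1 h2)
      push_cast at this
      exact this) (y i)
  rw [prod_eq_zero (mem_univ i) (f := fun j => (y i : ZMod (p ^ n)) - (y j : ZMod (p ^ n)))
    (by simp)] at key
  have hdvd : ((p ^ n : ℕ) : ℤ) ∣ ∏ j, (y i - x j) := by
    rw [← ZMod.intCast_zmod_eq_zero_iff_dvd]
    push_cast
    exact key
  push_cast at hdvd
  have hpI : Prime (p : ℤ) := Nat.prime_iff_prime_int.1 hp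
  by_cases hex : ∃ j, (p : ℤ) ∣ y i - x j
  · obtain ⟨j, hj⟩ := hex
    refine ⟨j, ?_⟩
    rw [← mul_prod_erase _ _ (mem_univ j)] at hdvd
    have hcop : IsCoprime ((p : ℤ) ^ n) (∏ l ∈ univ.erase j, (y i - x l)) := by
      apply IsCoprime.pow_left
      apply IsCoprime.prod_right
      intro l hl
      rw [hpI.coprime_iff_not_dvd]
      intro hd
      apply hx j l (ne_of_mem_erase hl).symm
      rw [Int.modEq_iff_dvd]
      have := dvd_sub hj hd
      simpa using this
    have := hcop.dvd_of_dvd_mul_right hdvd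
    rw [Int.modEq_comm, Int.modEq_iff_dvd]
    exact_mod_cast this
  · push Not at hex
    have hcop : IsCoprime ((p : ℤ) ^ n) (∏ l, (y i - x l)) := by
      apply IsCoprime.pow_left
      apply IsCoprime.prod_right
      intro l _
      rw [hpI.coprime_iff_not_dvd]
      exact hex l
    have hun : IsUnit ((p : ℤ) ^ n) := hcop.isUnit_of_dvd' dvd_rfl hdvd
    refine ⟨i, ?_⟩
    rw [Int.modEq_iff_dvd]
    push_cast
    exact hun.dvd

/-- Linnik's lemma. -/
theorem card_power_sums_modEq_le {p k : ℕ} (hp : p.Prime) (hkp : k < p) {P : ℕ} (hP : P ≤ p ^ k)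
    (b : ℤ) (c : Fin k → ℤ) (D : Finset (Fin k → ℤ))
    (hD : ∀ x ∈ D, ∀ i, x i ∈ Ico (0 : ℤ) P)
    (hdist : ∀ x ∈ D, ∀ i j, i ≠ j → ¬ x i ≡ x j [ZMOD p])
    (hc : ∀ x ∈ D, ∀ j : Fin k, ∑ i, (x i - b) ^ (j + 1 : ℕ) ≡ c j [ZMOD (p ^ (j + 1 : ℕ) : ℕ)]) :
    #D ≤ k ^ k * p ^ (k * (k - 1) / 2) := by
  classical
  have hp0 : (0 : ℤ) < p := by exact_mod_cast hp.pos
  let q : (Fin k → ℤ) → Fin k → ℤ := fun x j =>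
    ((∑ i, (x i - b) ^ (j + 1 : ℕ) - c j) / (p : ℤ) ^ (j + 1 : ℕ)) % (p : ℤ) ^ (k - (j + 1) : ℕ)
  let Tg : Finset (Fin k → ℤ) := Fintype.piFinset fun j : Fin k => Ico (0 : ℤ) ((p ^ (k - (j + 1)) : ℕ) : ℤ)
  have hTg : #Tg = p ^ (k * (k - 1) / 2) := by
    simp only [Tg, Fintype.card_piFinset, Int.card_Ico, sub_zero, Int.toNat_natCast]
    rw [prod_pow_eq_pow_sum, Fin.sum_univ_eq_sum_range (fun j => k - (j + 1))]
    congr 1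
    rw [← sum_range_id]
    rw [← sum_range_reflect]
    apply sum_congr rfl
    intro j hj
    have := mem_range.1 hj
    omega
  have hmaps : ∀ x ∈ D, q x ∈ Tg := by
    intro x _
    simp only [Tg, Fintype.mem_piFinset, mem_Ico]
    intro j
    have : (0 : ℤ) < (p : ℤ) ^ (k - (j + 1) : ℕ) := by positivity
    push_cast
    exact ⟨Int.emod_nonneg _ this.ne', Int.emod_lt_of_pos _ this⟩
  rw [mul_comm, ← hTg, mul_comm]
  apply (card_le_mul_card_image_of_maps_to hmaps (k ^ k) ?_)
  intro v _
  rcases (D.filter (fun x => q x = v)).eq_empty_or_nonempty with he | ⟨x, hx⟩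
  · rw [he]; simp
  rw [mem_filter] at hx
  have hsub : D.filter (fun x => q x = v) ⊆ Fintype.piFinset fun _ : Fin k => univ.image x := by
    intro y hy
    rw [mem_filter] at hy
    rw [Fintype.mem_piFinset]
    intro i
    have hmod : ∀ j, 1 ≤ j → j ≤ k →
        ∑ i, (x i - b) ^ j ≡ ∑ i, (y i - b) ^ j [ZMOD (p ^ k : ℕ)] := by
      intro j h1 h2
      obtain ⟨j, rfl⟩ : ∃ j', j = j' + 1 := ⟨j - 1, by omega⟩
      let jj : Fin k := ⟨j, by omega⟩
      have hqe : q x jj = q y jj := by rw [hx.2, hy.2]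
      have hcx := hc x hx.1 jj
      have hcy := hc y hy.1 jj
      simp only [q, jj] at hqe hcx hcy
      set sx := ∑ i, (x i - b) ^ (j + 1)
      set sy := ∑ i, (y i - b) ^ (j + 1)
      have h1 : (p : ℤ) ^ (j + 1) ∣ sx - c jj := by
        have := (Int.modEq_iff_dvd.1 hcx.symm); exact_mod_cast this
      have h2 : (p : ℤ) ^ (j + 1) ∣ sy - c jj := by
        have := (Int.modEq_iff_dvd.1 hcy.symm); exact_mod_cast this
      obtain ⟨ux, hux⟩ := h1
      obtain ⟨uy, huy⟩ := h2
      have hpj : (p : ℤ) ^ (j + 1) ≠ 0 := by positivity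
      have e1 : (sx - c jj) / (p : ℤ) ^ (j + 1) = ux := by
        rw [hux]; exact Int.mul_ediv_cancel_left _ hpj
      have e2 : (sy - c jj) / (p : ℤ) ^ (j + 1) = uy := by
        rw [huy]; exact Int.mul_ediv_cancel_left _ hpj
      have hqe' : ux ≡ uy [ZMOD (p : ℤ) ^ (k - (j + 1))] := by
        have := hqe
        rw [show c ⟨j, _⟩ = c jj from rfl] at this
        rw [e1, e2] at this
        exact this
      rw [Int.modEq_iff_dvd] at hqe' ⊢
      have : sy - sx = (p : ℤ) ^ (j + 1) * (uy - ux) := by linear_combination huy - hux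
      rw [this]
      push_cast
      have hk : (p : ℤ) ^ k = (p : ℤ) ^ (j + 1) * (p : ℤ) ^ (k - (j + 1)) := by
        rw [← pow_add]; congr 1; omega
      rw [hk]
      exact mul_dvd_mul_left _ hqe'
    obtain ⟨j, hj⟩ := exists_eq_of_power_sums_eq hp hkp (fun i => x i - b) (fun i => y i - b)
      (by
        intro i j hij hmod
        apply hdist x hx.1 i j hij
        simpa using hmod.add_right b) hmod i
    have hj' : y i ≡ x j [ZMOD (p ^ k : ℕ)] := by simpa using hj.add_right b
    have hyi := mem_Ico.1 (hD y hy.1 i)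
    have hxj := mem_Ico.1 (hD x hx.1 j)
    have hPk : (P : ℤ) ≤ ((p ^ k : ℕ) : ℤ) := by exact_mod_cast hP
    have : y i = x j := by
      have := hj'
      unfold Int.ModEq at this
      rwa [Int.emod_eq_of_lt hyi.1 (hyi.2.trans_le hPk),
        Int.emod_eq_of_lt hxj.1 (hxj.2.trans_le hPk)] at this
    rw [this]
    exact mem_image_of_mem _ (mem_univ _)
  calc #(D.filter (fun x => q x = v)) ≤ _ := card_le_card hsub
    _ = (#(univ.image x)) ^ k := by simp
    _ ≤ k ^ k := by
        gcongr
        exact card_image_le.trans (by simp)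

end Linnik

section Energy

open Finset Filter

variable {ι V : Type*} [DecidableEq V]

/-- The number of pairs of elements of `X` with the same image under `φ`. -/
def energy (φ : ι → V) (X : Finset ι) : ℕ := #{w ∈ X ×ˢ X | φ w.1 = φ w.2}

theorem sum_card_fiber_sq (φ : ι → V) (X : Finset ι) (T : Finset V) :
    ∑ v ∈ T, #{x ∈ X | φ x = v} ^ 2 = #{w ∈ X ×ˢ X | φ w.1 ∈ T ∧ φ w.1 = φ w.2} := by
  classical
  rw [card_eq_sum_card_fiberwise (f := fun w : ι × ι => φ w.1) (t := T)]
  · apply sum_congr rfl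
    intro v hv
    rw [sq, ← card_product]
    congr 1
    ext w
    simp only [mem_product, mem_filter]
    constructor
    · rintro ⟨⟨h1, h2⟩, h3, h4⟩
      exact ⟨⟨⟨h1, h3⟩, h2 ▸ hv, h2.trans h4.symm⟩, h2⟩
    · rintro ⟨⟨⟨h1, h3⟩, _, h5⟩, h6⟩
      exact ⟨⟨h1, h6⟩, h3, h5 ▸ h6⟩
  · intro w hw
    simp only [coe_filter, Set.mem_ofPred_eq] at hw
    exact hw.2.1

theorem sum_card_fiber_sq_le (φ : ι → V) (X : Finset ι) (T : Finset V) :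
    ∑ v ∈ T, #{x ∈ X | φ x = v} ^ 2 ≤ energy φ X := by
  rw [sum_card_fiber_sq]
  exact card_le_card (monotone_filter_right _ fun w _ h => h.2)

theorem energy_eq_sum (φ : ι → V) (X : Finset ι) (T : Finset V) (hT : ∀ x ∈ X, φ x ∈ T) :
    energy φ X = ∑ v ∈ T, #{x ∈ X | φ x = v} ^ 2 := by
  rw [sum_card_fiber_sq, energy]
  congr 1
  apply filter_congr
  intro w hw
  simp [hT w.1 (mem_product.1 hw).1]

theorem energy_le_of_subset_biUnion {κ : Type*} [DecidableEq ι] (φ : ι → V) (X : Finset ι)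
    (C : Finset κ) (Y : κ → Finset ι) (h : X ⊆ C.biUnion Y) :
    energy φ X ≤ #C * ∑ c ∈ C, energy φ (Y c) := by
  rw [energy_eq_sum φ X (X.image φ) (fun x hx => mem_image_of_mem _ hx)]
  calc ∑ v ∈ X.image φ, #{x ∈ X | φ x = v} ^ 2
      ≤ ∑ v ∈ X.image φ, #C * ∑ c ∈ C, #{x ∈ Y c | φ x = v} ^ 2 := by
        apply sum_le_sum
        intro v _
        refine le_trans ?_ sq_sum_le_card_mul_sum_sq
        gcongr
        refine le_trans (card_le_card ?_) (card_biUnion_le (s := C) (t := fun c => {x ∈ Y c | φ x = v}))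
        intro x hx
        rw [mem_filter] at hx
        obtain ⟨c, hc, hxc⟩ := mem_biUnion.1 (h hx.1)
        exact mem_biUnion.2 ⟨c, hc, mem_filter.2 ⟨hxc, hx.2⟩⟩
    _ = #C * ∑ c ∈ C, ∑ v ∈ X.image φ, #{x ∈ Y c | φ x = v} ^ 2 := by
        rw [← mul_sum, sum_comm]
    _ ≤ _ := by
        gcongr with c _
        exact sum_card_fiber_sq_le _ _ _

theorem card_shifted_le_energy [AddGroup V] (φ : ι → V) (X : Finset ι) (c : V) :
    #{w ∈ X ×ˢ X | φ w.1 = φ w.2 + c} ≤ energy φ X := by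
  classical
  set T := X.image φ
  have h1 : #{w ∈ X ×ˢ X | φ w.1 = φ w.2 + c}
      = ∑ v ∈ T, #{x ∈ X | φ x = v + c} * #{x ∈ X | φ x = v} := by
    rw [card_eq_sum_card_fiberwise (f := fun w : ι × ι => φ w.2) (t := T)]
    · apply sum_congr rfl
      intro v _
      rw [← card_product]
      congr 1
      ext w
      simp only [mem_product, mem_filter]
      constructor
      · rintro ⟨⟨⟨h1, h3⟩, h5⟩, h6⟩
        exact ⟨⟨h1, h6 ▸ h5⟩, h3, h6⟩
      · rintro ⟨⟨h1, h2⟩, h3, h4⟩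
        exact ⟨⟨⟨h1, h3⟩, h4 ▸ h2⟩, h4⟩
    · intro w hw
      simp only [coe_filter, Set.mem_ofPred_eq, mem_product] at hw
      exact mem_image_of_mem _ hw.1.2
  have h2 := sum_card_fiber_sq_le φ X T
  have h3 : ∑ v ∈ T, #{x ∈ X | φ x = v + c} ^ 2 ≤ energy φ X := by
    refine le_trans (le_of_eq ?_) (sum_card_fiber_sq_le φ X (T.image (· + c)))
    rw [sum_image (s := T) (g := fun v => v + c) (fun a _ b _ hab => add_right_cancel hab)]
  have h4 : 2 * ∑ v ∈ T, #{x ∈ X | φ x = v + c} * #{x ∈ X | φ x = v} ≤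
      ∑ v ∈ T, #{x ∈ X | φ x = v + c} ^ 2 + ∑ v ∈ T, #{x ∈ X | φ x = v} ^ 2 := by
    rw [mul_sum, ← sum_add_distrib]
    apply sum_le_sum
    intro v _
    have := two_mul_le_add_sq (#{x ∈ X | φ x = v + c}) (#{x ∈ X | φ x = v})
    linarith
  omega

theorem sum_addChar_norm_sq {G : Type*} [AddCommGroup G] [Fintype G] [DecidableEq G]
    (φ : ι → G) (X : Finset ι) :
    ∑ ψ : AddChar G ℂ, ‖∑ x ∈ X, ψ (φ x)‖ ^ 2 = Fintype.card G * energy φ X := by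
  have key : ∑ ψ : AddChar G ℂ, ((‖∑ x ∈ X, ψ (φ x)‖ ^ 2 : ℝ) : ℂ)
      = Fintype.card G * energy φ X := by
    have h1 : ∀ ψ : AddChar G ℂ, ((‖∑ x ∈ X, ψ (φ x)‖ ^ 2 : ℝ) : ℂ)
        = ∑ w ∈ X ×ˢ X, ψ (φ w.1 - φ w.2) := by
      intro ψ
      push_cast
      rw [← Complex.mul_conj', map_sum, sum_mul_sum, ← sum_product']
      apply sum_congr rfl
      intro w _
      rw [sub_eq_add_neg, AddChar.map_add_eq_mul, AddChar.map_neg_eq_conj]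
    simp_rw [h1]
    rw [sum_comm]
    simp_rw [AddChar.sum_apply_eq_ite, sub_eq_zero]
    rw [← sum_filter, sum_const, energy]
    simp [mul_comm]
  exact_mod_cast key

/-- Reduction of an integer vector modulo `n + 1`. -/
def reduceMod {k : ℕ} (n : ℕ) (v : Fin k → ℤ) : Fin k → ZMod (n + 1) := fun j => (v j : ZMod (n + 1))

theorem eventually_reduceMod_eq_iff {k : ℕ} (u v : Fin k → ℤ) :
    ∀ᶠ n : ℕ in atTop, (reduceMod n u = reduceMod n v ↔ u = v) := by
  filter_upwards [eventually_ge_atTop (∑ j, (u j - v j).natAbs)] with n hn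
  refine ⟨fun h => ?_, fun h => by rw [h]⟩
  funext j
  have hj : ((u j : ℤ) : ZMod (n + 1)) = v j := congrFun h j
  rw [ZMod.intCast_eq_intCast_iff_dvd_sub] at hj
  have h1 : (u j - v j).natAbs ≤ n :=
    (single_le_sum (f := fun j => (u j - v j).natAbs) (fun _ _ => Nat.zero_le _) (mem_univ j)).trans hn
  have h2 : |v j - u j| ≤ n := by
    rw [Int.abs_eq_natAbs]
    exact Int.ofNat_le.2 (by omega)
  have := Int.eq_zero_of_abs_lt_dvd hj (by push_cast; omega)
  omega

theorem eventually_sum_addChar_norm_sq {k : ℕ} (φ : ι → Fin k → ℤ) (X : Finset ι) :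
    ∀ᶠ n : ℕ in atTop, ∑ ψ : AddChar (Fin k → ZMod (n + 1)) ℂ,
      ‖∑ x ∈ X, ψ (reduceMod n (φ x))‖ ^ 2 = (n + 1 : ℝ) ^ k * energy φ X := by
  have h : ∀ᶠ n : ℕ in atTop, ∀ w ∈ X ×ˢ X,
      (reduceMod n (φ w.1) = reduceMod n (φ w.2) ↔ φ w.1 = φ w.2) := by
    rw [Filter.eventually_all_finset]
    intro w _
    exact eventually_reduceMod_eq_iff _ _
  filter_upwards [h] with n hn
  rw [sum_addChar_norm_sq (fun x => reduceMod n (φ x)) X]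
  have : energy (fun x => reduceMod n (φ x)) X = energy φ X := by
    unfold energy
    congr 1
    exact filter_congr hn
  rw [this]
  simp [ZMod.card]

end Energy

section PowerSums

open Finset Filter

/-- The vector of power sums of orders `1, …, k` of a tuple of integers. -/
def psums (k : ℕ) {s : ℕ} (x : Fin s → ℤ) : Fin k → ℤ := fun j => ∑ i, x i ^ (j + 1 : ℕ)

/-- The `s`-tuples of elements of `A`. -/
def tuples (s : ℕ) (A : Finset ℤ) : Finset (Fin s → ℤ) := Fintype.piFinset fun _ => A

/-- The number of solutions of Vinogradov's system in which the variables range over `A`. -/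
def vinogradov (k s : ℕ) (A : Finset ℤ) : ℕ := energy (psums k (s := s)) (tuples s A)

/-- The exponential sum over `A` attached to a character. -/
noncomputable def expSum {k n : ℕ} (ψ : AddChar (Fin k → ZMod (n + 1)) ℂ) (A : Finset ℤ) : ℂ :=
  ∑ a ∈ A, ψ (reduceMod n fun j => a ^ (j + 1 : ℕ))

theorem reduceMod_add {k n : ℕ} (u v : Fin k → ℤ) :
    reduceMod n (u + v) = reduceMod n u + reduceMod n v := by
  funext j; simp [reduceMod]

theorem addChar_map_sum {G κ : Type*} [AddCommGroup G] (ψ : AddChar G ℂ) (f : κ → G)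
    (T : Finset κ) : ψ (∑ i ∈ T, f i) = ∏ i ∈ T, ψ (f i) := by
  classical
  induction T using Finset.induction with
  | empty => simp
  | insert a T ha ih => rw [sum_insert ha, prod_insert ha, AddChar.map_add_eq_mul, ih]

theorem addChar_psums {k n s : ℕ} (ψ : AddChar (Fin k → ZMod (n + 1)) ℂ) (x : Fin s → ℤ) :
    ψ (reduceMod n (psums k x)) = ∏ i, ψ (reduceMod n fun j => x i ^ (j + 1 : ℕ)) := by
  have : reduceMod n (psums k x) = ∑ i, reduceMod n fun j : Fin k => x i ^ (j + 1 : ℕ) := by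
    funext j
    simp [reduceMod, psums, Finset.sum_apply]
  rw [this, addChar_map_sum]

theorem sum_piFinset_addChar {k n s : ℕ} (ψ : AddChar (Fin k → ZMod (n + 1)) ℂ)
    (A : Fin s → Finset ℤ) :
    ∑ x ∈ Fintype.piFinset A, ψ (reduceMod n (psums k x)) = ∏ i, expSum ψ (A i) := by
  simp_rw [addChar_psums]
  exact (prod_univ_sum A fun _ a => ψ (reduceMod n fun j : Fin k => a ^ (j + 1 : ℕ))).symm

theorem sum_tuples_addChar {k n s : ℕ} (ψ : AddChar (Fin k → ZMod (n + 1)) ℂ) (A : Finset ℤ) :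
    ∑ x ∈ tuples s A, ψ (reduceMod n (psums k x)) = expSum ψ A ^ s := by
  rw [tuples, sum_piFinset_addChar]
  simp

theorem eventually_sum_expSum_pow (k s : ℕ) (A : Finset ℤ) :
    ∀ᶠ n : ℕ in atTop, ∑ ψ : AddChar (Fin k → ZMod (n + 1)) ℂ, ‖expSum ψ A‖ ^ (2 * s)
      = (n + 1 : ℝ) ^ k * vinogradov k s A := by
  filter_upwards [eventually_sum_addChar_norm_sq (psums k (s := s)) (tuples s A)] with n hn
  rw [vinogradov, ← hn]
  apply sum_congr rfl
  intro ψ _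
  rw [sum_tuples_addChar, norm_pow, ← pow_mul, mul_comm]

/-- The mixed sums: `x` ranges over a set of tuples and `z` over all tuples of elements of `A`. -/
theorem eventually_sum_mixed (k r s : ℕ) (X : Finset (Fin r → ℤ)) (A : Finset ℤ) :
    ∀ᶠ n : ℕ in atTop, ∑ ψ : AddChar (Fin k → ZMod (n + 1)) ℂ,
      ‖∑ x ∈ X, ψ (reduceMod n (psums k x))‖ ^ 2 * ‖expSum ψ A‖ ^ (2 * s)
      = (n + 1 : ℝ) ^ k * energy (fun w : (Fin r → ℤ) × (Fin s → ℤ) => psums k w.1 + psums k w.2)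
          (X ×ˢ tuples s A) := by
  filter_upwards [eventually_sum_addChar_norm_sq
    (fun w : (Fin r → ℤ) × (Fin s → ℤ) => psums k w.1 + psums k w.2) (X ×ˢ tuples s A)] with n hn
  rw [← hn]
  apply sum_congr rfl
  intro ψ _
  have : ∑ w ∈ X ×ˢ tuples s A, ψ (reduceMod n (psums k w.1 + psums k w.2))
      = (∑ x ∈ X, ψ (reduceMod n (psums k x))) * expSum ψ A ^ s := by
    rw [← sum_tuples_addChar, sum_mul_sum, ← sum_product']
    apply sum_congr rfl
    intro w _
    rw [reduceMod_add, AddChar.map_add_eq_mul]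
  rw [this, norm_mul, mul_pow, norm_pow, ← pow_mul, mul_comm 2 s]

theorem norm_expSum_le {k n : ℕ} (ψ : AddChar (Fin k → ZMod (n + 1)) ℂ) (A : Finset ℤ) :
    ‖expSum ψ A‖ ≤ #A := by
  refine (norm_sum_le _ _).trans ?_
  simp

theorem vinogradov_add_le (k s r : ℕ) (A : Finset ℤ) :
    vinogradov k (s + r) A ≤ #A ^ (2 * r) * vinogradov k s A := by
  obtain ⟨n, h1, h2⟩ := ((eventually_sum_expSum_pow k (s + r) A).and
    (eventually_sum_expSum_pow k s A)).exists
  have hn : (0 : ℝ) < (n + 1 : ℝ) ^ k := by positivity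
  have : (n + 1 : ℝ) ^ k * vinogradov k (s + r) A
      ≤ (n + 1 : ℝ) ^ k * (#A ^ (2 * r) * vinogradov k s A) := by
    rw [← h1, mul_left_comm, ← h2, mul_sum]
    apply sum_le_sum
    intro ψ _
    rw [mul_add, pow_add, mul_comm]
    gcongr
    exact norm_expSum_le ψ A
  exact_mod_cast le_of_mul_le_mul_left this hn

theorem vinogradov_le_card_pow (k s : ℕ) (A : Finset ℤ) : vinogradov k s A ≤ #A ^ (2 * s) := by
  have h0 : vinogradov k 0 A ≤ 1 := by
    unfold vinogradov energy
    refine (card_filter_le _ _).trans ?_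
    simp [tuples]
  have := vinogradov_add_le k 0 s A
  simp only [zero_add] at this
  exact this.trans (mul_le_of_le_one_right' h0)

end PowerSums

section MainTerm

open Finset Filter

theorem sum_sub_pow {r : ℕ} (x : Fin r → ℤ) (b : ℤ) (j : ℕ) :
    ∑ i, (x i - b) ^ j = ∑ l ∈ range (j + 1), (∑ i, x i ^ l) * ((-b) ^ (j - l) * (j.choose l : ℤ)) := by
  simp_rw [sub_eq_add_neg, add_pow, sum_mul]
  rw [sum_comm]
  apply sum_congr rfl
  intro l _
  apply sum_congr rfl
  intro i _
  ring

theorem psums_translate {k r s : ℕ} {x x' : Fin r → ℤ} {z z' : Fin s → ℤ} (b : ℤ)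
    (h : psums k x + psums k z = psums k x' + psums k z') :
    psums k (fun i => x i - b) + psums k (fun i => z i - b)
      = psums k (fun i => x' i - b) + psums k (fun i => z' i - b) := by
  have hl : ∀ l ≤ k, ∑ i, x i ^ l + ∑ i, z i ^ l = ∑ i, x' i ^ l + ∑ i, z' i ^ l := by
    intro l hl
    rcases l with _ | l
    · simp
    · exact congrFun h ⟨l, hl⟩
  funext j
  simp only [psums, Pi.add_apply]
  rw [sum_sub_pow, sum_sub_pow, sum_sub_pow, sum_sub_pow, ← sum_add_distrib, ← sum_add_distrib]
  apply sum_congr rfl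
  intro l hlj
  rw [← add_mul, ← add_mul, hl l (by have := mem_range.1 hlj; have := j.2; omega)]

theorem psums_mul {k s : ℕ} (p : ℤ) (w : Fin s → ℤ) (j : Fin k) :
    psums k (fun i => p * w i) j = p ^ (j + 1 : ℕ) * psums k w j := by
  simp [psums, mul_pow, mul_sum]

/-- The residue class of `b` modulo `p` inside `[0, P)`. -/
noncomputable def resClass (P p : ℕ) (b : ℤ) : Finset ℤ := {x ∈ Ico (0 : ℤ) P | x % p = b}

theorem exists_of_mem_resClass {P p Q : ℕ} (hp : 0 < p) (hPQ : P ≤ p * Q) {b x : ℤ}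
    (hx : x ∈ resClass P p b) : x - b = p * ((x - b) / p) ∧ (x - b) / p ∈ Ico (0 : ℤ) Q := by
  rw [resClass, mem_filter, mem_Ico] at hx
  obtain ⟨⟨h0, h1⟩, h2⟩ := hx
  have hp' : (0 : ℤ) < p := by exact_mod_cast hp
  have hd : x - b = p * (x / p) := by
    rw [← h2]; have := Int.emod_add_mul_ediv x p; linarith
  have hq : (x - b) / p = x / p := by rw [hd]; exact Int.mul_ediv_cancel_left _ hp'.ne'
  rw [hq]
  refine ⟨hd, mem_Ico.2 ⟨Int.ediv_nonneg h0 hp'.le, ?_⟩⟩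
  apply Int.ediv_lt_of_lt_mul hp'
  have : (P : ℤ) ≤ p * Q := by exact_mod_cast hPQ
  linarith

theorem card_shifted_resClass_le (k s : ℕ) {P p Q : ℕ} (hp : 0 < p) (hPQ : P ≤ p * Q) (b : ℤ)
    (c : Fin k → ℤ) :
    #{w ∈ tuples s (resClass P p b) ×ˢ tuples s (resClass P p b) |
      psums k (fun i => w.1 i - b) = psums k (fun i => w.2 i - b) + c}
      ≤ vinogradov k s (Ico (0 : ℤ) Q) := by
  set S := {w ∈ tuples s (resClass P p b) ×ˢ tuples s (resClass P p b) |
      psums k (fun i => w.1 i - b) = psums k (fun i => w.2 i - b) + c} with hS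
  rcases S.eq_empty_or_nonempty with he | ⟨w₀, hw₀⟩
  · simp [he]
  let D : (Fin s → ℤ) → Fin s → ℤ := fun z i => (z i - b) / p
  have hD : ∀ z ∈ tuples s (resClass P p b), (fun i => z i - b) = fun i => (p : ℤ) * D z i := by
    intro z hz
    funext i
    exact (exists_of_mem_resClass hp hPQ (Fintype.mem_piFinset.1 hz i)).1
  have hDmem : ∀ z ∈ tuples s (resClass P p b), D z ∈ tuples s (Ico (0 : ℤ) Q) := by
    intro z hz
    exact Fintype.mem_piFinset.2 fun i =>
      (exists_of_mem_resClass hp hPQ (Fintype.mem_piFinset.1 hz i)).2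
  have hDeq : ∀ w ∈ S, ∀ j : Fin k, (p : ℤ) ^ (j + 1 : ℕ) * (psums k (D w.1) j - psums k (D w.2) j) = c j := by
    intro w hw j
    rw [hS, mem_filter, mem_product] at hw
    have := congrFun hw.2 j
    rw [hD _ hw.1.1, hD _ hw.1.2, Pi.add_apply, psums_mul, psums_mul] at this
    rw [mul_sub, this]; ring
  have hp' : (p : ℤ) ≠ 0 := by exact_mod_cast hp.ne'
  refine le_trans ?_ (card_shifted_le_energy (psums k) (tuples s (Ico (0 : ℤ) Q))
    (psums k (D w₀.1) - psums k (D w₀.2)))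
  apply card_le_card_of_injOn (fun w => (D w.1, D w.2))
  · intro w hw
    have hw' := hw
    simp only [coe_filter, mem_product, Set.mem_ofPred_eq]
    rw [mem_coe, hS, mem_filter, mem_product] at hw
    refine ⟨⟨hDmem _ hw.1.1, hDmem _ hw.1.2⟩, ?_⟩
    funext j
    have h1 := hDeq w hw' j
    rw [← hDeq w₀ hw₀ j] at h1
    have := mul_left_cancel₀ (pow_ne_zero _ hp') h1
    simp only [Pi.add_apply, Pi.sub_apply]
    linarith
  · intro w hw w' hw' h
    simp only [Prod.mk.injEq] at h
    rw [mem_coe, hS, mem_filter, mem_product] at hw hw'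
    have e1 : (fun i => w.1 i - b) = fun i => w'.1 i - b := by
      rw [hD _ hw.1.1, hD _ hw'.1.1, h.1]
    have e2 : (fun i => w.2 i - b) = fun i => w'.2 i - b := by
      rw [hD _ hw.1.2, hD _ hw'.1.2, h.2]
    ext i
    · have := congrFun e1 i; simpa using this
    · have := congrFun e2 i; simpa using this

theorem vinogradov_resClass_le (k s : ℕ) {P p Q : ℕ} (hp : 0 < p) (hPQ : P ≤ p * Q) (b : ℤ) :
    vinogradov k s (resClass P p b) ≤ vinogradov k s (Ico (0 : ℤ) Q) := by
  refine le_trans (card_le_card ?_) (card_shifted_resClass_le k s hp hPQ b 0)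
  apply monotone_filter_right
  intro w _ hw
  have := psums_translate (x := fun i : Fin 0 => 0) (x' := fun i : Fin 0 => 0) b
    (congrArg (psums k (fun i : Fin 0 => 0) + ·) hw)
  rw [add_zero]
  exact add_left_cancel this

theorem energy_mixed_le (k r s : ℕ) {P p Q : ℕ} (hp : 0 < p) (hPQ : P ≤ p * Q) (b : ℤ)
    (X : Finset (Fin r → ℤ)) (L : ℕ)
    (hL : ∀ c : Fin k → ℤ, #{x ∈ X | ∀ j : Fin k,
      psums k (fun i => x i - b) j ≡ c j [ZMOD (p ^ (j + 1 : ℕ) : ℕ)]} ≤ L) :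
    energy (fun w : (Fin r → ℤ) × (Fin s → ℤ) => psums k w.1 + psums k w.2)
      (X ×ˢ tuples s (resClass P p b)) ≤ vinogradov k s (Ico (0 : ℤ) Q) * (L * #X) := by
  classical
  set B := tuples s (resClass P p b) with hB
  set T := {y ∈ X ×ˢ X | ∀ j : Fin k, psums k (fun i => y.1 i - b) j ≡
    psums k (fun i => y.2 i - b) j [ZMOD (p ^ (j + 1 : ℕ) : ℕ)]} with hT
  have hTcard : #T ≤ L * #X := by
    apply card_le_mul_card_image_of_maps_to (f := Prod.snd)
    · intro y hy
      rw [hT, mem_filter, mem_product] at hy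
      exact hy.1.2
    · intro x' _
      refine le_trans ?_ (hL (psums k fun i => x' i - b))
      apply card_le_card_of_injOn Prod.fst
      · intro y hy
        simp only [hT, coe_filter, mem_product, Set.mem_ofPred_eq, mem_filter] at hy ⊢
        obtain ⟨⟨⟨h1, _⟩, h2⟩, rfl⟩ := hy
        exact ⟨h1, h2⟩
      · intro y hy y' hy' h
        simp only [coe_filter, Set.mem_ofPred_eq] at hy hy'
        exact Prod.ext h (hy.2.trans hy'.2.symm)
  have hpow : ∀ z ∈ B, ∀ j : Fin k,
      ((p ^ (j + 1 : ℕ) : ℕ) : ℤ) ∣ psums k (fun i => z i - b) j := by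
    intro z hz j
    apply dvd_sum
    intro i _
    change _ ∣ (z i - b) ^ (j + 1 : ℕ)
    rw [(exists_of_mem_resClass hp hPQ (Fintype.mem_piFinset.1 hz i)).1, mul_pow]
    push_cast
    exact dvd_mul_right _ _
  refine le_trans ?_ (Nat.mul_le_mul_left _ hTcard)
  apply card_le_mul_card_image_of_maps_to
    (f := fun w : ((Fin r → ℤ) × (Fin s → ℤ)) × ((Fin r → ℤ) × (Fin s → ℤ)) => (w.1.1, w.2.1))
  · intro w hw
    simp only [mem_filter, mem_product] at hw
    rw [hT, mem_filter, mem_product]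
    refine ⟨⟨hw.1.1.1, hw.1.2.1⟩, fun j => ?_⟩
    have h := congrFun (psums_translate b hw.2) j
    simp only [Pi.add_apply] at h
    have h1 := hpow _ hw.1.1.2 j
    have h2 := hpow _ hw.1.2.2 j
    rw [Int.modEq_iff_dvd]
    have : psums k (fun i => w.2.1 i - b) j - psums k (fun i => w.1.1 i - b) j
      = psums k (fun i => w.1.2 i - b) j - psums k (fun i => w.2.2 i - b) j := by linarith
    rw [this]
    exact dvd_sub h1 h2
  · intro y _
    refine le_trans ?_ (card_shifted_resClass_le k s hp hPQ b
      (psums k (fun i => y.2 i - b) - psums k (fun i => y.1 i - b)))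
    apply card_le_card_of_injOn (fun w => (w.1.2, w.2.2))
    · intro w hw
      simp only [coe_filter, mem_product, Set.mem_ofPred_eq, mem_filter] at hw ⊢
      obtain ⟨⟨hm, heq⟩, rfl⟩ := hw
      refine ⟨⟨hm.1.2, hm.2.2⟩, ?_⟩
      have h := psums_translate b heq
      dsimp only
      rw [← sub_eq_iff_eq_add'.2 h.symm]
      abel
    · intro w hw w' hw' h
      simp only [coe_filter, Set.mem_ofPred_eq] at hw hw'
      have h3 := hw.2.trans hw'.2.symm
      simp only [Prod.mk.injEq] at h h3
      exact Prod.ext (Prod.ext h3.1 h.1) (Prod.ext h3.2 h.2)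

end MainTerm

section Recurrence

open Finset Filter

theorem sq_mul_pow_le_add {u v ε : ℝ} (hu : 0 ≤ u) (hv : 0 ≤ v) (hε : 0 < ε) (q : ℕ) :
    u ^ 2 * v ^ q ≤ ε ^ 2 * v ^ (q + 2) + (1 / ε) ^ q * u ^ (q + 2) := by
  rcases le_total u (ε * v) with h | h
  · calc u ^ 2 * v ^ q ≤ (ε * v) ^ 2 * v ^ q := by gcongr
      _ = ε ^ 2 * v ^ (q + 2) := by ring
      _ ≤ _ := le_add_of_nonneg_right (by positivity)
  · have h' : v ≤ 1 / ε * u := by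
      rw [one_div, inv_mul_eq_div, le_div_iff₀ hε]; linarith
    calc u ^ 2 * v ^ q ≤ u ^ 2 * (1 / ε * u) ^ q := by gcongr
      _ = (1 / ε) ^ q * u ^ (q + 2) := by rw [mul_pow]; ring
      _ ≤ _ := le_add_of_nonneg_left (by positivity)

theorem sum_pow_le_card_pow_mul_sum_pow {ι : Type*} (S : Finset ι) {f : ι → ℝ}
    (hf : ∀ i ∈ S, 0 ≤ f i) (n : ℕ) :
    (∑ i ∈ S, f i) ^ (n + 1) ≤ (#S : ℝ) ^ n * ∑ i ∈ S, f i ^ (n + 1) := by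
  rcases S.eq_empty_or_nonempty with rfl | hS
  · simp
  have := _root_.pow_sum_div_card_le_sum_pow hf n
  rwa [div_le_iff₀ (by have := hS.card_pos; positivity), mul_comm] at this

theorem resClass_subset (P p : ℕ) (b : ℤ) : resClass P p b ⊆ Ico (0 : ℤ) P := filter_subset _ _

theorem Ico_eq_biUnion_resClass (P : ℕ) {p : ℕ} (hp : 0 < p) :
    Ico (0 : ℤ) P = (range p).biUnion fun a => resClass P p a := by
  ext x
  simp only [mem_biUnion, mem_range, resClass, mem_filter]
  constructor
  · intro hx
    have hp' : (0 : ℤ) < p := by exact_mod_cast hp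
    refine ⟨(x % p).toNat, ?_, hx, ?_⟩
    · have := Int.emod_lt_of_pos x hp'
      have := Int.emod_nonneg x hp'.ne'
      omega
    · rw [Int.toNat_of_nonneg (Int.emod_nonneg x hp'.ne')]
  · rintro ⟨a, _, hx, _⟩
    exact hx

theorem expSum_eq_sum_resClass {k n : ℕ} (ψ : AddChar (Fin k → ZMod (n + 1)) ℂ) (P : ℕ) {p : ℕ}
    (hp : 0 < p) :
    expSum ψ (Ico (0 : ℤ) P) = ∑ a ∈ range p, expSum ψ (resClass P p a) := by
  unfold expSum
  rw [Ico_eq_biUnion_resClass P hp, sum_biUnion]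
  intro a _ b _ hab
  rw [Function.onFun, disjoint_left]
  intro x hx hx'
  simp only [resClass, mem_filter] at hx hx'
  exact hab (by have := hx.2.symm.trans hx'.2; exact_mod_cast this)

/-- The tuples whose `i`-th and `j`-th coordinates agree modulo `p`. -/
noncomputable def coincide (k P p : ℕ) (c : Fin k × Fin k) : Finset (Fin k → ℤ) :=
  {x ∈ tuples k (Ico (0 : ℤ) P) | x c.1 % p = x c.2 % p}

theorem sum_coincide {k n : ℕ} (ψ : AddChar (Fin k → ZMod (n + 1)) ℂ) (P : ℕ) {p : ℕ} (hp : 0 < p)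
    {c : Fin k × Fin k} (hc : c.1 ≠ c.2) :
    ∑ x ∈ coincide k P p c, ψ (reduceMod n (psums k x))
      = (∑ a ∈ range p, expSum ψ (resClass P p a) ^ 2) * expSum ψ (Ico (0 : ℤ) P) ^ (k - 2) := by
  have key : coincide k P p c = (range p).biUnion fun a => Fintype.piFinset fun l =>
      if l ∈ ({c.1, c.2} : Finset (Fin k)) then resClass P p a else Ico (0 : ℤ) P := by
    ext x
    simp only [coincide, tuples, mem_filter, Fintype.mem_piFinset, mem_biUnion]
    constructor
    · rintro ⟨hx, hxc⟩
      have h1 := hx c.1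
      rw [Ico_eq_biUnion_resClass P hp, mem_biUnion] at h1
      obtain ⟨a, ha, ha'⟩ := h1
      refine ⟨a, ha, fun l => ?_⟩
      split_ifs with h
      · simp only [mem_insert, mem_singleton] at h
        rcases h with rfl | rfl
        · exact ha'
        · rw [resClass, mem_filter] at ha' ⊢
          exact ⟨hx _, hxc ▸ ha'.2⟩
      · exact hx l
    · rintro ⟨a, _, h⟩
      have h1 := h c.1
      have h2 := h c.2
      simp only [mem_insert, mem_singleton, true_or, or_true, if_true, resClass, mem_filter] at h1 h2
      refine ⟨fun l => ?_, h1.2.trans h2.2.symm⟩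
      have := h l
      split_ifs at this
      · exact resClass_subset _ _ _ this
      · exact this
  rw [key, sum_biUnion, sum_mul]
  · apply sum_congr rfl
    intro a _
    rw [sum_piFinset_addChar]
    have : ∀ l : Fin k, expSum ψ (if l ∈ ({c.1, c.2} : Finset (Fin k)) then resClass P p a
        else Ico (0 : ℤ) P) = if l ∈ ({c.1, c.2} : Finset (Fin k)) then expSum ψ (resClass P p a)
        else expSum ψ (Ico (0 : ℤ) P) := fun l => by split_ifs <;> rfl
    simp_rw [this]
    rw [prod_ite, prod_const, prod_const, filter_mem_eq_inter, univ_inter, card_pair hc]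
    congr 2
    rw [filter_not, filter_mem_eq_inter, univ_inter, card_sdiff_of_subset (subset_univ _),
      card_pair hc, card_univ, Fintype.card_fin]
  · intro a _ b _ hab
    rw [Function.onFun, disjoint_left]
    intro x hx hx'
    have h1 := Fintype.mem_piFinset.1 hx c.1
    have h2 := Fintype.mem_piFinset.1 hx' c.1
    simp only [mem_insert, mem_singleton, true_or, if_true, resClass, mem_filter] at h1 h2
    exact hab (by have := h1.2.symm.trans h2.2; exact_mod_cast this)

theorem energy_coincide_le {k s P p Q : ℕ} (hk : 2 ≤ k) (hp : 0 < p) (hPQ : P ≤ p * Q)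
    {c : Fin k × Fin k} (hc : c.1 ≠ c.2) {ε : ℝ} (hε : 0 < ε) :
    (energy (fun w : (Fin k → ℤ) × (Fin s → ℤ) => psums k w.1 + psums k w.2)
      (coincide k P p c ×ˢ tuples s (Ico (0 : ℤ) P)) : ℝ)
      ≤ ε ^ 2 * vinogradov k (s + k) (Ico (0 : ℤ) P)
        + (1 / ε) ^ (s + k - 2) * ((p : ℝ) ^ (s + k) * vinogradov k (s + k) (Ico (0 : ℤ) Q)) := by
  have hev : ∀ᶠ n : ℕ in atTop, ∀ a ∈ range p,
      ∑ ψ : AddChar (Fin k → ZMod (n + 1)) ℂ, ‖expSum ψ (resClass P p a)‖ ^ (2 * (s + k))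
        = (n + 1 : ℝ) ^ k * vinogradov k (s + k) (resClass P p a) := by
    rw [Filter.eventually_all_finset]
    intro a _
    exact eventually_sum_expSum_pow k (s + k) _
  obtain ⟨n, h1, h2, h3⟩ := ((eventually_sum_mixed k k s (coincide k P p c) (Ico (0 : ℤ) P)).and
    ((eventually_sum_expSum_pow k (s + k) (Ico (0 : ℤ) P)).and hev)).exists
  have hn : (0 : ℝ) < (n + 1 : ℝ) ^ k := by positivity
  refine le_of_mul_le_mul_left ?_ hn
  rw [← h1]
  have hpt : ∀ ψ : AddChar (Fin k → ZMod (n + 1)) ℂ,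
      ‖∑ x ∈ coincide k P p c, ψ (reduceMod n (psums k x))‖ ^ 2
        * ‖expSum ψ (Ico (0 : ℤ) P)‖ ^ (2 * s)
      ≤ ε ^ 2 * ‖expSum ψ (Ico (0 : ℤ) P)‖ ^ (2 * (s + k)) + (1 / ε) ^ (s + k - 2)
        * ((p : ℝ) ^ (s + k - 1) * ∑ a ∈ range p, ‖expSum ψ (resClass P p a)‖ ^ (2 * (s + k))) := by
    intro ψ
    set u : ℝ := ∑ a ∈ range p, ‖expSum ψ (resClass P p a)‖ ^ 2
    set v : ℝ := ‖expSum ψ (Ico (0 : ℤ) P)‖ ^ 2 with hv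
    have hu : 0 ≤ u := sum_nonneg fun _ _ => by positivity
    have e1 : ‖∑ x ∈ coincide k P p c, ψ (reduceMod n (psums k x))‖
        ≤ u * ‖expSum ψ (Ico (0 : ℤ) P)‖ ^ (k - 2) := by
      rw [sum_coincide ψ P hp hc, norm_mul, norm_pow]
      gcongr
      refine (norm_sum_le _ _).trans (le_of_eq ?_)
      simp only [norm_pow, u]
    have e2 : u ^ (s + k) ≤ (p : ℝ) ^ (s + k - 1)
        * ∑ a ∈ range p, ‖expSum ψ (resClass P p a)‖ ^ (2 * (s + k)) := by
      have := sum_pow_le_card_pow_mul_sum_pow (range p)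
        (f := fun a => ‖expSum ψ (resClass P p a)‖ ^ 2) (fun _ _ => by positivity) (s + k - 1)
      rw [show s + k - 1 + 1 = s + k by omega, card_range] at this
      simpa only [← pow_mul] using this
    have e3 := sq_mul_pow_le_add hu (v := v) (by positivity) hε (s + k - 2)
    rw [show s + k - 2 + 2 = s + k by omega] at e3
    calc _ ≤ (u * ‖expSum ψ (Ico (0 : ℤ) P)‖ ^ (k - 2)) ^ 2
        * ‖expSum ψ (Ico (0 : ℤ) P)‖ ^ (2 * s) := by gcongr
      _ = u ^ 2 * v ^ (s + k - 2) := by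
        rw [hv, ← pow_mul, mul_pow, mul_assoc, ← pow_mul, ← pow_add]
        congr 2; omega
      _ ≤ _ := e3
      _ ≤ _ := by
        rw [hv, ← pow_mul]
        gcongr
  refine (sum_le_sum fun ψ _ => hpt ψ).trans ?_
  rw [sum_add_distrib, ← mul_sum, ← mul_sum, ← mul_sum, h2, sum_comm, sum_congr rfl h3, ← mul_sum]
  have e4 : (∑ a ∈ range p, (vinogradov k (s + k) (resClass P p a) : ℝ))
      ≤ p * vinogradov k (s + k) (Ico (0 : ℤ) Q) := by
    refine (sum_le_card_nsmul _ _ (vinogradov k (s + k) (Ico (0 : ℤ) Q) : ℝ) ?_).trans ?_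
    · intro a _
      exact_mod_cast vinogradov_resClass_le k (s + k) hp hPQ a
    · simp
  have e5 : (p : ℝ) ^ (s + k) = (p : ℝ) ^ (s + k - 1) * p := by
    rw [← pow_succ]; congr 1; omega
  calc _ ≤ ε ^ 2 * ((n + 1 : ℝ) ^ k * vinogradov k (s + k) (Ico (0 : ℤ) P))
      + (1 / ε) ^ (s + k - 2) * ((p : ℝ) ^ (s + k - 1) * ((n + 1 : ℝ) ^ k *
        (p * vinogradov k (s + k) (Ico (0 : ℤ) Q)))) := by gcongr
    _ = _ := by rw [e5]; ring

theorem card_tuples_distinct_modEq_le {k P p : ℕ} (hp : p.Prime) (hkp : k < p) (hP : P ≤ p ^ k)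
    (b : ℤ) (X : Finset (Fin k → ℤ)) (hX : X ⊆ tuples k (Ico (0 : ℤ) P))
    (hd : ∀ x ∈ X, ∀ i j, i ≠ j → ¬ x i ≡ x j [ZMOD p]) (c : Fin k → ℤ) :
    #{x ∈ X | ∀ j : Fin k, psums k (fun i => x i - b) j ≡ c j [ZMOD (p ^ (j + 1 : ℕ) : ℕ)]}
      ≤ k ^ k * p ^ (k * (k - 1) / 2) := by
  apply card_power_sums_modEq_le hp hkp hP b c
  · intro x hx i
    exact Fintype.mem_piFinset.1 (hX (mem_filter.1 hx).1) i
  · intro x hx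
    exact hd x (mem_filter.1 hx).1
  · intro x hx
    exact (mem_filter.1 hx).2

theorem card_tuples (s : ℕ) (A : Finset ℤ) : #(tuples s A) = #A ^ s := by
  simp [tuples]

theorem vinogradov_recurrence {k s P p Q : ℕ} (hk : 2 ≤ k) (hs : 0 < s) (hp : p.Prime) (hkp : k < p)
    (hP : P ≤ p ^ k) (hPQ : P ≤ p * Q) :
    (vinogradov k (s + k) (Ico (0 : ℤ) P) : ℝ)
      ≤ (4 * p ^ (2 * s) * P ^ k * (k ^ k * p ^ (k * (k - 1) / 2))
        + (2 * k ^ 2) ^ (s + k) * p ^ (s + k) * Q ^ (2 * k)) * vinogradov k s (Ico (0 : ℤ) Q) := by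
  classical
  set A := Ico (0 : ℤ) P with hA
  set X := tuples k A with hX
  set G := {x ∈ X | ∀ i j, i ≠ j → ¬ x i ≡ x j [ZMOD p]} with hG
  set H := {x ∈ X | ¬ ∀ i j, i ≠ j → ¬ x i ≡ x j [ZMOD p]} with hH
  set C : Finset (Fin k × Fin k) := {c | c.1 ≠ c.2} with hC
  let φ : (Fin k → ℤ) × (Fin s → ℤ) → Fin k → ℤ := fun w => psums k w.1 + psums k w.2
  have hp0 := hp.pos
  set J : ℝ := (vinogradov k (s + k) A : ℝ) with hJ
  set J' : ℝ := (vinogradov k s (Ico (0 : ℤ) Q) : ℝ) with hJ'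
  have hk0 : (0 : ℝ) < k := by exact_mod_cast (by omega : 0 < k)
  have hcardC : (#C : ℝ) ≤ k ^ 2 := by
    have : #C ≤ k ^ 2 := by
      refine (card_le_univ _).trans ?_
      simp [sq]
    exact_mod_cast this
  have hevG : ∀ᶠ n : ℕ in atTop, ∀ b ∈ range p, ∑ ψ : AddChar (Fin k → ZMod (n + 1)) ℂ,
      ‖∑ x ∈ G, ψ (reduceMod n (psums k x))‖ ^ 2 * ‖expSum ψ (resClass P p b)‖ ^ (2 * s)
      = (n + 1 : ℝ) ^ k * energy φ (G ×ˢ tuples s (resClass P p b)) := by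
    rw [Filter.eventually_all_finset]
    intro b _
    exact eventually_sum_mixed k k s G _
  obtain ⟨n, h1, h2, h3⟩ := ((eventually_sum_expSum_pow k (s + k) A).and
    ((eventually_sum_mixed k k s H A).and hevG)).exists
  have hn : (0 : ℝ) < (n + 1 : ℝ) ^ k := by positivity
  -- the tuples with a coincidence modulo `p`
  have hHle : (energy φ (H ×ˢ tuples s A) : ℝ) ≤ k ^ 2 * (k ^ 2 *
      ((1 / (2 * k ^ 2 : ℝ)) ^ 2 * J + (2 * k ^ 2 : ℝ) ^ (s + k - 2) * (p ^ (s + k) *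
        (Q ^ (2 * k) * J')))) := by
    have e1 : energy φ (H ×ˢ tuples s A)
        ≤ #C * ∑ c ∈ C, energy φ (coincide k P p c ×ˢ tuples s A) := by
      apply energy_le_of_subset_biUnion
      intro w hw
      rw [mem_product, hH, mem_filter] at hw
      obtain ⟨⟨hx, hd⟩, hz⟩ := hw
      push Not at hd
      obtain ⟨i, j, hij, hm⟩ := hd
      rw [mem_biUnion]
      refine ⟨(i, j), by simp [hC, hij], mem_product.2 ⟨?_, hz⟩⟩
      exact mem_filter.2 ⟨hx, hm⟩
    have e2 : ∀ c ∈ C, (energy φ (coincide k P p c ×ˢ tuples s A) : ℝ)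
        ≤ (1 / (2 * k ^ 2 : ℝ)) ^ 2 * J + (2 * k ^ 2 : ℝ) ^ (s + k - 2) * (p ^ (s + k) *
          (Q ^ (2 * k) * J')) := by
      intro c hc
      refine (energy_coincide_le hk hp0 hPQ (mem_filter.1 hc).2
        (ε := 1 / (2 * k ^ 2)) (by positivity)).trans ?_
      rw [one_div_one_div]
      gcongr
      have := vinogradov_add_le k s k (Ico (0 : ℤ) Q)
      rw [Int.card_Ico, sub_zero, Int.toNat_natCast] at this
      rw [hJ']
      exact_mod_cast this
    have e3 : (energy φ (H ×ˢ tuples s A) : ℝ)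
        ≤ #C * ∑ c ∈ C, (energy φ (coincide k P p c ×ˢ tuples s A) : ℝ) := by exact_mod_cast e1
    refine e3.trans ?_
    refine (mul_le_mul_of_nonneg_left (sum_le_card_nsmul _ _ _ e2) (by positivity)).trans ?_
    rw [nsmul_eq_mul]
    gcongr
  -- the well-conditioned tuples
  have hGle : ∑ ψ : AddChar (Fin k → ZMod (n + 1)) ℂ,
      ‖∑ x ∈ G, ψ (reduceMod n (psums k x))‖ ^ 2 * ‖expSum ψ A‖ ^ (2 * s)
      ≤ (n + 1 : ℝ) ^ k * (p ^ (2 * s) * (J' * ((k ^ k * p ^ (k * (k - 1) / 2)) * P ^ k))) := by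
    have e1 : ∀ ψ : AddChar (Fin k → ZMod (n + 1)) ℂ, ‖expSum ψ A‖ ^ (2 * s)
        ≤ (p : ℝ) ^ (2 * s - 1) * ∑ b ∈ range p, ‖expSum ψ (resClass P p b)‖ ^ (2 * s) := by
      intro ψ
      have := sum_pow_le_card_pow_mul_sum_pow (range p)
        (f := fun b => ‖expSum ψ (resClass P p b)‖) (fun _ _ => norm_nonneg _) (2 * s - 1)
      rw [show 2 * s - 1 + 1 = 2 * s by omega, card_range] at this
      refine le_trans ?_ this
      rw [hA, expSum_eq_sum_resClass ψ P hp0]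
      gcongr
      exact norm_sum_le _ _
    have hGX : #G ≤ P ^ k := by
      refine (card_filter_le _ _).trans ?_
      rw [hX, card_tuples, hA, Int.card_Ico, sub_zero, Int.toNat_natCast]
    have e2 : ∀ b ∈ range p, (energy φ (G ×ˢ tuples s (resClass P p b)) : ℝ)
        ≤ J' * ((k ^ k * p ^ (k * (k - 1) / 2)) * P ^ k) := by
      intro b _
      have h := energy_mixed_le k k s hp0 hPQ (b : ℤ) G (k ^ k * p ^ (k * (k - 1) / 2))
        (card_tuples_distinct_modEq_le hp hkp hP b G (filter_subset _ _)
          (fun x hx => (mem_filter.1 hx).2))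
      have h' := h.trans (Nat.mul_le_mul_left _ (Nat.mul_le_mul_left _ hGX))
      rw [hJ']
      exact_mod_cast h'
    calc _ ≤ ∑ ψ : AddChar (Fin k → ZMod (n + 1)) ℂ,
          ‖∑ x ∈ G, ψ (reduceMod n (psums k x))‖ ^ 2 * ((p : ℝ) ^ (2 * s - 1) *
            ∑ b ∈ range p, ‖expSum ψ (resClass P p b)‖ ^ (2 * s)) := by
          apply sum_le_sum
          intro ψ _
          gcongr
          exact e1 ψ
      _ = (p : ℝ) ^ (2 * s - 1) * ∑ b ∈ range p, ∑ ψ : AddChar (Fin k → ZMod (n + 1)) ℂ,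
          ‖∑ x ∈ G, ψ (reduceMod n (psums k x))‖ ^ 2 * ‖expSum ψ (resClass P p b)‖ ^ (2 * s) := by
          rw [sum_comm, mul_sum]
          apply sum_congr rfl
          intro ψ _
          rw [← mul_sum]; ring
      _ = (p : ℝ) ^ (2 * s - 1) * ((n + 1 : ℝ) ^ k *
          ∑ b ∈ range p, (energy φ (G ×ˢ tuples s (resClass P p b)) : ℝ)) := by
          rw [sum_congr rfl h3, ← mul_sum]
      _ ≤ (p : ℝ) ^ (2 * s - 1) * ((n + 1 : ℝ) ^ k *
          (p * (J' * ((k ^ k * p ^ (k * (k - 1) / 2)) * P ^ k)))) := by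
          gcongr
          refine (sum_le_card_nsmul _ _ _ e2).trans ?_
          simp
      _ = _ := by
          rw [show (p : ℝ) ^ (2 * s) = (p : ℝ) ^ (2 * s - 1) * p by
            rw [← pow_succ]; congr 1; omega]
          ring
  have hsplit : ∀ ψ : AddChar (Fin k → ZMod (n + 1)) ℂ, ‖expSum ψ A‖ ^ (2 * (s + k))
      ≤ 2 * (‖∑ x ∈ G, ψ (reduceMod n (psums k x))‖ ^ 2 * ‖expSum ψ A‖ ^ (2 * s))
        + 2 * (‖∑ x ∈ H, ψ (reduceMod n (psums k x))‖ ^ 2 * ‖expSum ψ A‖ ^ (2 * s)) := by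
    intro ψ
    have e : expSum ψ A ^ k = ∑ x ∈ G, ψ (reduceMod n (psums k x))
        + ∑ x ∈ H, ψ (reduceMod n (psums k x)) := by
      rw [← sum_tuples_addChar, hG, hH, sum_filter_add_sum_filter_not]
    have e' : ‖expSum ψ A‖ ^ (2 * (s + k)) = ‖expSum ψ A ^ k‖ ^ 2 * ‖expSum ψ A‖ ^ (2 * s) := by
      rw [norm_pow]; ring
    rw [e', e, ← mul_add, ← add_mul, ← mul_assoc]
    gcongr
    set g := ∑ x ∈ G, ψ (reduceMod n (psums k x))
    set h := ∑ x ∈ H, ψ (reduceMod n (psums k x))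
    nlinarith [norm_add_le g h, norm_nonneg (g + h), sq_nonneg (‖g‖ - ‖h‖), norm_nonneg g,
      norm_nonneg h]
  have htot : (n + 1 : ℝ) ^ k * J ≤ (n + 1 : ℝ) ^ k *
      (2 * (p ^ (2 * s) * (J' * ((k ^ k * p ^ (k * (k - 1) / 2)) * P ^ k)))
        + 2 * (k ^ 2 * (k ^ 2 * ((1 / (2 * k ^ 2 : ℝ)) ^ 2 * J +
          (2 * k ^ 2 : ℝ) ^ (s + k - 2) * (p ^ (s + k) * (Q ^ (2 * k) * J')))))) := by
    rw [hJ, ← h1]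
    refine (sum_le_sum fun ψ _ => hsplit ψ).trans ?_
    rw [sum_add_distrib, ← mul_sum, ← mul_sum, h2, mul_add]
    have := mul_le_mul_of_nonneg_left hHle hn.le
    linarith
  have hfin := le_of_mul_le_mul_left htot hn
  have e5 : (2 * k ^ 2 : ℝ) ^ (s + k) = (2 * k ^ 2 : ℝ) ^ (s + k - 2) * (2 * k ^ 2) ^ 2 := by
    rw [← pow_add]; congr 1; omega
  have e6 : (k : ℝ) ^ 2 * (k ^ 2 * ((1 / (2 * k ^ 2 : ℝ)) ^ 2 * J)) = J / 4 := by
    field_simp; ring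
  rw [e5]
  rw [mul_add, mul_add, e6] at hfin
  linarith

end Recurrence

section MeanValue

open Finset Filter

theorem exists_prime_modulus {k P : ℕ} (hk : 2 ≤ k) {R : ℝ} (hR : (k : ℝ) ≤ R)
    (hRP : R ^ k = P) :
    ∃ p Q : ℕ, p.Prime ∧ k < p ∧ P ≤ p ^ k ∧ P ≤ p * Q ∧ 1 ≤ Q ∧ (p : ℝ) ≤ 3 * R ∧
      (Q : ℝ) ≤ 2 * R ^ (k - 1) := by
  have hk2 : (2 : ℝ) ≤ k := by exact_mod_cast hk
  have hR0 : 0 < R := by linarith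
  obtain ⟨p, hp, h1, h2⟩ := Nat.exists_prime_lt_and_le_two_mul ⌈R⌉₊ (by positivity)
  have hRp : R < p := (Nat.le_ceil R).trans_lt (by exact_mod_cast h1)
  have hp3 : (p : ℝ) ≤ 3 * R := by
    have : (p : ℝ) ≤ 2 * ⌈R⌉₊ := by exact_mod_cast h2
    have := Nat.ceil_lt_add_one hR0.le
    linarith
  have hpow : R ^ k = R * R ^ (k - 1) := by rw [← pow_succ']; congr 1; omega
  refine ⟨p, P / p + 1, hp, ?_, ?_, ?_, Nat.le_add_left 1 _, hp3, ?_⟩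
  · exact_mod_cast hR.trans_lt hRp
  · have : (P : ℝ) ≤ (p : ℝ) ^ k := by rw [← hRP]; gcongr
    exact_mod_cast this
  · exact (Nat.lt_mul_div_succ P hp.pos).le
  · push_cast
    have h3 : ((P / p : ℕ) : ℝ) ≤ R ^ (k - 1) := by
      refine Nat.cast_div_le.trans ?_
      rw [div_le_iff₀ (by linarith), ← hRP, hpow, mul_comm]
      gcongr
    have h4 : 1 ≤ R ^ (k - 1) := one_le_pow₀ (by linarith)
    linarith

set_option maxHeartbeats 1600000 in
theorem mean_value_step {k s : ℕ} (hk : 2 ≤ k) (hs : k ^ 2 ≤ s) (hs' : s + k ≤ 11 * k ^ 2)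
    {η C : ℝ} (hη : 0 ≤ η) (hηK : η ≤ k * (k + 1) / 2) (hC : 0 ≤ C)
    (ih : ∀ P : ℕ, 1 ≤ P → (vinogradov k s (Ico (0 : ℤ) P) : ℝ)
      ≤ C * (P : ℝ) ^ (2 * s - k * (k + 1) / 2 + η : ℝ)) (P : ℕ) (hP : 1 ≤ P) :
    (vinogradov k (s + k) (Ico (0 : ℤ) P) : ℝ)
      ≤ (k : ℝ) ^ (80 * k ^ 2 : ℝ) * C *
        (P : ℝ) ^ (2 * (s + k : ℕ) - k * (k + 1) / 2 + (η - η / k) : ℝ) := by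
  have hk2 : (2 : ℝ) ≤ k := by exact_mod_cast hk
  have hk0 : (0 : ℝ) < k := by linarith
  have hk1 : (1 : ℝ) ≤ k := by linarith
  have hP0 : (0 : ℝ) < P := by exact_mod_cast hP
  have hP1 : (1 : ℝ) ≤ P := by exact_mod_cast hP
  have hsr : (k : ℝ) ^ 2 ≤ s := by exact_mod_cast hs
  have hsr' : (s : ℝ) + k ≤ 11 * k ^ 2 := by exact_mod_cast hs'
  rcases lt_or_ge P (k ^ k) with hsmall | hlarge
  · have h1 : (vinogradov k (s + k) (Ico (0 : ℤ) P) : ℝ)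
        ≤ (P : ℝ) ^ (2 * k) * vinogradov k s (Ico (0 : ℤ) P) := by
      have := vinogradov_add_le k s k (Ico (0 : ℤ) P)
      rw [Int.card_Ico, sub_zero, Int.toNat_natCast] at this
      exact_mod_cast this
    have h2 : (P : ℝ) ^ (η / k) ≤ (k : ℝ) ^ (80 * k ^ 2 : ℝ) := by
      have hPk : (P : ℝ) ≤ (k : ℝ) ^ (k : ℝ) := by
        rw [Real.rpow_natCast]; exact_mod_cast hsmall.le
      calc (P : ℝ) ^ (η / k) ≤ ((k : ℝ) ^ (k : ℝ)) ^ (η / k) := by gcongr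
        _ = (k : ℝ) ^ η := by
          rw [← Real.rpow_mul hk0.le]; congr 1; field_simp
        _ ≤ _ := by
          apply Real.rpow_le_rpow_of_exponent_le hk1
          nlinarith
    calc _ ≤ (P : ℝ) ^ (2 * k) * (C * (P : ℝ) ^ (2 * s - k * (k + 1) / 2 + η : ℝ)) :=
          h1.trans (by gcongr; exact ih P hP)
      _ = (P : ℝ) ^ (η / k) * C *
          (P : ℝ) ^ (2 * (s + k : ℕ) - k * (k + 1) / 2 + (η - η / k) : ℝ) := by
          have e : (P : ℝ) ^ (2 * k) = (P : ℝ) ^ (2 * k : ℝ) := by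
            rw [← Real.rpow_natCast]; push_cast; rfl
          rw [e, mul_left_comm, ← Real.rpow_add hP0, mul_comm ((P : ℝ) ^ (η / k)), mul_assoc,
            ← Real.rpow_add hP0]
          push_cast
          congr 2; ring
      _ ≤ _ := by gcongr
  set R : ℝ := (P : ℝ) ^ (1 / k : ℝ) with hR
  have hRP : R ^ k = P := by
    rw [hR, ← Real.rpow_natCast, ← Real.rpow_mul hP0.le]
    rw [one_div, inv_mul_cancel₀ hk0.ne', Real.rpow_one]
  have hkR : (k : ℝ) ≤ R := by
    have : ((k : ℝ) ^ k) ≤ R ^ k := by rw [hRP]; exact_mod_cast hlarge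
    exact le_of_pow_le_pow_left₀ (by omega) (by positivity) this
  have hR0 : 0 < R := by linarith
  have hR1 : 1 ≤ R := by linarith
  obtain ⟨p, Q, hp, hkp, hPp, hPQ, hQ, hp3, hQ2⟩ := exists_prime_modulus hk hkR hRP
  have hrec := vinogradov_recurrence hk (s := s) (by nlinarith) hp hkp hPp hPQ
  set N := k * (k - 1) / 2 with hN
  have hNr : (N : ℝ) = k * (k - 1) / 2 := by
    rw [hN, Nat.cast_div (Nat.even_mul_pred_self k).two_dvd (by norm_num)]
    rw [Nat.cast_mul, Nat.cast_sub (by omega)]; norm_num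
  set E : ℝ := 2 * s - k * (k + 1) / 2 + η with hE
  have hE0 : 0 ≤ E := by rw [hE]; nlinarith
  have hE2 : E ≤ 2 * s := by rw [hE]; linarith
  have hpb : (p : ℝ) ≤ (k : ℝ) ^ (2 : ℝ) * R := by
    rw [Real.rpow_two]
    exact hp3.trans (by gcongr; nlinarith)
  have hQb : (Q : ℝ) ≤ k * R ^ (k - 1 : ℝ) := by
    have : R ^ (k - 1 : ℝ) = R ^ (k - 1) := by
      rw [← Real.rpow_natCast, Nat.cast_sub (by omega)]; norm_num
    rw [this]
    exact hQ2.trans (by gcongr)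
  have hppow : ∀ n : ℕ, (p : ℝ) ^ n ≤ (k : ℝ) ^ (2 * n : ℝ) * R ^ (n : ℝ) := by
    intro n
    calc (p : ℝ) ^ n ≤ ((k : ℝ) ^ (2 : ℝ) * R) ^ n := by gcongr
      _ = _ := by
        rw [mul_pow, Real.rpow_mul hk0.le, Real.rpow_natCast, Real.rpow_natCast]
  have hQpow : ∀ x : ℝ, 0 ≤ x → (Q : ℝ) ^ x ≤ (k : ℝ) ^ x * R ^ ((k - 1) * x : ℝ) := by
    intro x hx
    calc (Q : ℝ) ^ x ≤ (k * R ^ (k - 1 : ℝ)) ^ x := by gcongr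
      _ = _ := by
        rw [Real.mul_rpow hk0.le (by positivity), ← Real.rpow_mul hR0.le]
  set F : ℝ := k * (2 * (s + k : ℕ) - k * (k + 1) / 2 + (η - η / k)) with hF
  have hF' : F = k * (2 * (s + k) - k * (k + 1) / 2 + η) - η := by
    rw [hF]; push_cast; field_simp; ring
  have hPF : (P : ℝ) ^ (2 * (s + k : ℕ) - k * (k + 1) / 2 + (η - η / k) : ℝ) = R ^ F := by
    rw [← hRP, ← Real.rpow_natCast R k, ← Real.rpow_mul hR0.le]
  have ht1 : (4 * p ^ (2 * s) * P ^ k * (k ^ k * p ^ N)) * (Q : ℝ) ^ E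
      ≤ (k : ℝ) ^ (78 * k ^ 2 : ℝ) * R ^ F := by
    have e1 : (2 + 4 * s + k + 2 * N + E : ℝ) ≤ 78 * k ^ 2 := by
      have e' : (k : ℝ) * (k - 1) = k ^ 2 - k := by ring
      rw [hNr, e']
      linarith only [sq_nonneg (k : ℝ), hk2, hsr', hE2]
    have h4 : (4 : ℝ) ≤ (k : ℝ) ^ (2 : ℝ) := by rw [Real.rpow_two]; nlinarith
    have hPk : (P : ℝ) ^ k = R ^ (k ^ 2 : ℝ) := by
      rw [← hRP, ← pow_mul, ← Real.rpow_natCast]; push_cast; rw [sq]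
    calc _ ≤ ((k : ℝ) ^ (2 : ℝ) * ((k : ℝ) ^ (2 * (2 * s : ℕ) : ℝ) * R ^ ((2 * s : ℕ) : ℝ))
          * R ^ (k ^ 2 : ℝ) * ((k : ℝ) ^ (k : ℝ) * ((k : ℝ) ^ (2 * N : ℝ) * R ^ (N : ℝ))))
          * ((k : ℝ) ^ E * R ^ ((k - 1) * E : ℝ)) := by
          rw [hPk, Real.rpow_natCast (k : ℝ) k]
          gcongr
          · exact hppow _
          · exact hppow _
          · exact hQpow _ hE0
      _ = (k : ℝ) ^ (2 + 4 * s + k + 2 * N + E : ℝ) * R ^ (2 * s + k ^ 2 + N + (k - 1) * E : ℝ) := by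
          simp only [Real.rpow_add hk0, Real.rpow_add hR0]
          push_cast
          rw [show (2 * (2 * s) : ℝ) = 4 * s by ring]
          ring
      _ ≤ _ := by
          have e : (2 * s + k ^ 2 + N + (k - 1) * E : ℝ) = F := by
            rw [hF', hNr, hE]; ring
          rw [e]
          gcongr
  have ht2 : ((2 * k ^ 2) ^ (s + k) * p ^ (s + k) * Q ^ (2 * k)) * (Q : ℝ) ^ E
      ≤ (k : ℝ) ^ (78 * k ^ 2 : ℝ) * R ^ F := by
    have h2k : (2 * k ^ 2 : ℝ) ^ (s + k) ≤ (k : ℝ) ^ (3 * (s + k : ℕ) : ℝ) := by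
      rw [Real.rpow_mul hk0.le, Real.rpow_natCast, show (k : ℝ) ^ (3 : ℝ) = k ^ (3 : ℕ) by
        norm_cast]
      gcongr
      nlinarith [sq_nonneg (k : ℝ)]
    have hQ2k : (Q : ℝ) ^ (2 * k) ≤ (k : ℝ) ^ (2 * k : ℝ) * R ^ ((k - 1) * (2 * k) : ℝ) := by
      have := hQpow (2 * k) (by positivity)
      rwa [show (Q : ℝ) ^ (2 * k : ℝ) = (Q : ℝ) ^ (2 * k) by
        rw [← Real.rpow_natCast]; push_cast; rfl] at this
    calc _ ≤ ((k : ℝ) ^ (3 * (s + k : ℕ) : ℝ) * ((k : ℝ) ^ (2 * (s + k : ℕ) : ℝ)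
          * R ^ ((s + k : ℕ) : ℝ)) * ((k : ℝ) ^ (2 * k : ℝ) * R ^ ((k - 1) * (2 * k) : ℝ)))
          * ((k : ℝ) ^ E * R ^ ((k - 1) * E : ℝ)) := by
          gcongr
          · exact hppow _
          · exact hQpow _ hE0
      _ = (k : ℝ) ^ (5 * (s + k) + 2 * k + E : ℝ)
          * R ^ (s + k + (k - 1) * (2 * k) + (k - 1) * E : ℝ) := by
          push_cast
          rw [show (5 * (s + k) + 2 * k + E : ℝ) = 3 * (s + k) + 2 * (s + k) + 2 * k + E by ring]
          rw [Real.rpow_add hk0 (_ + _) E, Real.rpow_add hk0 (_ + _) (2 * k),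
            Real.rpow_add hk0 (3 * (s + k) : ℝ), Real.rpow_add hR0 _ ((k - 1) * E : ℝ),
            Real.rpow_add hR0 _ ((k - 1) * (2 * k) : ℝ)]
          ring
      _ ≤ _ := by
          gcongr
          · nlinarith
          · rw [hF', hE]; nlinarith
  have hk78 : 2 * (k : ℝ) ^ (78 * k ^ 2 : ℝ) ≤ (k : ℝ) ^ (80 * k ^ 2 : ℝ) := by
    calc 2 * (k : ℝ) ^ (78 * k ^ 2 : ℝ) ≤ (k : ℝ) ^ (1 : ℝ) * (k : ℝ) ^ (78 * k ^ 2 : ℝ) := by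
          rw [Real.rpow_one]; gcongr
      _ = (k : ℝ) ^ (1 + 78 * k ^ 2 : ℝ) := by rw [Real.rpow_add hk0]
      _ ≤ _ := by
          apply Real.rpow_le_rpow_of_exponent_le hk1
          nlinarith
  rw [hPF]
  calc _ ≤ (4 * p ^ (2 * s) * P ^ k * (k ^ k * p ^ N)
        + (2 * k ^ 2) ^ (s + k) * p ^ (s + k) * Q ^ (2 * k)) * (C * (Q : ℝ) ^ E) := by
        refine hrec.trans ?_
        gcongr
        exact ih Q hQ
    _ = C * ((4 * p ^ (2 * s) * P ^ k * (k ^ k * p ^ N)) * (Q : ℝ) ^ E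
        + ((2 * k ^ 2) ^ (s + k) * p ^ (s + k) * Q ^ (2 * k)) * (Q : ℝ) ^ E) := by ring
    _ ≤ C * ((k : ℝ) ^ (78 * k ^ 2 : ℝ) * R ^ F + (k : ℝ) ^ (78 * k ^ 2 : ℝ) * R ^ F) := by gcongr
    _ = (2 * (k : ℝ) ^ (78 * k ^ 2 : ℝ)) * C * R ^ F := by ring
    _ ≤ _ := by gcongr

theorem vinogradov_mean_value {k : ℕ} (hk : 2 ≤ k) {P : ℕ} (hP : 1 ≤ P) :
    (vinogradov k (11 * k ^ 2) (Ico (0 : ℤ) P) : ℝ)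
      ≤ (k : ℝ) ^ (800 * k ^ 3 : ℝ) *
        (P : ℝ) ^ (22 * k ^ 2 - k * (k + 1) / 2 + k * (k + 1) / 2 / 20000 : ℝ) := by
  have hk2 : (2 : ℝ) ≤ k := by exact_mod_cast hk
  have hk0 : (0 : ℝ) < k := by linarith
  have hq0 : (0 : ℝ) ≤ 1 - 1 / k := by
    rw [sub_nonneg, div_le_one hk0]; linarith
  have hq1 : (1 : ℝ) - 1 / k ≤ 1 := by
    have : (0 : ℝ) ≤ 1 / k := by positivity
    linarith
  have key : ∀ l : ℕ, l ≤ 10 * k → ∀ P : ℕ, 1 ≤ P →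
      (vinogradov k (k ^ 2 + k * l) (Ico (0 : ℤ) P) : ℝ) ≤ (k : ℝ) ^ (80 * k ^ 2 * l : ℝ) *
        (P : ℝ) ^ (2 * (k ^ 2 + k * l : ℕ) - k * (k + 1) / 2
          + k * (k + 1) / 2 * (1 - 1 / k) ^ l : ℝ) := by
    intro l
    induction l with
    | zero =>
      intro _ P _
      have := vinogradov_le_card_pow k (k ^ 2) (Ico (0 : ℤ) P)
      rw [Int.card_Ico, sub_zero, Int.toNat_natCast] at this
      have h : (vinogradov k (k ^ 2) (Ico (0 : ℤ) P) : ℝ) ≤ (P : ℝ) ^ (2 * k ^ 2) := by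
        exact_mod_cast this
      simp only [mul_zero, add_zero, Nat.cast_zero, Real.rpow_zero, one_mul, pow_zero, mul_one,
        sub_add_cancel]
      refine h.trans (le_of_eq ?_)
      rw [← Real.rpow_natCast]; push_cast; rfl
    | succ l ih =>
      intro hl P hP
      have h := mean_value_step hk (s := k ^ 2 + k * l) (by omega) (by nlinarith)
        (η := k * (k + 1) / 2 * (1 - 1 / k) ^ l) (by positivity)
        (mul_le_of_le_one_right (by positivity) (pow_le_one₀ hq0 hq1))
        (by positivity) (ih (by omega)) P hP
      rw [← Real.rpow_add hk0] at h
      have e1 : k ^ 2 + k * (l + 1) = k ^ 2 + k * l + k := by ring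
      rw [e1]
      refine h.trans (le_of_eq ?_)
      congr 2
      · push_cast; ring
      · rw [pow_succ]; ring
  have h := key (10 * k) le_rfl P hP
  have e : k ^ 2 + k * (10 * k) = 11 * k ^ 2 := by ring
  rw [e] at h
  refine h.trans ?_
  have hexp : ((1 : ℝ) - 1 / k) ^ (10 * k) ≤ 1 / 20000 := by
    have h1 : (1 : ℝ) - 1 / k ≤ Real.exp (-(1 / k)) := by
      have := Real.add_one_le_exp (-(1 / k : ℝ)); linarith
    calc ((1 : ℝ) - 1 / k) ^ (10 * k) ≤ Real.exp (-(1 / k)) ^ (10 * k) := by gcongr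
      _ = Real.exp (-10) := by
        rw [← Real.exp_nat_mul]; congr 1; push_cast; field_simp
      _ ≤ 1 / 20000 := by
        rw [Real.exp_neg, ← one_div]
        apply one_div_le_one_div_of_le (by norm_num)
        have h2 : (2.7 : ℝ) ≤ Real.exp 1 := by have := Real.exp_one_gt_d9; linarith
        calc (20000 : ℝ) ≤ 2.7 ^ 10 := by norm_num
          _ ≤ Real.exp 1 ^ 10 := by gcongr
          _ = Real.exp 10 := by rw [← Real.exp_nat_mul]; norm_num
  have hP1 : (1 : ℝ) ≤ P := by exact_mod_cast hP
  apply mul_le_mul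
  · apply le_of_eq; congr 1; push_cast; ring
  · apply Real.rpow_le_rpow_of_exponent_le hP1
    push_cast
    have : (k * (k + 1) / 2 : ℝ) * (1 - 1 / k) ^ (10 * k) ≤ k * (k + 1) / 2 * (1 / 20000) := by
      gcongr
    linarith
  · positivity
  · positivity

end MeanValue

section Bilinear

open Finset Real

/-- The point of the unit circle with argument `θ`. -/
noncomputable def phase (θ : ℝ) : ℂ := Complex.exp (θ * Complex.I)

theorem norm_phase (θ : ℝ) : ‖phase θ‖ = 1 := Complex.norm_exp_ofReal_mul_I θ

theorem phase_add (θ η : ℝ) : phase (θ + η) = phase θ * phase η := by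
  rw [phase, phase, phase, ← Complex.exp_add]; congr 1; push_cast; ring

theorem phase_zero : phase 0 = 1 := by simp [phase]

theorem conj_phase (θ : ℝ) : (starRingEnd ℂ) (phase θ) = phase (-θ) := by
  rw [phase, phase, ← Complex.exp_conj]
  congr 1
  simp

theorem phase_sum {ι : Type*} (S : Finset ι) (f : ι → ℝ) :
    phase (∑ i ∈ S, f i) = ∏ i ∈ S, phase (f i) := by
  classical
  induction S using Finset.induction with
  | empty => simp [phase_zero]
  | insert a S ha ih => rw [sum_insert ha, prod_insert ha, phase_add, ih]

theorem phase_sub_one_norm_ge {θ : ℝ} (h : |θ| ≤ π) : 2 / π * |θ| ≤ ‖phase θ - 1‖ := by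
  have h1 := Real.mul_abs_le_abs_sin (x := θ / 2) (by rw [abs_div]; norm_num; linarith)
  have h2 : ‖phase θ - 1‖ = 2 * |Real.sin (θ / 2)| := by
    have := Complex.norm_exp_I_mul_ofReal_sub_one θ
    rw [phase, mul_comm, this, Real.norm_eq_abs, abs_mul]; norm_num
  rw [h2]
  rw [abs_div] at h1; norm_num at h1
  have e : 2 / π * |θ| = 2 * (|θ| / π) := by ring
  linarith

/-- The Weyl sum over `A` with coefficients `β` in degrees `1, …, k`. -/
noncomputable def weylSum {k : ℕ} (β : Fin k → ℝ) (A : Finset ℤ) : ℂ :=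
  ∑ y ∈ A, phase (∑ j, β j * (y : ℝ) ^ (j + 1 : ℕ))

theorem weylSum_pow {k : ℕ} (s : ℕ) (β : Fin k → ℝ) (A : Finset ℤ) :
    weylSum β A ^ s = ∑ y ∈ tuples s A, phase (∑ j, β j * (psums k y j : ℝ)) := by
  have h : ∀ y : Fin s → ℤ, phase (∑ j, β j * (psums k y j : ℝ))
      = ∏ i, phase (∑ j, β j * (y i : ℝ) ^ (j + 1 : ℕ)) := by
    intro y
    rw [← phase_sum, sum_comm]
    congr 1
    apply sum_congr rfl
    intro j _
    rw [← mul_sum, psums]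
    push_cast
    rfl
  simp_rw [h]
  rw [tuples]
  refine Eq.trans ?_ (prod_univ_sum (fun _ => A)
    fun _ a => phase (∑ j, β j * (a : ℝ) ^ (j + 1 : ℕ)))
  rw [prod_const, card_univ, Fintype.card_fin, weylSum]

theorem norm_weylSum_pow {k : ℕ} (s : ℕ) (β : Fin k → ℝ) (A : Finset ℤ) :
    ((‖weylSum β A‖ ^ (2 * s) : ℝ) : ℂ) = ∑ w ∈ tuples s A ×ˢ tuples s A,
      phase (∑ j, β j * ((psums k w.1 - psums k w.2) j : ℝ)) := by
  rw [pow_mul', ← norm_pow, Complex.ofReal_pow, ← Complex.mul_conj', weylSum_pow, map_sum,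
    sum_mul_sum, sum_product]
  apply sum_congr rfl
  intro y _
  apply sum_congr rfl
  intro z _
  rw [conj_phase, ← phase_add]
  congr 1
  rw [← sub_eq_add_neg, ← sum_sub_distrib]
  apply sum_congr rfl
  intro j _
  rw [Pi.sub_apply]
  push_cast
  ring

/-- The integers of absolute value at most `s * X ^ j`. -/
noncomputable def symBox (s X j : ℕ) : Finset ℤ := Icc (-(s * X ^ j : ℕ)) (s * X ^ j : ℕ)

/-- The bilinear average `∑ v, |∑ u, exp (i α u v)|` over `symBox`. -/
noncomputable def boxAverage (α : ℝ) (s X j : ℕ) : ℝ :=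
  ∑ v ∈ symBox s X j, ‖∑ u ∈ symBox s X j, phase (α * u * v)‖

theorem psums_sub_mem {k s X : ℕ} {w : (Fin s → ℤ) × (Fin s → ℤ)}
    (hw : w ∈ tuples s (Ico (0 : ℤ) X) ×ˢ tuples s (Ico (0 : ℤ) X)) :
    psums k w.1 - psums k w.2 ∈ Fintype.piFinset fun j : Fin k => symBox s X (j + 1) := by
  have key : ∀ y ∈ tuples s (Ico (0 : ℤ) X), ∀ j : Fin k,
      0 ≤ psums k y j ∧ psums k y j ≤ (s * X ^ (j + 1 : ℕ) : ℕ) := by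
    intro y hy j
    have hy' : ∀ i, 0 ≤ y i ∧ y i < X := fun i => mem_Ico.1 (Fintype.mem_piFinset.1 hy i)
    constructor
    · exact sum_nonneg fun i _ => pow_nonneg (hy' i).1 _
    · refine (sum_le_card_nsmul _ _ ((X : ℤ) ^ (j + 1 : ℕ)) fun i _ => ?_).trans ?_
      · exact pow_le_pow_left₀ (hy' i).1 (hy' i).2.le _
      · simp
  rw [mem_product] at hw
  rw [Fintype.mem_piFinset]
  intro j
  have h1 := key _ hw.1 j
  have h2 := key _ hw.2 j
  rw [symBox, mem_Icc, Pi.sub_apply]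
  constructor <;> linarith [h1.1, h1.2, h2.1, h2.2]

theorem norm_bilinear_pow_le {k s X : ℕ} (hs : 1 ≤ s) (α : Fin k → ℝ) :
    ‖∑ x ∈ Ico (0 : ℤ) X, weylSum (fun j => α j * (x : ℝ) ^ (j + 1 : ℕ)) (Ico (0 : ℤ) X)‖
        ^ (4 * s ^ 2)
      ≤ (X : ℝ) ^ (8 * s ^ 2 - 4 * s) * (vinogradov k s (Ico (0 : ℤ) X) : ℝ) ^ 2
        * ∏ j : Fin k, boxAverage (α j) s X (j + 1) := by
  classical
  set A := Ico (0 : ℤ) X with hA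
  have hcA : #A = X := by rw [hA, Int.card_Ico, sub_zero, Int.toNat_natCast]
  set Y := tuples s A ×ˢ tuples s A with hY
  have hcY : #Y = X ^ (2 * s) := by
    rw [hY, card_product, card_tuples, hcA]; ring
  set B := Fintype.piFinset fun j : Fin k => symBox s X (j + 1) with hB
  let D : (Fin s → ℤ) × (Fin s → ℤ) → Fin k → ℤ := fun w => psums k w.1 - psums k w.2
  have hDB : ∀ w ∈ Y, D w ∈ B := fun w hw => psums_sub_mem hw
  let ν : (Fin k → ℤ) → ℕ := fun u => #{w ∈ Y | D w = u}
  set J : ℝ := (vinogradov k s A : ℝ) with hJ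
  have hνJ : ∀ u, (ν u : ℝ) ≤ J := by
    intro u
    have h := card_shifted_le_energy (psums k (s := s)) (tuples s A) u
    have e : ν u = #{w ∈ tuples s A ×ˢ tuples s A | psums k w.1 = psums k w.2 + u} := by
      simp only [ν]
      congr 1
      apply filter_congr
      intro w _
      exact sub_eq_iff_eq_add'
    rw [hJ, e]
    exact_mod_cast h
  have hfib : ∀ F : (Fin k → ℤ) → ℝ, ∑ w ∈ Y, F (D w) = ∑ u ∈ B, (ν u : ℝ) * F u := by
    intro F
    rw [← sum_fiberwise_of_maps_to hDB]
    apply sum_congr rfl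
    intro u _
    rw [sum_congr rfl (g := fun _ => F u) (fun w hw => by rw [(mem_filter.1 hw).2]), sum_const,
      nsmul_eq_mul]
  have hνsum : ∑ u ∈ B, (ν u : ℝ) = (X : ℝ) ^ (2 * s) := by
    have := hfib fun _ => 1
    simp only [sum_const, hcY, nsmul_eq_mul, mul_one] at this
    rw [← this]; push_cast; rfl
  let V : (Fin k → ℤ) → ℝ := fun u => ‖weylSum (fun j => α j * (u j : ℝ)) A‖
  set S : ℤ → ℂ := fun x => weylSum (fun j => α j * (x : ℝ) ^ (j + 1 : ℕ)) A with hS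
  -- first application of the Hölder inequality
  have h1 : ‖∑ x ∈ A, S x‖ ^ (2 * s) ≤ (X : ℝ) ^ (2 * s - 1) * ∑ x ∈ A, ‖S x‖ ^ (2 * s) := by
    have := sum_pow_le_card_pow_mul_sum_pow A (f := fun x => ‖S x‖)
      (fun _ _ => norm_nonneg _) (2 * s - 1)
    rw [show 2 * s - 1 + 1 = 2 * s by omega, hcA] at this
    refine le_trans ?_ this
    gcongr
    exact norm_sum_le _ _
  have h2 : ∑ x ∈ A, ‖S x‖ ^ (2 * s) ≤ ∑ w ∈ Y, V (D w) := by
    have e : ((∑ x ∈ A, ‖S x‖ ^ (2 * s) : ℝ) : ℂ)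
        = ∑ w ∈ Y, weylSum (fun j => α j * (D w j : ℝ)) A := by
      rw [Complex.ofReal_sum, sum_congr rfl fun x _ => norm_weylSum_pow s _ A, sum_comm]
      apply sum_congr rfl
      intro w _
      apply sum_congr rfl
      intro x _
      congr 1
      apply sum_congr rfl
      intro j _
      simp only [D]
      ring
    calc ∑ x ∈ A, ‖S x‖ ^ (2 * s) = ‖((∑ x ∈ A, ‖S x‖ ^ (2 * s) : ℝ) : ℂ)‖ := by
          rw [Complex.norm_real, Real.norm_of_nonneg (sum_nonneg fun _ _ => by positivity)]
      _ ≤ _ := by rw [e]; exact norm_sum_le _ _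
  -- second application
  have h3 : (∑ w ∈ Y, V (D w)) ^ s
      ≤ (X : ℝ) ^ (2 * s * (s - 1)) * ∑ u ∈ B, (ν u : ℝ) * V u ^ s := by
    have := sum_pow_le_card_pow_mul_sum_pow Y (f := fun w => V (D w))
      (fun _ _ => norm_nonneg _) (s - 1)
    rw [show s - 1 + 1 = s by omega, hcY, hfib fun u => V u ^ s] at this
    push_cast at this
    rwa [← pow_mul] at this
  have h4 : (∑ u ∈ B, (ν u : ℝ) * V u ^ s) ^ 2
      ≤ (J * (X : ℝ) ^ (2 * s)) * ∑ u ∈ B, V u ^ (2 * s) := by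
    refine (sum_mul_sq_le_sq_mul_sq B (fun u => (ν u : ℝ)) (fun u => V u ^ s)).trans ?_
    have e1 : ∑ u ∈ B, (ν u : ℝ) ^ 2 ≤ J * (X : ℝ) ^ (2 * s) := by
      rw [← hνsum, mul_sum]
      apply sum_le_sum
      intro u _
      rw [sq]
      gcongr
      exact hνJ u
    have e2 : ∑ u ∈ B, (V u ^ s) ^ 2 = ∑ u ∈ B, V u ^ (2 * s) := by
      apply sum_congr rfl
      intro u _
      rw [← pow_mul, mul_comm]
    rw [e2]
    gcongr
  have h5 : ∑ u ∈ B, V u ^ (2 * s) ≤ J * ∏ j : Fin k, boxAverage (α j) s X (j + 1) := by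
    let g : Fin k → ℤ → ℝ := fun j v => ‖∑ u ∈ symBox s X (j + 1), phase (α j * u * v)‖
    have e : ((∑ u ∈ B, V u ^ (2 * s) : ℝ) : ℂ)
        = ∑ w ∈ Y, ∏ j : Fin k, ∑ u ∈ symBox s X (j + 1), phase (α j * u * (D w j : ℝ)) := by
      rw [Complex.ofReal_sum, sum_congr rfl fun u _ => norm_weylSum_pow s _ A, sum_comm]
      apply sum_congr rfl
      intro w _
      simp_rw [phase_sum]
      rw [prod_univ_sum]
    calc ∑ u ∈ B, V u ^ (2 * s) = ‖((∑ u ∈ B, V u ^ (2 * s) : ℝ) : ℂ)‖ := by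
          rw [Complex.norm_real, Real.norm_of_nonneg
            (sum_nonneg fun _ _ => pow_nonneg (norm_nonneg _) _)]
      _ ≤ ∑ w ∈ Y, ∏ j : Fin k, g j (D w j) := by
          rw [e]
          refine (norm_sum_le _ _).trans (le_of_eq ?_)
          simp_rw [norm_prod, g]
      _ = ∑ v ∈ B, (ν v : ℝ) * ∏ j : Fin k, g j (v j) := hfib fun v => ∏ j : Fin k, g j (v j)
      _ ≤ ∑ v ∈ B, J * ∏ j : Fin k, g j (v j) := by
          apply sum_le_sum
          intro v _
          exact mul_le_mul_of_nonneg_right (hνJ v) (prod_nonneg fun _ _ => norm_nonneg _)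
      _ = _ := by
          rw [← mul_sum, hB, ← prod_univ_sum]
          rfl
  obtain ⟨q, rfl⟩ : ∃ q, s = q + 1 := ⟨s - 1, by omega⟩
  have hX0 : (0 : ℝ) ≤ X := Nat.cast_nonneg X
  have hJ0 : 0 ≤ J := Nat.cast_nonneg _
  have hM0 : 0 ≤ ∑ w ∈ Y, V (D w) := sum_nonneg fun _ _ => norm_nonneg _
  have hN0 : 0 ≤ ∑ u ∈ B, (ν u : ℝ) * V u ^ (q + 1) :=
    sum_nonneg fun _ _ => mul_nonneg (Nat.cast_nonneg _) (pow_nonneg (norm_nonneg _) _)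
  calc ‖∑ x ∈ A, S x‖ ^ (4 * (q + 1) ^ 2)
      = ((‖∑ x ∈ A, S x‖ ^ (2 * (q + 1))) ^ (q + 1)) ^ 2 := by
        rw [← pow_mul, ← pow_mul]; congr 1; ring
    _ ≤ (((X : ℝ) ^ (2 * (q + 1) - 1) * ∑ w ∈ Y, V (D w)) ^ (q + 1)) ^ 2 := by
        gcongr
        exact h1.trans (by gcongr)
    _ = (((X : ℝ) ^ (2 * (q + 1) - 1)) ^ (q + 1)) ^ 2 * ((∑ w ∈ Y, V (D w)) ^ (q + 1)) ^ 2 := by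
        rw [mul_pow, mul_pow]
    _ ≤ (((X : ℝ) ^ (2 * (q + 1) - 1)) ^ (q + 1)) ^ 2 * ((X : ℝ) ^ (2 * (q + 1) * (q + 1 - 1)) *
          ∑ u ∈ B, (ν u : ℝ) * V u ^ (q + 1)) ^ 2 := by gcongr
    _ ≤ (((X : ℝ) ^ (2 * (q + 1) - 1)) ^ (q + 1)) ^ 2 *
        (((X : ℝ) ^ (2 * (q + 1) * (q + 1 - 1))) ^ 2 * ((J * (X : ℝ) ^ (2 * (q + 1))) *
          (J * ∏ j : Fin k, boxAverage (α j) (q + 1) X (j + 1)))) := by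
        rw [mul_pow ((X : ℝ) ^ (2 * (q + 1) * (q + 1 - 1)))]
        gcongr
        exact h4.trans (by gcongr)
    _ = _ := by
        have e : 8 * (q + 1) ^ 2 - 4 * (q + 1)
            = (2 * (q + 1) - 1) * (q + 1) * 2 + 2 * (q + 1) * (q + 1 - 1) * 2 + 2 * (q + 1) := by
          have : 2 * (q + 1) - 1 = 2 * q + 1 := by omega
          rw [this, Nat.add_sub_cancel]
          apply Nat.sub_eq_of_eq_add
          ring
        rw [e, pow_add, pow_add, ← pow_mul, ← pow_mul, ← pow_mul]
        ring

theorem boxAverage_le_sq (α : ℝ) (s X j : ℕ) :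
    boxAverage α s X j ≤ (2 * (s * X ^ j : ℕ) + 1 : ℝ) ^ 2 := by
  have hc : (#(symBox s X j) : ℝ) = 2 * (s * X ^ j : ℕ) + 1 := by
    rw [symBox, Int.card_Icc]
    have : ((s * X ^ j : ℕ) + 1 - -((s * X ^ j : ℕ) : ℤ)).toNat = 2 * (s * X ^ j) + 1 := by omega
    rw [this]; push_cast; ring
  refine (sum_le_card_nsmul _ _ (#(symBox s X j) : ℝ) fun v _ => ?_).trans ?_
  · refine (norm_sum_le _ _).trans (le_of_eq ?_)
    simp [norm_phase]
  · rw [nsmul_eq_mul, hc, sq]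

theorem boxAverage_nonneg (α : ℝ) (s X j : ℕ) : 0 ≤ boxAverage α s X j :=
  sum_nonneg fun _ _ => norm_nonneg _

theorem norm_sum_phase_Icc_le {H : ℕ} {θ : ℝ} (h0 : θ ≠ 0) (h : |θ| ≤ π) :
    ‖∑ u ∈ Icc (-(H : ℤ)) H, phase (θ * u)‖ ≤ π / |θ| := by
  have hpos : 0 < 2 / π * |θ| := by have := Real.pi_pos; have := abs_pos.2 h0; positivity
  have hge := phase_sub_one_norm_ge h
  have htel : (phase θ - 1) * ∑ u ∈ Icc (-(H : ℤ)) H, phase (θ * u)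
      = phase (θ * (H + 1 : ℤ)) - phase (θ * (-H : ℤ)) := by
    induction H with
    | zero => simp [phase_zero]
    | succ H ih =>
      have e : Icc (-((H + 1 : ℕ) : ℤ)) (H + 1 : ℕ)
          = insert (-(H + 1) : ℤ) (insert (H + 1 : ℤ) (Icc (-(H : ℤ)) H)) := by
        ext u; simp only [mem_insert, mem_Icc]; push_cast; omega
      rw [e, sum_insert (by simp only [mem_insert, mem_Icc]; omega),
        sum_insert (by simp only [mem_Icc]; omega), mul_add, mul_add, ih]
      have e1 : phase (θ * ((H + 1 : ℕ) + 1 : ℤ)) = phase θ * phase (θ * (H + 1 : ℤ)) := by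
        rw [← phase_add]; congr 1; push_cast; ring
      have e2 : phase (θ * (-H : ℤ)) = phase θ * phase (θ * (-(H + 1) : ℤ)) := by
        rw [← phase_add]; congr 1; push_cast; ring
      rw [e1, e2]
      push_cast
      ring
  have hn : ‖phase θ - 1‖ * ‖∑ u ∈ Icc (-(H : ℤ)) H, phase (θ * u)‖ ≤ 2 := by
    rw [← norm_mul, htel]
    refine (norm_sub_le _ _).trans ?_
    rw [norm_phase, norm_phase]; norm_num
  have h2 : 2 / π * |θ| * ‖∑ u ∈ Icc (-(H : ℤ)) H, phase (θ * u)‖ ≤ 2 :=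
    (mul_le_mul_of_nonneg_right hge (norm_nonneg _)).trans hn
  rw [le_div_iff₀ (abs_pos.2 h0)]
  have hpi := Real.pi_pos
  have : 2 / π * |θ| * ‖∑ u ∈ Icc (-(H : ℤ)) H, phase (θ * u)‖
      = 2 / π * (‖∑ u ∈ Icc (-(H : ℤ)) H, phase (θ * u)‖ * |θ|) := by ring
  rw [this, div_mul_eq_mul_div, div_le_iff₀ hpi] at h2
  linarith

theorem boxAverage_le {α : ℝ} (h0 : α ≠ 0) {s X j : ℕ} (h : |α| * (s * X ^ j : ℕ) ≤ π) :
    boxAverage α s X j ≤ 2 * (s * X ^ j : ℕ) + 1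
      + 2 * π / |α| * (1 + Real.log (s * X ^ j : ℕ)) := by
  unfold boxAverage symBox
  set H := s * X ^ j
  have hb : ∀ v : ℤ, v ≠ 0 → |v| ≤ H →
      ‖∑ u ∈ Icc (-(H : ℤ)) H, phase (α * u * v)‖ ≤ π / |α| * |(v : ℝ)|⁻¹ := by
    intro v hv hvH
    have hvH' : |(v : ℝ)| ≤ H := by exact_mod_cast hvH
    have := norm_sum_phase_Icc_le (H := H) (θ := α * v) (mul_ne_zero h0 (by exact_mod_cast hv))
      (by rw [abs_mul]; exact (mul_le_mul_of_nonneg_left hvH' (abs_nonneg _)).trans h)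
    rw [abs_mul, div_mul_eq_div_div, div_eq_mul_inv (π / |α|)] at this
    simpa only [mul_right_comm] using this
  have hsplit : Icc (-(H : ℤ)) H = insert 0 ((Icc (1 : ℤ) H) ∪ (Icc (-(H : ℤ)) (-1))) := by
    ext v; simp only [mem_insert, mem_union, mem_Icc]; omega
  have hdisj : Disjoint (Icc (1 : ℤ) H) (Icc (-(H : ℤ)) (-1)) := by
    rw [disjoint_left]; intro v; simp only [mem_Icc]; omega
  have hharm : ∑ v ∈ Icc (1 : ℤ) H, |(v : ℝ)|⁻¹ ≤ 1 + Real.log H := by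
    have h1 := harmonic_le_one_add_log H
    refine le_trans (le_of_eq ?_) h1
    rw [harmonic_eq_sum_Icc]
    push_cast
    symm
    apply sum_bij (fun (n : ℕ) _ => (n : ℤ))
    · intro n hn; rw [mem_Icc] at hn ⊢; omega
    · intro a _ b _ hab; exact_mod_cast hab
    · intro v hv
      rw [mem_Icc] at hv
      exact ⟨v.toNat, by rw [mem_Icc]; omega, by omega⟩
    · intro n _; simp
  have hneg : ∑ v ∈ Icc (-(H : ℤ)) (-1), |(v : ℝ)|⁻¹ = ∑ v ∈ Icc (1 : ℤ) H, |(v : ℝ)|⁻¹ := by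
    apply sum_bij (fun v _ => -v)
    · intro v hv; rw [mem_Icc] at hv ⊢; omega
    · intro a _ b _ hab; simpa using hab
    · intro v hv
      rw [mem_Icc] at hv
      exact ⟨-v, by rw [mem_Icc]; omega, by omega⟩
    · intro v _; simp
  have hcard : (#(Icc (-(H : ℤ)) H) : ℝ) = 2 * H + 1 := by
    rw [Int.card_Icc]
    have : ((H : ℤ) + 1 - -(H : ℤ)).toNat = 2 * H + 1 := by omega
    rw [this]; push_cast; ring
  have hz : ‖∑ u ∈ Icc (-(H : ℤ)) H, phase (α * u * (0 : ℤ))‖ ≤ 2 * H + 1 := by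
    refine (norm_sum_le _ _).trans (le_of_eq ?_)
    simp only [norm_phase, sum_const, nsmul_eq_mul, mul_one, hcard]
  have h1 : ∑ v ∈ Icc (1 : ℤ) H, ‖∑ u ∈ Icc (-(H : ℤ)) H, phase (α * u * v)‖
      ≤ π / |α| * (1 + Real.log H) := by
    refine (sum_le_sum fun v hv => hb v ?_ ?_).trans ?_
    · rw [mem_Icc] at hv; omega
    · rw [mem_Icc] at hv; rw [abs_le]; omega
    · rw [← mul_sum]
      have := Real.pi_pos
      gcongr
  have h2 : ∑ v ∈ Icc (-(H : ℤ)) (-1), ‖∑ u ∈ Icc (-(H : ℤ)) H, phase (α * u * v)‖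
      ≤ π / |α| * (1 + Real.log H) := by
    refine (sum_le_sum fun v hv => hb v ?_ ?_).trans ?_
    · rw [mem_Icc] at hv; omega
    · rw [mem_Icc] at hv; rw [abs_le]; omega
    · rw [← mul_sum, hneg]
      have := Real.pi_pos
      gcongr
  have hsum : ∀ g : ℤ → ℝ, ∑ v ∈ Icc (-(H : ℤ)) H, g v
      = g 0 + (∑ v ∈ Icc (1 : ℤ) H, g v + ∑ v ∈ Icc (-(H : ℤ)) (-1), g v) := by
    intro g
    rw [hsplit, sum_insert (by simp), sum_union hdisj]
  calc _ = ‖∑ u ∈ Icc (-(H : ℤ)) H, phase (α * u * (0 : ℤ))‖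
      + (∑ v ∈ Icc (1 : ℤ) H, ‖∑ u ∈ Icc (-(H : ℤ)) H, phase (α * u * v)‖
        + ∑ v ∈ Icc (-(H : ℤ)) (-1), ‖∑ u ∈ Icc (-(H : ℤ)) H, phase (α * u * v)‖) := by
        exact hsum fun v => ‖∑ u ∈ Icc (-(H : ℤ)) H, phase (α * u * v)‖
    _ ≤ (2 * H + 1) + (π / |α| * (1 + Real.log H) + π / |α| * (1 + Real.log H)) := by gcongr
    _ = _ := by ring

end Bilinear

section ExponentialSum

open Finset Real

theorem one_add_log_le {y : ℝ} (hy : 1 ≤ y) : 1 + log y ≤ 20 * exp (log y / 20) := by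
  have := add_one_le_exp (log y / 20)
  have := log_nonneg hy
  nlinarith

theorem boxAverage_saving {κ ℓ L t α : ℝ} {N X s j n : ℕ} (hκ : 1 ≤ κ)
    (hN : 1 ≤ N) (hℓ : ℓ = log N) (hX : 1 ≤ X) (hL : L = log X) (ht : 0 < t)
    (htκ : log t = κ * ℓ) (hj : 2 * κ < j) (hj' : j ≤ 3 * κ) (hn : N ≤ n) (hn' : n ≤ 2 * N)
    (hLℓ : L ≤ 2 / 5 * ℓ) (hℓL : 2 / 5 * ℓ ≤ L + log 2) (hL18 : 18 ≤ L) (hs : 21 ≤ s)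
    (hsN : log s ≤ κ * ℓ / 5) (hα : |α| = t / (j * (n : ℝ) ^ j)) :
    boxAverage α s X j ≤ 9 * (s : ℝ) ^ 2 * exp (19 / 10 * j * L) := by
  have hN0 : (0 : ℝ) < N := by exact_mod_cast hN
  have hX0 : (0 : ℝ) < X := by exact_mod_cast hX
  have hs0 : (0 : ℝ) < s := by exact_mod_cast (by omega : 0 < s)
  have hs21 : (21 : ℝ) ≤ s := by exact_mod_cast hs
  have hn0 : (0 : ℝ) < n := by exact_mod_cast (by omega : 0 < n)
  have hj0 : (0 : ℝ) < j := by linarith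
  have hj1 : (1 : ℝ) ≤ j := by linarith
  have hl2 : log 2 < 0.7 := by linarith [log_two_lt_d9]
  have hlj0 : 0 ≤ log j := log_nonneg hj1
  have hlj : log j ≤ j := (log_le_sub_one_of_pos hj0).trans (by linarith)
  have hln : ℓ ≤ log n := by
    rw [hℓ]; exact log_le_log hN0 (by exact_mod_cast hn)
  have hln' : log n ≤ ℓ + 0.7 := by
    have : log n ≤ log (2 * N) := log_le_log hn0 (by exact_mod_cast hn')
    rw [log_mul (by norm_num) hN0.ne', ← hℓ] at this
    linarith
  have hαpos : 0 < |α| := by rw [hα]; positivity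
  have hα0 : α ≠ 0 := abs_pos.mp hαpos
  have hlα : log |α| = κ * ℓ - (log j + j * log n) := by
    rw [hα, log_div ht.ne' (by positivity), log_mul hj0.ne' (by positivity), log_pow, htκ]
  have hY : ((s * X ^ j : ℕ) : ℝ) = s * (X : ℝ) ^ j := by push_cast; ring
  have hlY : log ((s * X ^ j : ℕ) : ℝ) = log s + j * L := by
    rw [hY, log_mul hs0.ne' (by positivity), log_pow, hL]
  have hY1 : (1 : ℝ) ≤ ((s * X ^ j : ℕ) : ℝ) := by
    exact_mod_cast Nat.mul_pos (by omega) (pow_pos hX j)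
  have hY0 : (0 : ℝ) < ((s * X ^ j : ℕ) : ℝ) := by linarith
  have hsmall : |α| * ((s * X ^ j : ℕ) : ℝ) ≤ π := by
    have : log (|α| * ((s * X ^ j : ℕ) : ℝ)) ≤ 0 := by
      rw [log_mul hαpos.ne' hY0.ne', hlα, hlY]
      have : j * ℓ ≤ j * log n := by gcongr
      have : j * L ≤ j * (2 / 5 * ℓ) := by gcongr
      have : 2 * κ * ℓ ≤ j * ℓ := by
        have : 0 ≤ ℓ := by linarith
        gcongr
      linarith
    have h1 : |α| * ((s * X ^ j : ℕ) : ℝ) ≤ 1 :=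
      (log_nonpos_iff (by positivity)).mp this
    linarith [pi_gt_three]
  have hXj : (X : ℝ) ^ j = exp (j * L) := by
    rw [hL, mul_comm, exp_mul, exp_log hX0, rpow_natCast]
  refine (boxAverage_le hα0 hsmall).trans ?_
  have hinv : 1 / |α| ≤ exp (j * (2.87 + 5 / 3 * L)) := by
    have : 1 / |α| = exp (-log |α|) := by rw [exp_neg, exp_log hαpos, one_div]
    rw [this, exp_le_exp, hlα]
    have h1 : j * log n ≤ j * (ℓ + 0.7) := by gcongr
    have h2 : j / 3 * ℓ ≤ κ * ℓ := by
      have : 0 ≤ ℓ := by linarith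
      gcongr
      linarith
    have h3 : j * ℓ ≤ j * (2.5 * (L + 0.7)) := by gcongr; linarith
    linarith
  have hlog : 1 + log ((s * X ^ j : ℕ) : ℝ) ≤ 20 * (s * exp (j * L / 20)) := by
    refine (one_add_log_le hY1).trans ?_
    rw [hlY, add_div, exp_add]
    gcongr
    have : 0 ≤ log s := log_nonneg (by linarith)
    calc exp (log s / 20) ≤ exp (log s) := by gcongr; linarith
      _ = s := exp_log hs0
  have hjL : j * 18 ≤ j * L := by gcongr
  have hss : 21 * (s : ℝ) ≤ (s : ℝ) ^ 2 := by rw [sq]; gcongr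
  have hmain : 2 * π / |α| * (1 + log ((s * X ^ j : ℕ) : ℝ))
      ≤ 6 * (s : ℝ) ^ 2 * exp (19 / 10 * j * L) := by
    have hlog0 : 0 ≤ 1 + log ((s * X ^ j : ℕ) : ℝ) := by linarith [log_nonneg hY1]
    calc 2 * π / |α| * (1 + log ((s * X ^ j : ℕ) : ℝ))
        = 2 * π * (1 / |α|) * (1 + log ((s * X ^ j : ℕ) : ℝ)) := by ring
      _ ≤ 2 * 3.15 * exp (j * (2.87 + 5 / 3 * L)) * (20 * (s * exp (j * L / 20))) := by
          gcongr
          exact pi_lt_d2.le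
      _ = 126 * s * exp (j * (2.87 + 5 / 3 * L) + j * L / 20) := by rw [exp_add]; ring
      _ ≤ 6 * (s : ℝ) ^ 2 * exp (19 / 10 * j * L) := by
          gcongr ?_ * exp ?_
          · linarith
          · linarith
  have hfirst : 2 * ((s * X ^ j : ℕ) : ℝ) + 1 ≤ 3 * (s : ℝ) ^ 2 * exp (19 / 10 * j * L) := by
    calc 2 * ((s * X ^ j : ℕ) : ℝ) + 1 ≤ 3 * ((s * X ^ j : ℕ) : ℝ) := by linarith
      _ = 3 * s * exp (j * L) := by rw [hY, hXj]; ring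
      _ ≤ 3 * (s : ℝ) ^ 2 * exp (19 / 10 * j * L) := by
          gcongr ?_ * exp ?_
          · linarith
          · linarith
  linarith

theorem half_le_card_good {κ : ℝ} (hκ : 1 ≤ κ) {k : ℕ} (hk : 3 * κ ≤ k) :
    κ / 2 ≤ #{j ∈ range k | 2 * κ < ((j + 1 : ℕ) : ℝ) ∧ ((j + 1 : ℕ) : ℝ) ≤ 3 * κ} := by
  have hsub : Ico ⌊2 * κ⌋₊ ⌊3 * κ⌋₊ ⊆
      {j ∈ range k | 2 * κ < ((j + 1 : ℕ) : ℝ) ∧ ((j + 1 : ℕ) : ℝ) ≤ 3 * κ} := by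
    intro j hj
    rw [mem_Ico] at hj
    have h1 : 2 * κ < ((j + 1 : ℕ) : ℝ) := Nat.lt_of_floor_lt (by omega)
    have h2 : ((j + 1 : ℕ) : ℝ) ≤ 3 * κ := (Nat.le_floor_iff (by linarith)).mp (by omega)
    rw [mem_filter, mem_range]
    refine ⟨?_, h1, h2⟩
    have : ((j + 1 : ℕ) : ℝ) ≤ k := h2.trans hk
    exact_mod_cast this
  have hcard := card_le_card hsub
  rw [Nat.card_Ico] at hcard
  have hc : ((⌊3 * κ⌋₊ - ⌊2 * κ⌋₊ : ℕ) : ℝ) ≤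
      #{j ∈ range k | 2 * κ < ((j + 1 : ℕ) : ℝ) ∧ ((j + 1 : ℕ) : ℝ) ≤ 3 * κ} := by
    exact_mod_cast hcard
  refine le_trans ?_ hc
  have h1 : (⌊2 * κ⌋₊ : ℝ) ≤ 2 * κ := Nat.floor_le (by linarith)
  have h2 : 3 * κ < ⌊3 * κ⌋₊ + 1 := Nat.lt_floor_add_one _
  have h3 : ⌊2 * κ⌋₊ < ⌊3 * κ⌋₊ := by
    have : (⌊2 * κ⌋₊ : ℝ) < ⌊3 * κ⌋₊ := by linarith
    exact_mod_cast this
  rw [Nat.cast_sub h3.le]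
  rcases le_or_gt κ 2 with h | h
  · have : (⌊2 * κ⌋₊ : ℝ) + 1 ≤ ⌊3 * κ⌋₊ := by exact_mod_cast h3
    linarith
  · linarith

end ExponentialSum

section ExponentialSum

open Finset Real

theorem prod_boxAverage_le {κ ℓ L t : ℝ} {N X s n k : ℕ} (hκ : 1 ≤ κ)
    (hN : 1 ≤ N) (hℓ : ℓ = log N) (hX : 1 ≤ X) (hL : L = log X) (ht : 0 < t)
    (htκ : log t = κ * ℓ) (hn : N ≤ n) (hn' : n ≤ 2 * N)
    (hLℓ : L ≤ 2 / 5 * ℓ) (hℓL : 2 / 5 * ℓ ≤ L + log 2) (hL18 : 18 ≤ L) (hs : 21 ≤ s)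
    (hsN : log s ≤ κ * ℓ / 5) (hk : 3 * κ ≤ k) (α : Fin k → ℝ)
    (hα : ∀ j : Fin k, |α j| = t / (((j + 1 : ℕ) : ℝ) * (n : ℝ) ^ (j + 1 : ℕ))) :
    ∏ j : Fin k, boxAverage (α j) s X (j + 1)
      ≤ (9 * (s : ℝ) ^ 2) ^ k * exp ((k * (k + 1) - κ ^ 2 / 10) * L) := by
  classical
  have hs0 : (0 : ℝ) < s := by exact_mod_cast (by omega : 0 < s)
  have hX0 : (0 : ℝ) < X := by exact_mod_cast hX
  let e : ℕ → ℝ := fun j =>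
    if 2 * κ < ((j + 1 : ℕ) : ℝ) ∧ ((j + 1 : ℕ) : ℝ) ≤ 3 * κ then κ / 5 else 0
  have hbox : ∀ j : Fin k, boxAverage (α j) s X (j + 1)
      ≤ 9 * (s : ℝ) ^ 2 * exp ((2 * ((j : ℕ) + 1) - e j) * L) := by
    intro j
    by_cases h : 2 * κ < (((j : ℕ) + 1 : ℕ) : ℝ) ∧ (((j : ℕ) + 1 : ℕ) : ℝ) ≤ 3 * κ
    · refine (boxAverage_saving hκ hN hℓ hX hL ht htκ h.1 h.2 hn hn' hLℓ hℓL hL18 hs hsN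
        (hα j)).trans ?_
      gcongr
      simp only [e, h, and_self, if_true]
      have := h.1
      push_cast at this ⊢
      linarith
    · refine (boxAverage_le_sq _ _ _ _).trans ?_
      simp only [e, h, if_false, sub_zero]
      have hXj : (X : ℝ) ^ ((j : ℕ) + 1) = exp (((j : ℕ) + 1) * L) := by
        have : (((j : ℕ) + 1 : ℕ) : ℝ) = (j : ℕ) + 1 := by push_cast; ring
        rw [hL, mul_comm, exp_mul, exp_log hX0, ← this, rpow_natCast]
      have h1 : (1 : ℝ) ≤ ((s * X ^ ((j : ℕ) + 1) : ℕ) : ℝ) := by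
        exact_mod_cast Nat.mul_pos (by omega) (pow_pos hX _)
      calc (2 * ((s * X ^ ((j : ℕ) + 1) : ℕ) : ℝ) + 1) ^ 2
          ≤ (3 * ((s * X ^ ((j : ℕ) + 1) : ℕ) : ℝ)) ^ 2 := by gcongr; linarith
        _ = 9 * (s : ℝ) ^ 2 * ((X : ℝ) ^ ((j : ℕ) + 1)) ^ 2 := by push_cast; ring
        _ = 9 * (s : ℝ) ^ 2 * exp (2 * ((j : ℕ) + 1) * L) := by
            rw [hXj, ← exp_nat_mul]; push_cast; ring_nf
        _ ≤ _ := le_rfl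
  have hsum2 : ∀ k : ℕ, ∑ j ∈ range k, 2 * ((j : ℝ) + 1) = k * (k + 1) := by
    intro k
    induction k with
    | zero => simp
    | succ k ih => rw [sum_range_succ, ih]; push_cast; ring
  have hsume : κ ^ 2 / 10 ≤ ∑ j ∈ range k, e j := by
    simp only [e]
    rw [← sum_filter, sum_const, nsmul_eq_mul]
    have := half_le_card_good hκ hk
    calc κ ^ 2 / 10 = κ / 2 * (κ / 5) := by ring
      _ ≤ _ := by gcongr
  calc ∏ j : Fin k, boxAverage (α j) s X (j + 1)
      ≤ ∏ j : Fin k, 9 * (s : ℝ) ^ 2 * exp ((2 * ((j : ℕ) + 1) - e j) * L) :=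
        prod_le_prod (fun _ _ => boxAverage_nonneg _ _ _ _) fun j _ => hbox j
    _ = (9 * (s : ℝ) ^ 2) ^ k * exp ((k * (k + 1) - ∑ j ∈ range k, e j) * L) := by
        rw [prod_mul_distrib, prod_const, card_univ, Fintype.card_fin, ← exp_sum, ← sum_mul,
          Fin.sum_univ_eq_sum_range (fun j => 2 * ((j : ℝ) + 1) - e j), sum_sub_distrib, hsum2]
    _ ≤ _ := by gcongr

theorem bilinear_exponent_le {κ L s k : ℝ} (hκ : 1 ≤ κ) (hk : 1 ≤ k) (hk' : k ≤ 11 * κ)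
    (hLκ : 10 ^ 9 * κ ^ 2 ≤ L) :
    (8 * s ^ 2 + k * (k + 1) / 20000 - κ ^ 2 / 10) * L + (1600 * k ^ 4 + 12 * k ^ 2)
      ≤ 8 * s ^ 2 * L - κ ^ 2 / 20 * L := by
  have hL0 : 0 ≤ L := le_trans (by positivity) hLκ
  have hk2 : k ^ 2 ≤ 121 * κ ^ 2 := by
    calc k ^ 2 ≤ (11 * κ) ^ 2 := by gcongr
      _ = _ := by ring
  have h1 : k * (k + 1) ≤ 200 * κ ^ 2 := by nlinarith
  have h2 : k * (k + 1) / 20000 * L ≤ 200 * κ ^ 2 / 20000 * L := by gcongr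
  have h3 : k ^ 4 ≤ 14641 * κ ^ 4 := by
    calc k ^ 4 ≤ (11 * κ) ^ 4 := by gcongr
      _ = _ := by ring
  have h4 : κ ^ 2 * (10 ^ 9 * κ ^ 2) ≤ κ ^ 2 * L := by gcongr
  have h5 : κ ^ 2 * 1 ≤ κ ^ 2 * κ ^ 2 := by
    gcongr
    exact one_le_pow₀ hκ
  have h6 : κ ^ 4 = κ ^ 2 * κ ^ 2 := by ring
  have h7 : 0 ≤ κ ^ 2 * L := by positivity
  linarith

set_option maxHeartbeats 800000 in
theorem norm_bilinear_le {κ ℓ L t : ℝ} {N X n k : ℕ} (hκ : 1 ≤ κ)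
    (hN : 1 ≤ N) (hℓ : ℓ = log N) (hX : 1 ≤ X) (hL : L = log X) (ht : 0 < t)
    (htκ : log t = κ * ℓ) (hn : N ≤ n) (hn' : n ≤ 2 * N)
    (hLℓ : L ≤ 2 / 5 * ℓ) (hℓL : 2 / 5 * ℓ ≤ L + log 2) (hLκ : 10 ^ 9 * κ ^ 2 ≤ L)
    (hk : 3 * κ ≤ k) (hk' : k ≤ 11 * κ) (α : Fin k → ℝ)
    (hα : ∀ j : Fin k, |α j| = t / (((j + 1 : ℕ) : ℝ) * (n : ℝ) ^ (j + 1 : ℕ))) :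
    ‖∑ x ∈ Ico (0 : ℤ) X, weylSum (fun j => α j * (x : ℝ) ^ ((j : ℕ) + 1)) (Ico 0 (X : ℤ))‖
      ≤ exp (2 * L - L / (2 * 10 ^ 8 * κ ^ 2)) := by
  have hX0 : (0 : ℝ) < X := by exact_mod_cast hX
  have hκ2 : 1 ≤ κ ^ 2 := one_le_pow₀ hκ
  have hk3 : 3 ≤ k := by
    have : (3 : ℝ) ≤ k := by linarith
    exact_mod_cast this
  have hk3r : (3 : ℝ) ≤ k := by exact_mod_cast hk3
  have hksq : (k : ℝ) ^ 2 ≤ 121 * κ ^ 2 := by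
    calc (k : ℝ) ^ 2 ≤ (11 * κ) ^ 2 := by gcongr
      _ = _ := by ring
  set s := 11 * k ^ 2 with hs
  have hsr : (s : ℝ) = 11 * (k : ℝ) ^ 2 := by rw [hs]; push_cast; ring
  have hs21 : 21 ≤ s := by nlinarith
  have hs0 : (0 : ℝ) < s := by exact_mod_cast (by omega : 0 < s)
  have hL0 : 0 ≤ L := by linarith
  have hsN : log s ≤ κ * ℓ / 5 := by
    have h1 : log s ≤ s := (log_le_sub_one_of_pos hs0).trans (by linarith)
    have h2 : ℓ ≤ κ * ℓ := le_mul_of_one_le_left (by linarith) hκ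
    linarith
  have hprod := prod_boxAverage_le hκ hN hℓ hX hL ht htκ hn hn' hLℓ hℓL (by linarith) hs21 hsN
    hk α hα
  have hJ := vinogradov_mean_value (k := k) (by omega) hX
  rw [← hs] at hJ
  have hkl : log k ≤ k := (log_le_sub_one_of_pos (by linarith)).trans (by linarith)
  have hJ' : (vinogradov k s (Ico (0 : ℤ) X) : ℝ)
      ≤ exp (800 * (k : ℝ) ^ 4 + (2 * s - k * (k + 1) / 2 + k * (k + 1) / 40000) * L) := by
    refine hJ.trans ?_
    rw [rpow_def_of_pos (by linarith), rpow_def_of_pos hX0, ← exp_add, exp_le_exp, ← hL]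
    have h3 : log k * (800 * (k : ℝ) ^ 3) ≤ k * (800 * (k : ℝ) ^ 3) := by gcongr
    rw [hsr]
    nlinarith
  have hmain := norm_bilinear_pow_le (X := X) (by omega : 1 ≤ s) α
  set W := ‖∑ x ∈ Ico (0 : ℤ) X, weylSum (fun j => α j * (x : ℝ) ^ ((j : ℕ) + 1))
    (Ico 0 (X : ℤ))‖ with hW
  have hW0 : 0 ≤ W := norm_nonneg _
  have hnine : (9 * (s : ℝ) ^ 2) ^ k ≤ exp (12 * (k : ℝ) ^ 2) := by
    have h33 : (9 * (s : ℝ) ^ 2) ≤ exp (12 * k) := by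
      have hk0 : (0 : ℝ) ≤ k := by linarith
      have h1 : (k : ℝ) ≤ exp k := by linarith [add_one_le_exp (k : ℝ)]
      have h2 : (33 : ℝ) ≤ exp (4 * k) := by
        have : (3 : ℝ) ^ 4 ≤ exp 1 ^ (4 * k) := by
          calc (3 : ℝ) ^ 4 ≤ 2 ^ (4 * k) := by
                calc (3 : ℝ) ^ 4 ≤ 2 ^ (12) := by norm_num
                  _ ≤ 2 ^ (4 * k) := pow_le_pow_right₀ (by norm_num) (by omega)
            _ ≤ exp 1 ^ (4 * k) := by
                gcongr
                linarith [add_one_le_exp (1 : ℝ)]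
        rw [← exp_nat_mul] at this
        push_cast at this
        rw [mul_one] at this
        linarith
      calc 9 * (s : ℝ) ^ 2 = (33 * (k : ℝ) ^ 2) ^ 2 := by rw [hsr]; ring
        _ ≤ (exp (4 * k) * exp k ^ 2) ^ 2 := by gcongr
        _ = exp (12 * k) := by
          rw [← exp_nat_mul, ← exp_add, ← exp_nat_mul]; push_cast; ring_nf
    calc (9 * (s : ℝ) ^ 2) ^ k ≤ exp (12 * k) ^ k := by gcongr
      _ = _ := by rw [← exp_nat_mul]; ring_nf
  have hXp : (X : ℝ) ^ (8 * s ^ 2 - 4 * s) = exp ((8 * (s : ℝ) ^ 2 - 4 * s) * L) := by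
    have hle : 4 * s ≤ 8 * s ^ 2 := by nlinarith
    have hcast : ((8 * s ^ 2 - 4 * s : ℕ) : ℝ) = 8 * (s : ℝ) ^ 2 - 4 * s := by
      rw [Nat.cast_sub hle]; push_cast; ring
    rw [← hcast, exp_nat_mul, hL, exp_log hX0]
  have hpow : W ^ (4 * s ^ 2) ≤ exp (8 * (s : ℝ) ^ 2 * L - κ ^ 2 / 20 * L) := by
    refine hmain.trans ?_
    calc _ ≤ exp ((8 * (s : ℝ) ^ 2 - 4 * s) * L)
          * exp (800 * (k : ℝ) ^ 4 + (2 * s - k * (k + 1) / 2 + k * (k + 1) / 40000) * L) ^ 2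
          * (exp (12 * (k : ℝ) ^ 2) * exp ((k * (k + 1) - κ ^ 2 / 10) * L)) := by
          rw [hXp]
          gcongr
          · exact prod_nonneg fun _ _ => boxAverage_nonneg _ _ _ _
          · exact hprod.trans (by gcongr)
      _ = exp ((8 * (s : ℝ) ^ 2 + k * (k + 1) / 20000 - κ ^ 2 / 10) * L
            + (1600 * (k : ℝ) ^ 4 + 12 * (k : ℝ) ^ 2)) := by
          rw [← exp_nat_mul, ← exp_add, ← exp_add, ← exp_add]
          push_cast; ring_nf
      _ ≤ _ := by
          rw [exp_le_exp]
          exact bilinear_exponent_le hκ (by linarith) hk' hLκ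
  have hs2 : 4 * (s : ℝ) ^ 2 ≤ 10 ^ 7 * κ ^ 4 := by
    calc 4 * (s : ℝ) ^ 2 = 484 * ((k : ℝ) ^ 2) ^ 2 := by rw [hsr]; ring
      _ ≤ 484 * (121 * κ ^ 2) ^ 2 := by gcongr
      _ = 7086244 * κ ^ 4 := by ring
      _ ≤ _ := by gcongr; norm_num
  refine le_of_pow_le_pow_left₀ (n := 4 * s ^ 2) (by positivity) (exp_pos _).le (hpow.trans ?_)
  rw [← exp_nat_mul, exp_le_exp]
  push_cast
  have h6 : 4 * (s : ℝ) ^ 2 * (L / (2 * 10 ^ 8 * κ ^ 2))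
      ≤ 10 ^ 7 * κ ^ 4 * (L / (2 * 10 ^ 8 * κ ^ 2)) := by gcongr
  have h7 : 10 ^ 7 * κ ^ 4 * (L / (2 * 10 ^ 8 * κ ^ 2)) = κ ^ 2 / 20 * L := by
    field_simp
    ring
  nlinarith

end ExponentialSum

section ExponentialSum

open Finset Real

theorem norm_phase_sub_le (a b : ℝ) : ‖phase a - phase b‖ ≤ |a - b| := by
  have h : phase a - phase b = phase b * (phase (a - b) - 1) := by
    rw [mul_sub, mul_one, ← phase_add]; ring_nf
  rw [h, norm_mul, norm_phase, one_mul, phase, mul_comm]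
  simpa using Real.norm_exp_I_mul_ofReal_sub_one_le (x := a - b)

theorem norm_sum_shift_sub_le {g : ℕ → ℂ} (hg : ∀ n, ‖g n‖ ≤ 1) (N N' h : ℕ) :
    ‖∑ n ∈ Ioc N N', g (n + h) - ∑ n ∈ Ioc N N', g n‖ ≤ 2 * h := by
  rcases le_or_gt N' N with hN | hN
  · rw [Ioc_eq_empty (by omega)]; simp
  induction h with
  | zero => simp
  | succ h ih =>
    have hstep : ∑ n ∈ Ioc N N', g (n + (h + 1)) - ∑ n ∈ Ioc N N', g (n + h)
        = g (N' + 1 + h) - g (N + 1 + h) := by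
      rw [← sum_sub_distrib]
      have := Finset.sum_Ico_sub (fun n => g (n + h)) (show N + 1 ≤ N' + 1 by omega)
      rw [← this]
      have e : Ioc N N' = Ico (N + 1) (N' + 1) := by ext; simp
      rw [e]
      apply sum_congr rfl
      intro n _
      ring_nf
    have h2 : ‖g (N' + 1 + h) - g (N + 1 + h)‖ ≤ 2 :=
      (norm_sub_le _ _).trans (by linarith [hg (N' + 1 + h), hg (N + 1 + h)])
    calc ‖∑ n ∈ Ioc N N', g (n + (h + 1)) - ∑ n ∈ Ioc N N', g n‖
        = ‖(g (N' + 1 + h) - g (N + 1 + h)) + (∑ n ∈ Ioc N N', g (n + h)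
            - ∑ n ∈ Ioc N N', g n)‖ := by rw [← hstep, sub_add_sub_cancel]
      _ ≤ 2 + 2 * h := (norm_add_le _ _).trans (add_le_add h2 ih)
      _ = 2 * ((h + 1 : ℕ) : ℝ) := by push_cast; ring

theorem sum_Ico_intCast (X : ℕ) (F : ℤ → ℂ) :
    ∑ x ∈ Ico (0 : ℤ) X, F x = ∑ x ∈ range X, F x := by
  have : Ico (0 : ℤ) X = (range X).image (fun n : ℕ => (n : ℤ)) := by
    ext x
    simp only [mem_Ico, mem_image, mem_range]
    constructor
    · intro h
      exact ⟨x.toNat, by omega, by omega⟩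
    · rintro ⟨a, ha, rfl⟩
      omega
  rw [this, sum_image (by intro a _ b _ h; simpa using h)]

/-- The Taylor coefficients of `-t * log (n + u)` at `u = 0`. -/
noncomputable def taylorCoeff (t : ℝ) (n k : ℕ) (j : Fin k) : ℝ :=
  t * (-1) ^ ((j : ℕ) + 1) / ((((j : ℕ) + 1 : ℕ) : ℝ) * (n : ℝ) ^ ((j : ℕ) + 1))

theorem abs_taylorCoeff {t : ℝ} (ht : 0 < t) (n k : ℕ) (j : Fin k) :
    |taylorCoeff t n k j| = t / ((((j : ℕ) + 1 : ℕ) : ℝ) * (n : ℝ) ^ ((j : ℕ) + 1)) := by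
  rw [taylorCoeff, abs_div, abs_mul, abs_pow, abs_neg, abs_one, one_pow, mul_one,
    abs_of_pos ht, abs_of_nonneg (by positivity)]

theorem abs_log_sub_taylor_le {t z : ℝ} (ht : 0 < t) {n u : ℕ} (k : ℕ) (hn : 0 < n)
    (hz : z ≤ 1 / 2) (hu : (u : ℝ) / n ≤ z) :
    |(-t * log ((n + u : ℕ) : ℝ)) -
      (-t * log n + ∑ j : Fin k, taylorCoeff t n k j * (u : ℝ) ^ ((j : ℕ) + 1))|
      ≤ 2 * t * z ^ (k + 1) := by
  have hn0 : (0 : ℝ) < n := by exact_mod_cast hn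
  set w : ℝ := -((u : ℝ) / n) with hw
  have hwa : |w| = (u : ℝ) / n := by rw [hw, abs_neg, abs_of_nonneg (by positivity)]
  have hw1 : |w| < 1 := by rw [hwa]; linarith
  have hT := abs_log_sub_add_sum_range_le hw1 k
  have hlog : log ((n + u : ℕ) : ℝ) = log n + log (1 - w) := by
    have : (0 : ℝ) ≤ (u : ℝ) / n := by positivity
    rw [← log_mul hn0.ne' (by rw [hw]; linarith), hw]
    congr 1
    push_cast
    field_simp
    ring
  have hsum : ∑ j : Fin k, taylorCoeff t n k j * (u : ℝ) ^ ((j : ℕ) + 1)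
      = t * ∑ i ∈ range k, w ^ (i + 1) / (i + 1) := by
    rw [← Fin.sum_univ_eq_sum_range (fun i => w ^ (i + 1) / ((i : ℝ) + 1)), mul_sum]
    apply sum_congr rfl
    intro j _
    rw [taylorCoeff, hw, neg_pow ((u : ℝ) / n), div_pow]
    push_cast
    field_simp
  have hmono : |w| ^ (k + 1) / (1 - |w|) ≤ 2 * z ^ (k + 1) := by
    have hwz : |w| ≤ z := by rw [hwa]; exact hu
    have h0 := abs_nonneg w
    rw [div_le_iff₀ (by linarith)]
    have h1 : |w| ^ (k + 1) ≤ z ^ (k + 1) := by gcongr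
    have h2 : 0 ≤ z ^ (k + 1) := pow_nonneg (by linarith) _
    nlinarith
  rw [hlog, hsum]
  have e : -t * (log n + log (1 - w)) - (-t * log n + t * ∑ i ∈ range k, w ^ (i + 1) / (i + 1))
      = -t * (∑ i ∈ range k, w ^ (i + 1) / (i + 1) + log (1 - w)) := by ring
  rw [e, abs_mul, abs_neg, abs_of_pos ht]
  nlinarith

theorem norm_sum_shifts_le {t z : ℝ} (ht : 0 < t) {n X : ℕ} (k : ℕ) (hn : 0 < n)
    (hz : z ≤ 1 / 2) (hX : (X : ℝ) ^ 2 / n ≤ z) :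
    ‖∑ x ∈ range X, ∑ y ∈ range X, phase (-t * log ((n + x * y : ℕ) : ℝ))‖
      ≤ ‖∑ x ∈ Ico (0 : ℤ) X, weylSum (fun j => taylorCoeff t n k j * (x : ℝ) ^ ((j : ℕ) + 1))
          (Ico 0 (X : ℤ))‖ + (X : ℝ) ^ 2 * (2 * t * z ^ (k + 1)) := by
  have hn0 : (0 : ℝ) < n := by exact_mod_cast hn
  have hW : phase (-t * log n) * ∑ x ∈ Ico (0 : ℤ) X,
      weylSum (fun j => taylorCoeff t n k j * (x : ℝ) ^ ((j : ℕ) + 1)) (Ico 0 (X : ℤ))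
      = ∑ x ∈ range X, ∑ y ∈ range X, phase (-t * log n
          + ∑ j : Fin k, taylorCoeff t n k j * ((x * y : ℕ) : ℝ) ^ ((j : ℕ) + 1)) := by
    rw [sum_Ico_intCast, mul_sum]
    apply sum_congr rfl
    intro x _
    rw [weylSum, sum_Ico_intCast, mul_sum]
    apply sum_congr rfl
    intro y _
    rw [phase_add]
    congr 3
    ext j
    push_cast
    ring
  have hdiff : ‖∑ x ∈ range X, ∑ y ∈ range X, phase (-t * log ((n + x * y : ℕ) : ℝ))
      - phase (-t * log n) * ∑ x ∈ Ico (0 : ℤ) X,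
      weylSum (fun j => taylorCoeff t n k j * (x : ℝ) ^ ((j : ℕ) + 1)) (Ico 0 (X : ℤ))‖
      ≤ (X : ℝ) ^ 2 * (2 * t * z ^ (k + 1)) := by
    rw [hW, ← sum_sub_distrib]
    calc _ ≤ ∑ x ∈ range X, ∑ y ∈ range X, 2 * t * z ^ (k + 1) := by
          refine (norm_sum_le _ _).trans (sum_le_sum fun x hx => ?_)
          rw [← sum_sub_distrib]
          refine (norm_sum_le _ _).trans (sum_le_sum fun y hy => ?_)
          refine (norm_phase_sub_le _ _).trans (abs_log_sub_taylor_le ht k hn hz ?_)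
          refine le_trans ?_ hX
          have hx' : (x : ℝ) ≤ X := by exact_mod_cast (mem_range.mp hx).le
          have hy' : (y : ℝ) ≤ X := by exact_mod_cast (mem_range.mp hy).le
          push_cast
          rw [sq]
          gcongr
      _ = _ := by simp only [sum_const, card_range, nsmul_eq_mul]; ring
  have hn' := norm_add_le (∑ x ∈ range X, ∑ y ∈ range X, phase (-t * log ((n + x * y : ℕ) : ℝ))
      - phase (-t * log n) * ∑ x ∈ Ico (0 : ℤ) X,
      weylSum (fun j => taylorCoeff t n k j * (x : ℝ) ^ ((j : ℕ) + 1)) (Ico 0 (X : ℤ)))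
      (phase (-t * log n) * ∑ x ∈ Ico (0 : ℤ) X,
      weylSum (fun j => taylorCoeff t n k j * (x : ℝ) ^ ((j : ℕ) + 1)) (Ico 0 (X : ℤ)))
  rw [sub_add_cancel, norm_mul (phase _), norm_phase, one_mul] at hn'
  linarith

theorem sq_mul_norm_sum_le {g : ℕ → ℂ} (hg : ∀ n, ‖g n‖ ≤ 1) (N N' X : ℕ) {B : ℝ}
    (hB : ∀ n ∈ Ioc N N', ‖∑ x ∈ range X, ∑ y ∈ range X, g (n + x * y)‖ ≤ B) :
    (X : ℝ) ^ 2 * ‖∑ n ∈ Ioc N N', g n‖ ≤ ((N' - N : ℕ) : ℝ) * B + 2 * (X : ℝ) ^ 4 := by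
  set S := ∑ n ∈ Ioc N N', g n with hS
  have h1 : ∑ n ∈ Ioc N N', ∑ x ∈ range X, ∑ y ∈ range X, g (n + x * y)
      = ∑ x ∈ range X, ∑ y ∈ range X, ∑ n ∈ Ioc N N', g (n + x * y) := by
    rw [sum_comm]
    exact sum_congr rfl fun x _ => sum_comm
  have h2 : ‖∑ x ∈ range X, ∑ y ∈ range X, (∑ n ∈ Ioc N N', g (n + x * y) - S)‖
      ≤ 2 * (X : ℝ) ^ 4 := by
    calc _ ≤ ∑ x ∈ range X, ∑ y ∈ range X, 2 * (X : ℝ) ^ 2 := by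
          refine (norm_sum_le _ _).trans (sum_le_sum fun x hx => ?_)
          refine (norm_sum_le _ _).trans (sum_le_sum fun y hy => ?_)
          refine (norm_sum_shift_sub_le hg N N' (x * y)).trans ?_
          have hx' : (x : ℝ) ≤ X := by exact_mod_cast (mem_range.mp hx).le
          have hy' : (y : ℝ) ≤ X := by exact_mod_cast (mem_range.mp hy).le
          push_cast
          rw [sq]
          gcongr
      _ = _ := by simp only [sum_const, card_range, nsmul_eq_mul]; ring
  have h3 : ‖∑ n ∈ Ioc N N', ∑ x ∈ range X, ∑ y ∈ range X, g (n + x * y)‖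
      ≤ ((N' - N : ℕ) : ℝ) * B := by
    refine (norm_sum_le_of_le _ hB).trans ?_
    rw [sum_const, Nat.card_Ioc, nsmul_eq_mul]
  have h4 : (X : ℂ) ^ 2 * S = ∑ n ∈ Ioc N N', ∑ x ∈ range X, ∑ y ∈ range X, g (n + x * y)
      - ∑ x ∈ range X, ∑ y ∈ range X, (∑ n ∈ Ioc N N', g (n + x * y) - S) := by
    rw [h1]
    simp only [sum_sub_distrib, sum_const, card_range, nsmul_eq_mul]
    ring
  calc (X : ℝ) ^ 2 * ‖S‖ = ‖(X : ℂ) ^ 2 * S‖ := by rw [norm_mul, norm_pow, Complex.norm_natCast]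
    _ ≤ _ := by rw [h4]; exact (norm_sub_le _ _).trans (add_le_add h3 h2)

theorem norm_sum_phase_log_le_of_large {κ ℓ t : ℝ} {N N' : ℕ} (hκ : 1 ≤ κ) (hN : 1 ≤ N)
    (hℓ : ℓ = log N) (ht : 0 < t) (htκ : log t = κ * ℓ) (hN' : N' ≤ 2 * N)
    (hbig : 10 ^ 10 * κ ^ 2 ≤ ℓ) :
    ‖∑ n ∈ Ioc N N', phase (-t * log n)‖ ≤ 5 * N * exp (-(ℓ / (10 ^ 9 * κ ^ 2))) := by
  have hN0 : (0 : ℝ) < N := by exact_mod_cast hN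
  have hNe : (N : ℝ) = exp ℓ := by rw [hℓ, exp_log hN0]
  have hκ2 : 1 ≤ κ ^ 2 := one_le_pow₀ hκ
  have hℓ0 : 10 ^ 10 ≤ ℓ := by linarith
  set X : ℕ := ⌊exp (2 / 5 * ℓ)⌋₊ with hXdef
  have hE1 : (1 : ℝ) ≤ exp (2 / 5 * ℓ) := one_le_exp (by linarith)
  have hXle : (X : ℝ) ≤ exp (2 / 5 * ℓ) := Nat.floor_le (exp_pos _).le
  have hX : 1 ≤ X := by rw [hXdef, Nat.one_le_floor_iff]; exact hE1
  have hX1 : (1 : ℝ) ≤ X := by exact_mod_cast hX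
  have hX0 : (0 : ℝ) < X := by linarith
  have hXge : exp (2 / 5 * ℓ) ≤ X * 2 := by
    have := Nat.lt_floor_add_one (exp (2 / 5 * ℓ))
    rw [← hXdef] at this
    linarith
  set L := log X with hL
  have hXe : (X : ℝ) = exp L := by rw [hL, exp_log hX0]
  have hl2 : log 2 < 0.7 := by linarith [log_two_lt_d9]
  have hLℓ : L ≤ 2 / 5 * ℓ := by rw [hL, log_le_iff_le_exp hX0]; exact hXle
  have hℓL : 2 / 5 * ℓ ≤ L + log 2 := by
    rw [hL, ← log_mul hX0.ne' (by norm_num), le_log_iff_exp_le (by linarith)]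
    exact hXge
  have hLκ : 10 ^ 9 * κ ^ 2 ≤ L := by linarith
  set k : ℕ := ⌈5 * κ⌉₊ + 4 with hk
  have hk1 : 5 * κ + 4 ≤ k := by
    rw [hk]; push_cast; linarith [Nat.le_ceil (5 * κ)]
  have hk2 : k ≤ 11 * κ := by
    rw [hk]; push_cast; linarith [Nat.ceil_lt_add_one (show 0 ≤ 5 * κ by linarith)]
  have hB : ∀ n ∈ Ioc N N',
      ‖∑ x ∈ range X, ∑ y ∈ range X, phase (-t * log ((n + x * y : ℕ) : ℝ))‖
      ≤ exp (2 * L - L / (2 * 10 ^ 8 * κ ^ 2)) + exp (2 * L) * (2 * exp (-ℓ)) := by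
    intro n hn
    rw [mem_Ioc] at hn
    have hn0 : 0 < n := by omega
    have hNn : (N : ℝ) ≤ n := by exact_mod_cast hn.1.le
    have hz : exp (-(ℓ / 5)) ≤ 1 / 2 := by
      rw [exp_neg, inv_le_comm₀ (exp_pos _) (by norm_num)]
      linarith [add_one_le_exp (ℓ / 5)]
    have hzX : (X : ℝ) ^ 2 / n ≤ exp (-(ℓ / 5)) := by
      calc (X : ℝ) ^ 2 / n ≤ exp (2 / 5 * ℓ) ^ 2 / exp ℓ := by
            rw [← hNe]; gcongr
        _ = exp (-(ℓ / 5)) := by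
            rw [← exp_nat_mul, ← exp_sub]; push_cast; ring_nf
    refine (norm_sum_shifts_le ht k hn0 hz hzX).trans ?_
    have h1 := norm_bilinear_le hκ hN hℓ hX hL ht htκ hn.1.le (by omega : n ≤ 2 * N) hLℓ hℓL hLκ
      (by linarith) hk2 (taylorCoeff t n k) (abs_taylorCoeff ht n k)
    have h2 : 2 * t * exp (-(ℓ / 5)) ^ (k + 1) ≤ 2 * exp (-ℓ) := by
      have ht' : t = exp (κ * ℓ) := by rw [← htκ, exp_log ht]
      rw [mul_assoc, ht', ← exp_nat_mul, ← exp_add]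
      gcongr
      push_cast
      have : (5 * κ + 4) * ℓ ≤ k * ℓ := by gcongr
      linarith
    have h3 : (X : ℝ) ^ 2 = exp (2 * L) := by rw [hXe, ← exp_nat_mul]; norm_num
    rw [h3]
    gcongr
  have hmain := sq_mul_norm_sum_le (g := fun n => phase (-t * log n))
    (fun n => (norm_phase _).le) N N' X hB
  set S := ‖∑ n ∈ Ioc N N', phase (-t * log n)‖ with hS
  have hNN : ((N' - N : ℕ) : ℝ) ≤ exp ℓ := by
    rw [← hNe]; exact_mod_cast (by omega : N' - N ≤ N)
  have h3 : (X : ℝ) ^ 2 = exp (2 * L) := by rw [hXe, ← exp_nat_mul]; norm_num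
  have h4 : (X : ℝ) ^ 4 = exp (2 * L) * exp (2 * L) := by rw [← h3]; ring
  rw [h3, h4] at hmain
  set D := ℓ / (10 ^ 9 * κ ^ 2) with hD
  have hD1 : D ≤ ℓ / 10 ^ 9 := by
    rw [hD]; gcongr; linarith
  have hDL : D ≤ L / (2 * 10 ^ 8 * κ ^ 2) := by
    rw [hD, div_le_div_iff₀ (by positivity) (by positivity)]
    have : ℓ * κ ^ 2 ≤ 5 * L * κ ^ 2 := by gcongr; linarith
    linarith
  have hfin : exp (2 * L) * S ≤ exp (2 * L) * (5 * exp (ℓ - D)) := by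
    calc exp (2 * L) * S ≤ exp ℓ * (exp (2 * L - L / (2 * 10 ^ 8 * κ ^ 2))
          + exp (2 * L) * (2 * exp (-ℓ))) + 2 * (exp (2 * L) * exp (2 * L)) := by
          refine hmain.trans ?_
          gcongr
      _ = exp (2 * L) * (exp (ℓ - L / (2 * 10 ^ 8 * κ ^ 2)) + 2 * exp 0 + 2 * exp (2 * L)) := by
          rw [exp_sub, exp_sub, exp_neg, exp_zero]
          field_simp
      _ ≤ exp (2 * L) * (exp (ℓ - D) + 2 * exp (ℓ - D) + 2 * exp (ℓ - D)) := by
          gcongr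
          · linarith
          · linarith
      _ = _ := by ring
  have := le_of_mul_le_mul_left hfin (exp_pos _)
  rw [hNe, mul_assoc, ← exp_add]
  exact this.trans_eq (by ring_nf)

/-- Vinogradov's estimate for the zeta sums over dyadic blocks. -/
theorem norm_sum_phase_log_le {t : ℝ} {N N' : ℕ} (hN : 1 ≤ N) (hNt : N ≤ t)
    (hN' : N' ≤ 2 * N) :
    ‖∑ n ∈ Ioc N N', phase (-t * log n)‖
      ≤ 5 * exp 10 * N * exp (-(log N ^ 3 / (10 ^ 9 * log t ^ 2))) := by
  have hN1 : (1 : ℝ) ≤ N := by exact_mod_cast hN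
  have hN0 : (0 : ℝ) < N := by linarith
  have ht : 0 < t := by linarith
  have hℓ0 : 0 ≤ log N := log_nonneg hN1
  have hlt : log N ≤ log t := log_le_log hN0 hNt
  rcases le_or_gt (log N ^ 3) (10 ^ 10 * log t ^ 2) with h | h
  · have h1 : ‖∑ n ∈ Ioc N N', phase (-t * log n)‖ ≤ N := by
      refine (norm_sum_le _ _).trans ?_
      simp only [norm_phase, sum_const, Nat.card_Ioc, nsmul_eq_mul, mul_one]
      exact_mod_cast (by omega : N' - N ≤ N)
    have h2 : log N ^ 3 / (10 ^ 9 * log t ^ 2) ≤ 10 := by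
      apply div_le_of_le_mul₀ (by positivity) (by norm_num)
      linarith
    calc ‖∑ n ∈ Ioc N N', phase (-t * log n)‖ ≤ 5 * N * exp 0 := by rw [exp_zero]; linarith
      _ ≤ 5 * N * exp (10 + -(log N ^ 3 / (10 ^ 9 * log t ^ 2))) := by gcongr; linarith
      _ = _ := by rw [exp_add]; ring
  · have hℓ : 0 < log N := by
      by_contra h0
      have : log N = 0 := le_antisymm (not_lt.mp h0) hℓ0
      rw [this] at h
      have : 0 ≤ 10 ^ 10 * log t ^ 2 := by positivity
      norm_num at h
      linarith
    have hκ : 1 ≤ log t / log N := by rwa [one_le_div hℓ]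
    refine (norm_sum_phase_log_le_of_large hκ hN rfl ht (by field_simp) hN' ?_).trans ?_
    · rw [div_pow, ← mul_div_assoc, div_le_iff₀ (by positivity)]
      linarith
    · have e : log N / (10 ^ 9 * (log t / log N) ^ 2) = log N ^ 3 / (10 ^ 9 * log t ^ 2) := by
        field_simp
      rw [e]
      gcongr
      linarith [one_le_exp (show (0 : ℝ) ≤ 10 by norm_num)]

end ExponentialSum

section ZetaBound

open Finset Real Filter Topology MeasureTheory intervalIntegral

theorem norm_cpow_sub_cpow_le {s : ℂ} (hs : 1 ≤ s.re) {a u : ℝ} (ha : 1 ≤ a) (hu : a ≤ u)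
    (hu' : u ≤ a + 1) : ‖(a : ℂ) ^ (-s) - (u : ℂ) ^ (-s)‖ ≤ ‖s‖ / a ^ 2 := by
  have hs0 : s ≠ 0 := by
    rintro rfl
    norm_num at hs
  have hderiv : ∀ x ∈ Set.Icc a (a + 1), HasDerivWithinAt (fun x : ℝ => (x : ℂ) ^ (-s))
      (-s * (x : ℂ) ^ (-s - 1)) (Set.Icc a (a + 1)) x := by
    intro x hx
    have hx0 : x ≠ 0 := by linarith [hx.1]
    exact (hasDerivAt_ofReal_cpow_const hx0 (by simpa using hs0) (r := -s)).hasDerivWithinAt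
  have hbound : ∀ x ∈ Set.Icc a (a + 1), ‖-s * (x : ℂ) ^ (-s - 1)‖ ≤ ‖s‖ / a ^ 2 := by
    intro x hx
    have hx1 : a ≤ x := hx.1
    have hx0 : 0 < x := by linarith
    rw [norm_mul, norm_neg, Complex.norm_cpow_eq_rpow_re_of_pos hx0, div_eq_mul_inv]
    gcongr
    have e : (-s - 1).re = -(s.re + 1) := by simp; ring
    rw [e, rpow_neg hx0.le]
    gcongr
    calc a ^ 2 = a ^ (2 : ℝ) := by norm_cast
      _ ≤ x ^ (2 : ℝ) := by gcongr
      _ ≤ x ^ (s.re + 1) := rpow_le_rpow_of_exponent_le (by linarith) (by linarith)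
  have := Convex.norm_image_sub_le_of_norm_hasDerivWithin_le hderiv hbound (convex_Icc a (a + 1))
    (x := u) (y := a) ⟨hu, hu'⟩ ⟨le_rfl, by linarith⟩
  refine this.trans ?_
  have h1 : ‖a - u‖ ≤ 1 := by rw [Real.norm_eq_abs, abs_le]; constructor <;> linarith
  exact mul_le_of_le_one_right (by positivity) h1

theorem norm_cpow_sub_integral_le {s : ℂ} (hs : 1 ≤ s.re) (hs1 : s ≠ 1) {n : ℕ} (hn : 1 ≤ n) :
    ‖(n : ℂ) ^ (-s) - (((n + 1 : ℕ) : ℂ) ^ (1 - s) - (n : ℂ) ^ (1 - s)) / (1 - s)‖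
      ≤ ‖s‖ / (n : ℝ) ^ 2 := by
  have hn1 : (1 : ℝ) ≤ n := by exact_mod_cast hn
  have h0 : (0 : ℝ) ∉ Set.uIcc (n : ℝ) (n + 1) := by
    rw [Set.uIcc_of_le (by linarith)]
    intro h
    linarith [h.1]
  have hI : (∫ x : ℝ in (n : ℝ)..(n + 1), (x : ℂ) ^ (-s))
      = (((n + 1 : ℕ) : ℂ) ^ (1 - s) - (n : ℂ) ^ (1 - s)) / (1 - s) := by
    rw [integral_cpow (Or.inr ⟨by simpa using hs1, h0⟩)]
    push_cast
    ring_nf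
  have hInt : IntervalIntegrable (fun x : ℝ => (x : ℂ) ^ (-s)) volume n (n + 1) :=
    intervalIntegrable_cpow (Or.inr h0)
  have hc : (n : ℂ) ^ (-s) = ∫ x : ℝ in (n : ℝ)..(n + 1), ((n : ℝ) : ℂ) ^ (-s) := by
    rw [intervalIntegral.integral_const]; simp
  rw [← hI, hc, ← intervalIntegral.integral_sub (by simp) hInt]
  have := intervalIntegral.norm_integral_le_of_norm_le_const (a := (n : ℝ)) (b := n + 1)
    (C := ‖s‖ / (n : ℝ) ^ 2)
    (f := fun x : ℝ => ((n : ℝ) : ℂ) ^ (-s) - (x : ℂ) ^ (-s)) (by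
      intro x hx
      rw [Set.uIoc_of_le (by linarith)] at hx
      exact norm_cpow_sub_cpow_le hs hn1 hx.1.le hx.2)
  simpa using this

theorem sum_Ioc_inv_sq_le {N M : ℕ} (hN : 1 ≤ N) (hNM : N ≤ M) :
    ∑ n ∈ Ioc N M, 1 / (n : ℝ) ^ 2 ≤ 1 / (N : ℝ) - 1 / (M : ℝ) := by
  induction M, hNM using Nat.le_induction with
  | base => simp
  | succ M hM ih =>
    rw [sum_Ioc_succ_top hM]
    have hM0 : (0 : ℝ) < M := by exact_mod_cast (by omega : 0 < M)
    have : 1 / ((M + 1 : ℕ) : ℝ) ^ 2 ≤ 1 / M - 1 / ((M + 1 : ℕ) : ℝ) := by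
      push_cast
      rw [div_sub_div _ _ hM0.ne' (by positivity), div_le_div_iff₀ (by positivity) (by positivity)]
      nlinarith
    linarith

theorem norm_sum_Ioc_cpow_le {s : ℂ} (hs : 1 ≤ s.re) (hs1 : s ≠ 1) {N M : ℕ} (hN : 1 ≤ N)
    (hNM : N ≤ M) :
    ‖∑ n ∈ Ioc N M, (n : ℂ) ^ (-s)‖ ≤ ‖s‖ / N + 2 / ‖1 - s‖ := by
  have htel : ∑ n ∈ Ioc N M, (((n + 1 : ℕ) : ℂ) ^ (1 - s) - (n : ℂ) ^ (1 - s))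
      = ((M + 1 : ℕ) : ℂ) ^ (1 - s) - ((N + 1 : ℕ) : ℂ) ^ (1 - s) := by
    have e : Ioc N M = Ico (N + 1) (M + 1) := by ext; simp
    rw [e]
    exact Finset.sum_Ico_sub (fun n : ℕ => (n : ℂ) ^ (1 - s)) (by omega)
  have hle1 : ∀ m : ℕ, ‖((m + 1 : ℕ) : ℂ) ^ (1 - s)‖ ≤ 1 := by
    intro m
    rw [Complex.norm_natCast_cpow_of_pos (by omega)]
    apply rpow_le_one_of_one_le_of_nonpos
    · push_cast; linarith [(Nat.cast_nonneg m : (0 : ℝ) ≤ m)]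
    · simp; linarith
  have hdecomp : ∑ n ∈ Ioc N M, (n : ℂ) ^ (-s)
      = ∑ n ∈ Ioc N M, ((n : ℂ) ^ (-s)
          - (((n + 1 : ℕ) : ℂ) ^ (1 - s) - (n : ℂ) ^ (1 - s)) / (1 - s))
        + (((M + 1 : ℕ) : ℂ) ^ (1 - s) - ((N + 1 : ℕ) : ℂ) ^ (1 - s)) / (1 - s) := by
    rw [sum_sub_distrib, ← sum_div, htel]
    ring
  rw [hdecomp]
  refine (norm_add_le _ _).trans (add_le_add ?_ ?_)
  · calc _ ≤ ∑ n ∈ Ioc N M, ‖s‖ * (1 / (n : ℝ) ^ 2) := by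
          refine norm_sum_le_of_le _ fun n hn => ?_
          rw [mem_Ioc] at hn
          refine (norm_cpow_sub_integral_le hs hs1 (by omega)).trans_eq ?_
          ring
      _ ≤ ‖s‖ * (1 / N) := by
          rw [← mul_sum]
          gcongr
          have := sum_Ioc_inv_sq_le hN hNM
          have h0 : (0 : ℝ) ≤ 1 / M := by positivity
          linarith
      _ = _ := by ring
  · rw [norm_div]
    gcongr
    exact (norm_sub_le _ _).trans (by linarith [hle1 M, hle1 N])

theorem norm_riemannZeta_sub_sum_le_of_one_lt {s : ℂ} (hs : 1 < s.re) {N : ℕ} (hN : 1 ≤ N) :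
    ‖riemannZeta s - ∑ n ∈ Ioc 0 N, (n : ℂ) ^ (-s)‖ ≤ ‖s‖ / N + 2 / ‖1 - s‖ := by
  have hs1 : s ≠ 1 := by
    rintro rfl
    norm_num at hs
  have hsum : HasSum (fun n : ℕ => (n : ℂ) ^ (-s)) (riemannZeta s) := by
    rw [zeta_eq_tsum_one_div_nat_cpow hs]
    have := (Complex.summable_one_div_nat_cpow.mpr hs).hasSum
    simpa [Complex.cpow_neg, one_div] using this
  have ht : Tendsto (fun M : ℕ => ∑ n ∈ Ioc 0 M, (n : ℂ) ^ (-s)) atTop (𝓝 (riemannZeta s)) := by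
    have h1 := (tendsto_add_atTop_iff_nat 1).mpr hsum.tendsto_sum_nat
    refine h1.congr fun M => ?_
    have hs0 : -s ≠ 0 := by
      rw [neg_ne_zero]
      rintro rfl
      norm_num at hs
    refine (sum_subset (fun n hn => ?_) fun n hn hn' => ?_).symm
    · rw [mem_Ioc] at hn
      rw [mem_range]
      omega
    · have : n = 0 := by
        rw [mem_range] at hn
        rw [mem_Ioc] at hn'
        omega
      rw [this, Nat.cast_zero, Complex.zero_cpow hs0]
  have ht2 : Tendsto (fun M : ℕ => ‖∑ n ∈ Ioc 0 M, (n : ℂ) ^ (-s) - ∑ n ∈ Ioc 0 N, (n : ℂ) ^ (-s)‖)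
      atTop (𝓝 ‖riemannZeta s - ∑ n ∈ Ioc 0 N, (n : ℂ) ^ (-s)‖) := (ht.sub_const _).norm
  refine le_of_tendsto ht2 ?_
  filter_upwards [eventually_ge_atTop N] with M hM
  rw [← sum_Ioc_consecutive _ (Nat.zero_le N) hM, add_sub_cancel_left]
  exact norm_sum_Ioc_cpow_le hs.le hs1 hN hM

theorem norm_riemannZeta_sub_sum_le {s : ℂ} (hs : 1 ≤ s.re) (hs1 : s ≠ 1) {N : ℕ} (hN : 1 ≤ N) :
    ‖riemannZeta s - ∑ n ∈ Ioc 0 N, (n : ℂ) ^ (-s)‖ ≤ ‖s‖ / N + 2 / ‖1 - s‖ := by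
  let F : ℝ → ℝ := fun ε => ‖riemannZeta (s + ε) - ∑ n ∈ Ioc 0 N, (n : ℂ) ^ (-(s + ε))‖
  let G : ℝ → ℝ := fun ε => ‖s + ε‖ / N + 2 / ‖1 - (s + ε)‖
  have hadd : ContinuousAt (fun ε : ℝ => s + (ε : ℂ)) 0 := by fun_prop
  have hF : ContinuousAt F 0 := by
    apply ContinuousAt.norm
    apply ContinuousAt.sub
    · have hz : ContinuousAt riemannZeta (s + ((0 : ℝ) : ℂ)) := by
        simpa using (differentiableAt_riemannZeta hs1).continuousAt
      exact ContinuousAt.comp (f := fun ε : ℝ => s + (ε : ℂ)) hz hadd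
    · apply tendsto_finsetSum
      intro n hn
      rw [mem_Ioc] at hn
      have hn0 : (n : ℂ) ≠ 0 := by exact_mod_cast (by omega : n ≠ 0)
      exact ContinuousAt.const_cpow hadd.neg (Or.inl hn0)
  have hG : ContinuousAt G 0 := by
    apply ContinuousAt.add
    · exact hadd.norm.div_const _
    · apply ContinuousAt.div continuousAt_const
      · exact (continuousAt_const.sub hadd).norm
      · simpa [sub_eq_zero] using hs1.symm
  have hFG : F 0 ≤ G 0 := by
    have hF' : Tendsto F (𝓝[>] 0) (𝓝 (F 0)) := hF.tendsto.mono_left nhdsWithin_le_nhds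
    have hG' : Tendsto G (𝓝[>] 0) (𝓝 (G 0)) := hG.tendsto.mono_left nhdsWithin_le_nhds
    refine le_of_tendsto_of_tendsto hF' hG' ?_
    filter_upwards [self_mem_nhdsWithin] with ε hε
    refine norm_riemannZeta_sub_sum_le_of_one_lt ?_ hN
    have : 0 < ε := hε
    simp
    linarith
  simpa [F, G] using hFG

theorem norm_riemannZeta_sub_sum_floor_le {σ t : ℝ} (hσ : 1 ≤ σ) (hσ' : σ ≤ 2) (ht : 2 ≤ t) :
    ‖riemannZeta (σ + t * Complex.I) - ∑ n ∈ Ioc 0 ⌊t⌋₊, (n : ℂ) ^ (-(σ + t * Complex.I))‖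
      ≤ 5 := by
  set s : ℂ := σ + t * Complex.I with hs
  have hre : s.re = σ := by simp [hs]
  have him : s.im = t := by simp [hs]
  have hs1 : s ≠ 1 := by
    intro h
    rw [h] at him
    simp at him
    linarith
  have hN : 1 ≤ ⌊t⌋₊ := by rw [Nat.one_le_floor_iff]; linarith
  have hN' : t / 2 ≤ ⌊t⌋₊ := by linarith [Nat.lt_floor_add_one t]
  have hN0 : (0 : ℝ) < ⌊t⌋₊ := by linarith
  refine (norm_riemannZeta_sub_sum_le (by rw [hre]; exact hσ) hs1 hN).trans ?_
  have h1 : ‖s‖ ≤ 2 + t := by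
    refine (Complex.norm_le_abs_re_add_abs_im s).trans ?_
    rw [hre, him, abs_of_pos (by linarith), abs_of_pos (by linarith)]
    linarith
  have h2 : t ≤ ‖1 - s‖ := by
    have := Complex.abs_im_le_norm (1 - s)
    simp [him] at this
    linarith [le_abs_self t]
  have h3 : ‖s‖ / ⌊t⌋₊ ≤ 4 := by
    rw [div_le_iff₀ hN0]; linarith
  have h4 : 2 / ‖1 - s‖ ≤ 1 := by
    rw [div_le_one (by linarith)]; linarith
  linarith

end ZetaBound

section ZetaBound

open Finset Real Filter Topology

theorem norm_sum_Ioc_mul_le {w : ℕ → ℝ} {a : ℕ → ℂ} {M M' : ℕ} {B : ℝ} (hB : 0 ≤ B)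
    (hw0 : ∀ n, M < n → 0 ≤ w n) (hw : ∀ n, M < n → w (n + 1) ≤ w n)
    (ha : ∀ m ≤ M', ‖∑ n ∈ Ioc M m, a n‖ ≤ B) :
    ‖∑ n ∈ Ioc M M', (w n : ℂ) * a n‖ ≤ w (M + 1) * B := by
  rcases le_or_gt M' M with h | h
  · rw [Ioc_eq_empty (by omega)]
    simp only [sum_empty, norm_zero]
    exact mul_nonneg (hw0 _ (by omega)) hB
  have key : ∀ m, M + 1 ≤ m → m ≤ M' →
      ‖∑ n ∈ Ioc M m, (w n : ℂ) * a n - w m * ∑ n ∈ Ioc M m, a n‖ ≤ (w (M + 1) - w m) * B := by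
    intro m hm
    induction m, hm using Nat.le_induction with
    | base =>
      intro _
      simp
    | succ m hm ih =>
      intro hm'
      have e : ∑ n ∈ Ioc M (m + 1), (w n : ℂ) * a n - w (m + 1) * ∑ n ∈ Ioc M (m + 1), a n
          = (∑ n ∈ Ioc M m, (w n : ℂ) * a n - w m * ∑ n ∈ Ioc M m, a n)
            + ((w m - w (m + 1) : ℝ) : ℂ) * ∑ n ∈ Ioc M m, a n := by
        rw [sum_Ioc_succ_top (by omega), sum_Ioc_succ_top (by omega)]
        push_cast
        ring
      have h1 : ‖((w m - w (m + 1) : ℝ) : ℂ) * ∑ n ∈ Ioc M m, a n‖ ≤ (w m - w (m + 1)) * B := by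
        have h0 : 0 ≤ w m - w (m + 1) := by linarith [hw m (by omega)]
        rw [norm_mul, Complex.norm_real, Real.norm_of_nonneg h0]
        gcongr
        exact ha m (by omega)
      rw [e]
      refine (norm_add_le _ _).trans ((add_le_add (ih (by omega)) h1).trans_eq (by ring))
  have h1 := key M' h le_rfl
  have h2 : ‖(w M' : ℂ) * ∑ n ∈ Ioc M M', a n‖ ≤ w M' * B := by
    have h0 := hw0 M' h
    rw [norm_mul, Complex.norm_real, Real.norm_of_nonneg h0]
    gcongr
    exact ha M' le_rfl
  calc ‖∑ n ∈ Ioc M M', (w n : ℂ) * a n‖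
      = ‖(∑ n ∈ Ioc M M', (w n : ℂ) * a n - w M' * ∑ n ∈ Ioc M M', a n)
          + w M' * ∑ n ∈ Ioc M M', a n‖ := by rw [sub_add_cancel]
    _ ≤ (w (M + 1) - w M') * B + w M' * B := (norm_add_le _ _).trans (add_le_add h1 h2)
    _ = _ := by ring

theorem norm_dyadic_block_le {t : ℝ} {j M : ℕ} (hj : (2 : ℝ) ^ j ≤ t) (hM : M ≤ 2 ^ (j + 1)) :
    ‖∑ n ∈ Ioc (2 ^ j) M, ((1 / (n : ℝ) : ℝ) : ℂ) * phase (-t * log n)‖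
      ≤ 5 * exp 10 * exp (-((j * log 2) ^ 3 / (10 ^ 9 * log t ^ 2))) := by
  have hp : (0 : ℝ) < 2 ^ j := by positivity
  have hlog : log ((2 ^ j : ℕ) : ℝ) = j * log 2 := by push_cast; rw [log_pow]
  have hcast : ((2 ^ j : ℕ) : ℝ) = 2 ^ j := by push_cast; ring
  refine (norm_sum_Ioc_mul_le (w := fun n => 1 / (n : ℝ)) (a := fun n => phase (-t * log n))
    (B := 5 * exp 10 * (2 ^ j) * exp (-((j * log 2) ^ 3 / (10 ^ 9 * log t ^ 2))))
    (by positivity) (fun n _ => by positivity) (fun n hn => ?_) fun m hm => ?_).trans ?_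
  · have : (0 : ℝ) < n := by exact_mod_cast (by omega : 0 < n)
    gcongr
    linarith
  · have := norm_sum_phase_log_le (t := t) (N := 2 ^ j) (N' := m) Nat.one_le_two_pow
      (by rw [hcast]; exact hj) (by rw [pow_succ] at hM; omega)
    rwa [hlog, hcast] at this
  · have h1 : 1 / ((2 ^ j + 1 : ℕ) : ℝ) ≤ 1 / 2 ^ j := by
      push_cast
      gcongr
      linarith
    calc _ ≤ 1 / 2 ^ j * (5 * exp 10 * (2 ^ j)
          * exp (-((j * log 2) ^ 3 / (10 ^ 9 * log t ^ 2)))) := by gcongr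
      _ = _ := by field_simp

theorem sum_exp_neg_le {b : ℝ} (hb : 0 < b) (J : ℕ) :
    ∑ j ∈ range J, exp (-(b * j)) ≤ 1 + 1 / b := by
  have hr : exp (-b) < 1 := by rw [exp_lt_one_iff]; linarith
  have h1 : ∑ j ∈ range J, exp (-(b * j)) = ∑ j ∈ range J, exp (-b) ^ j := by
    apply sum_congr rfl
    intro j _
    rw [← exp_nat_mul]
    ring_nf
  rw [h1]
  refine ((summable_geometric_of_lt_one (exp_pos _).le hr).sum_le_tsum _
    fun _ _ => by positivity).trans ?_
  rw [tsum_geometric_of_lt_one (exp_pos _).le hr]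
  have h2 : exp (-b) ≤ 1 / (1 + b) := by
    rw [exp_neg, one_div]
    gcongr
    linarith [add_one_le_exp b]
  have h3 : b / (1 + b) ≤ 1 - exp (-b) := by
    have : b / (1 + b) = 1 - 1 / (1 + b) := by field_simp; ring
    linarith
  calc (1 - exp (-b))⁻¹ ≤ (b / (1 + b))⁻¹ := by gcongr
    _ = 1 + 1 / b := by field_simp; ring

theorem sum_exp_neg_cube_le {b : ℝ} (hb : 0 < b) (J : ℕ) :
    ∑ j ∈ range J, exp (-((b * j) ^ 3)) ≤ exp 1 * (1 + 1 / b) := by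
  calc ∑ j ∈ range J, exp (-((b * j) ^ 3)) ≤ ∑ j ∈ range J, exp 1 * exp (-(b * j)) := by
        apply sum_le_sum
        intro j _
        rw [← exp_add, exp_le_exp]
        have h0 : 0 ≤ b * j := by positivity
        set x := b * j
        nlinarith [sq_nonneg (x - 1), mul_nonneg h0 (sq_nonneg (x - 1))]
    _ ≤ _ := by
        rw [← mul_sum]
        gcongr
        exact sum_exp_neg_le hb J

theorem norm_sum_min_two_pow_le {f : ℕ → ℂ} {N : ℕ} {B : ℕ → ℝ} (hB : ∀ j, 0 ≤ B j)
    (hf : ∀ j M : ℕ, 2 ^ j ≤ N → M ≤ 2 ^ (j + 1) → ‖∑ n ∈ Ioc (2 ^ j) M, f n‖ ≤ B j)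
    (J : ℕ) : ‖∑ n ∈ Ioc 1 (min N (2 ^ J)), f n‖ ≤ ∑ j ∈ range J, B j := by
  induction J with
  | zero => simp
  | succ J ih =>
    have h2 : 1 ≤ 2 ^ J := Nat.one_le_two_pow
    have h3 : 2 ^ J ≤ 2 ^ (J + 1) := Nat.pow_le_pow_right (by norm_num) (by omega)
    rw [sum_range_succ]
    rcases le_or_gt (2 ^ J) N with h | h
    · rw [← sum_Ioc_consecutive f (n := 2 ^ J) h2 (by omega)]
      rw [min_eq_right h] at ih
      exact (norm_add_le _ _).trans (add_le_add ih (hf J _ h (min_le_right _ _)))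
    · rw [min_eq_left h.le] at ih
      rw [min_eq_left (by omega)]
      linarith [hB J]

theorem natCast_cpow_neg_eq {n : ℕ} (hn : 0 < n) (σ t : ℝ) :
    (n : ℂ) ^ (-(σ + t * Complex.I)) = (((n : ℝ) ^ (-σ) : ℝ) : ℂ) * phase (-t * log n) := by
  have hn0 : (n : ℂ) ≠ 0 := by exact_mod_cast hn.ne'
  have hn0' : (0 : ℝ) < n := by exact_mod_cast hn
  rw [Complex.cpow_def_of_ne_zero hn0, rpow_def_of_pos hn0', phase, Complex.ofReal_exp,
    ← Complex.exp_add, ← Complex.natCast_log]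
  push_cast
  ring_nf

/-- The Vinogradov–Korobov bound on the line `Re s = 1`. -/
theorem exists_norm_riemannZeta_one_add_le :
    ∃ C : ℝ, 0 < C ∧ ∀ t : ℝ, 3 ≤ t →
      ‖riemannZeta (1 + t * Complex.I)‖ ≤ C * log t ^ (2 / 3 : ℝ) := by
  set c : ℝ := log 2 / 1000 with hc
  have hl2 : 0 < log 2 := log_pos (by norm_num)
  have hc0 : 0 < c := by positivity
  refine ⟨6 + 5 * exp 10 * exp 1 * (1 + 1 / c), by positivity, fun t ht => ?_⟩
  have hL1 : 1 ≤ log t := by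
    rw [le_log_iff_exp_le (by linarith)]
    linarith [exp_one_lt_d9]
  set Y : ℝ := log t ^ (2 / 3 : ℝ) with hY
  have hY1 : 1 ≤ Y := one_le_rpow hL1 (by norm_num)
  have hY3 : Y ^ 3 = log t ^ 2 := by
    rw [hY, ← rpow_natCast, ← rpow_mul (by linarith), ← rpow_natCast]
    norm_num
  have hN : 1 ≤ ⌊t⌋₊ := by rw [Nat.one_le_floor_iff]; linarith
  set N := ⌊t⌋₊ with hNdef
  have hNt : (N : ℝ) ≤ t := Nat.floor_le (by linarith)
  have happ := norm_riemannZeta_sub_sum_floor_le (σ := 1) le_rfl (by norm_num) (by linarith : 2 ≤ t)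
  rw [← hNdef] at happ
  have hterm : ∀ n ∈ Ioc 0 N, (n : ℂ) ^ (-(((1 : ℝ) : ℂ) + t * Complex.I))
      = ((1 / (n : ℝ) : ℝ) : ℂ) * phase (-t * log n) := by
    intro n hn
    rw [natCast_cpow_neg_eq (mem_Ioc.mp hn).1, rpow_neg_one, one_div]
  set f : ℕ → ℂ := fun n => ((1 / (n : ℝ) : ℝ) : ℂ) * phase (-t * log n) with hf
  rw [sum_congr rfl hterm, ← sum_Ioc_consecutive f (Nat.zero_le 1) hN] at happ
  have hblock := norm_sum_min_two_pow_le (N := N) (f := f)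
    (B := fun j => 5 * exp 10 * exp (-((c / Y * j) ^ 3))) (fun j => by positivity)
    (fun j M hj hM => by
      have hj' : (2 : ℝ) ^ j ≤ t := le_trans (by exact_mod_cast hj) hNt
      have e : (c / Y * j) ^ 3 = (j * log 2) ^ 3 / (10 ^ 9 * log t ^ 2) := by
        rw [← hY3, hc]
        field_simp
        ring
      rw [e]
      exact norm_dyadic_block_le hj' hM) N
  rw [min_eq_left Nat.lt_two_pow_self.le, ← mul_sum] at hblock
  have hcube := sum_exp_neg_cube_le (b := c / Y) (by positivity) N
  have h1 : ‖∑ n ∈ Ioc 0 1, f n‖ ≤ 1 := by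
    simp [hf, phase_zero]
  have h2 : ‖∑ n ∈ Ioc 1 N, f n‖ ≤ 5 * exp 10 * (exp 1 * ((1 + 1 / c) * Y)) := by
    refine hblock.trans ?_
    gcongr
    refine hcube.trans ?_
    gcongr
    have : 1 / (c / Y) = 1 / c * Y := by field_simp
    rw [this]
    linarith
  rw [Complex.ofReal_one] at happ
  have hz := norm_add_le (riemannZeta (1 + t * Complex.I)
    - (∑ n ∈ Ioc 0 1, f n + ∑ n ∈ Ioc 1 N, f n)) (∑ n ∈ Ioc 0 1, f n + ∑ n ∈ Ioc 1 N, f n)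
  rw [sub_add_cancel] at hz
  have hz2 := norm_add_le (∑ n ∈ Ioc 0 1, f n) (∑ n ∈ Ioc 1 N, f n)
  calc ‖riemannZeta (1 + t * Complex.I)‖
      ≤ 5 + (1 + 5 * exp 10 * (exp 1 * ((1 + 1 / c) * Y))) := by linarith
    _ ≤ 6 * Y + 5 * exp 10 * (exp 1 * ((1 + 1 / c) * Y)) := by linarith
    _ = _ := by ring

end ZetaBound

section SqrtZeta
open Finset ArithmeticFunction

/-- The coefficients of the Dirichlet series of the square root of `ζ`. -/
noncomputable def sqrtZetaAux (n : ℕ) : ℝ :=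
  if n ≤ 1 then n
  else (∑ d ∈ n.properDivisors.attach, vonMangoldt (n / d.1) * sqrtZetaAux d.1) /
    (2 * Real.log n)
termination_by n
decreasing_by exact (Nat.mem_properDivisors.mp d.2).2

/-- The square root of `ζ` with respect to Dirichlet convolution. -/
noncomputable def sqrtZeta : ArithmeticFunction ℝ :=
  ⟨sqrtZetaAux, by rw [sqrtZetaAux]; simp⟩

lemma sqrtZeta_one : sqrtZeta 1 = 1 := by
  change sqrtZetaAux 1 = 1
  rw [sqrtZetaAux]; simp

lemma sqrtZeta_of_one_lt {n : ℕ} (hn : 1 < n) :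
    sqrtZeta n = (∑ d ∈ n.properDivisors, vonMangoldt (n / d) * sqrtZeta d) /
      (2 * Real.log n) := by
  change sqrtZetaAux n = (∑ d ∈ n.properDivisors, vonMangoldt (n / d) * sqrtZetaAux d) / _
  rw [sqrtZetaAux, if_neg (by omega), sum_attach n.properDivisors
    (fun d ↦ vonMangoldt (n / d) * sqrtZetaAux d)]

lemma sqrtZeta_nonneg (n : ℕ) : 0 ≤ sqrtZeta n := by
  induction n using Nat.strong_induction_on with
  | _ n ih =>
    rcases Nat.lt_or_ge 1 n with hn | hn
    · rw [sqrtZeta_of_one_lt hn]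
      have : 0 ≤ Real.log n := Real.log_natCast_nonneg n
      refine div_nonneg (sum_nonneg fun d hd ↦ mul_nonneg vonMangoldt_nonneg
        (ih d (Nat.mem_properDivisors.mp hd).2)) (by positivity)
    · interval_cases n
      · simp
      · simp [sqrtZeta_one]

lemma sqrtZeta_mul_log (n : ℕ) :
    sqrtZeta n * Real.log n = (vonMangoldt * sqrtZeta) n / 2 := by
  rcases Nat.lt_or_ge 1 n with hn | hn
  · have hlog : 0 < Real.log n := Real.log_pos (by exact_mod_cast hn)
    rw [mul_apply, Nat.sum_divisorsAntidiagonal' (fun x y ↦ vonMangoldt x * sqrtZeta y),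
      ← Nat.insert_self_properDivisors (by omega), sum_insert (by simp),
      Nat.div_self (by omega), vonMangoldt_apply_one, zero_mul, zero_add,
      sqrtZeta_of_one_lt hn]
    field_simp
  · interval_cases n
    · simp
    · simp [mul_apply, sqrtZeta_one]

lemma sqrtZeta_mul_self_mul_log (n : ℕ) :
    (sqrtZeta * sqrtZeta) n * Real.log n = (vonMangoldt * (sqrtZeta * sqrtZeta)) n := by
  have key : pmul (sqrtZeta * sqrtZeta) log =
      pmul sqrtZeta log * sqrtZeta + sqrtZeta * pmul sqrtZeta log := by
    ext m
    simp only [pmul_apply, mul_apply, ArithmeticFunction.add_apply, sum_mul, ← sum_add_distrib]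
    refine sum_congr rfl fun x hx ↦ ?_
    obtain ⟨h, h0⟩ := Nat.mem_divisorsAntidiagonal.mp hx
    have h1 : (x.1 : ℝ) ≠ 0 := by
      rintro h1; apply h0; rw [← h]; rw [Nat.cast_eq_zero] at h1; simp [h1]
    have h2 : (x.2 : ℝ) ≠ 0 := by
      rintro h1; apply h0; rw [← h]; rw [Nat.cast_eq_zero] at h1; simp [h1]
    rw [← h]
    simp only [log_apply, Nat.cast_mul, Real.log_mul h1 h2]
    ring
  have h2 : pmul sqrtZeta log + pmul sqrtZeta log = vonMangoldt * sqrtZeta := by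
    ext m
    simp only [ArithmeticFunction.add_apply, pmul_apply, log_apply, sqrtZeta_mul_log]
    ring
  have h3 : pmul (sqrtZeta * sqrtZeta) log = vonMangoldt * (sqrtZeta * sqrtZeta) := by
    rw [key, mul_comm _ sqrtZeta, ← mul_add, h2]
    ring
  simpa [pmul_apply] using congrArg (fun F : ArithmeticFunction ℝ ↦ F n) h3

lemma sqrtZeta_mul_self {n : ℕ} (hn : 1 ≤ n) : (sqrtZeta * sqrtZeta) n = 1 := by
  induction n using Nat.strong_induction_on with
  | _ n ih =>
    rcases Nat.lt_or_ge 1 n with h1 | h1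
    · have hlog : 0 < Real.log n := Real.log_pos (by exact_mod_cast h1)
      have h := sqrtZeta_mul_self_mul_log n
      rw [mul_apply (f := vonMangoldt), Nat.sum_divisorsAntidiagonal
        (fun x y ↦ vonMangoldt x * (sqrtZeta * sqrtZeta) y)] at h
      have h2 : ∑ d ∈ n.divisors, vonMangoldt d * (sqrtZeta * sqrtZeta) (n / d) =
          ∑ d ∈ n.divisors, vonMangoldt d := by
        refine sum_congr rfl fun d hd ↦ ?_
        have hd0 := Nat.pos_of_mem_divisors hd
        have hdn := Nat.divisor_le hd
        rcases Nat.lt_or_ge 1 d with hd1 | hd1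
        · rw [ih (n / d) (Nat.div_lt_self (by omega) hd1) (Nat.div_pos hdn hd0), mul_one]
        · have : d = 1 := by omega
          simp [this]
      rw [h2, vonMangoldt_sum] at h
      exact mul_right_cancel₀ hlog.ne' (by rw [h, one_mul])
    · have : n = 1 := by omega
      subst this
      simp [mul_apply, sqrtZeta_one]

lemma sqrtZeta_le_one (n : ℕ) : sqrtZeta n ≤ 1 := by
  rcases Nat.eq_zero_or_pos n with h0 | h0
  · simp [h0]
  · rw [← sqrtZeta_mul_self h0, mul_apply]
    have := single_le_sum (f := fun x : ℕ × ℕ ↦ sqrtZeta x.1 * sqrtZeta x.2)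
      (s := n.divisorsAntidiagonal) (fun x _ ↦ mul_nonneg (sqrtZeta_nonneg _) (sqrtZeta_nonneg _))
      (a := (1, n)) (Nat.mem_divisorsAntidiagonal.mpr ⟨Nat.one_mul n, h0.ne'⟩)
    simpa [sqrtZeta_one] using this

end SqrtZeta

section SqrtZetaSeries
open Finset ArithmeticFunction

lemma LSeriesSummable_sqrtZeta {s : ℂ} (hs : 1 < s.re) :
    LSeriesSummable (fun n ↦ (sqrtZeta n : ℂ)) s := by
  refine LSeriesSummable_of_bounded_of_one_lt_re (m := 1) (fun n _ ↦ ?_) hs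
  rw [Complex.norm_real, Real.norm_of_nonneg (sqrtZeta_nonneg n)]
  exact sqrtZeta_le_one n

lemma riemannZeta_eq_LSeries_sqrtZeta_mul_self {s : ℂ} (hs : 1 < s.re) :
    riemannZeta s = LSeries (fun n ↦ (sqrtZeta n : ℂ)) s *
      LSeries (fun n ↦ (sqrtZeta n : ℂ)) s := by
  rw [← LSeries_convolution' (LSeriesSummable_sqrtZeta hs) (LSeriesSummable_sqrtZeta hs),
    ← LSeries_one_eq_riemannZeta hs]
  refine LSeries_congr (fun {n} hn ↦ ?_) s
  rw [LSeries.convolution_def, Pi.one_apply]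
  have := sqrtZeta_mul_self (Nat.one_le_iff_ne_zero.mpr hn)
  rw [mul_apply] at this
  dsimp only
  exact_mod_cast this.symm

lemma norm_tsum_le_of_norm_eq {a : ℕ → ℂ} {b : ℕ → ℂ} (hab : ∀ n, ‖a n‖ = ‖b n‖)
    (hb : Summable fun n ↦ ‖b n‖) (N : ℕ) : ‖∑' n, a (n + N)‖ ≤ ∑' n, ‖b (n + N)‖ := by
  have h := (summable_nat_add_iff N).mpr hb
  refine (norm_tsum_le_tsum_norm ?_).trans_eq ?_
  · simpa only [hab] using h
  · simp only [hab]

lemma exists_norm_riemannZeta_le_sqrtZeta_sum {σ : ℝ} (hσ : 1 < σ) :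
    ∃ N : ℕ, ∀ t : ℝ, ‖riemannZeta (σ + t * Complex.I)‖ ≤
      2 * ‖∑ n ∈ range N, LSeries.term (fun n ↦ (sqrtZeta n : ℂ)) (σ + t * Complex.I) n‖ ^ 2
        + 2 := by
  have hre (t : ℝ) : ((σ : ℂ) + t * Complex.I).re = σ := by simp
  have hnorm (t : ℝ) (n : ℕ) :
      ‖LSeries.term (fun n ↦ (sqrtZeta n : ℂ)) (σ + t * Complex.I) n‖ =
      ‖LSeries.term (fun n ↦ (sqrtZeta n : ℂ)) σ n‖ := by
    rw [LSeries.norm_term_eq, LSeries.norm_term_eq, hre, Complex.ofReal_re]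
  have hsum : Summable fun n ↦ ‖LSeries.term (fun n ↦ (sqrtZeta n : ℂ)) σ n‖ :=
    (LSeriesSummable_sqrtZeta (s := σ) (by simpa)).norm
  have htail := _root_.tendsto_sum_nat_add
    (fun n ↦ ‖LSeries.term (fun n ↦ (sqrtZeta n : ℂ)) σ n‖)
  obtain ⟨N, hN⟩ := (htail.eventually (gt_mem_nhds one_pos)).exists
  refine ⟨N, fun t ↦ ?_⟩
  have hs : 1 < ((σ : ℂ) + t * Complex.I).re := by rwa [hre]
  rw [riemannZeta_eq_LSeries_sqrtZeta_mul_self hs, norm_mul, LSeries,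
    ← (LSeriesSummable_sqrtZeta hs).sum_add_tsum_nat_add N]
  set u := ∑ n ∈ range N, LSeries.term (fun n ↦ (sqrtZeta n : ℂ)) (σ + t * Complex.I) n
  have hv : ‖∑' n, LSeries.term (fun n ↦ (sqrtZeta n : ℂ)) (σ + t * Complex.I) (n + N)‖ ≤ 1 :=
    (norm_tsum_le_of_norm_eq (hnorm t) hsum N).trans hN.le
  have h := norm_add_le u
    (∑' n, LSeries.term (fun n ↦ (sqrtZeta n : ℂ)) (σ + t * Complex.I) (n + N))
  have h0 := norm_nonneg (u +
    ∑' n, LSeries.term (fun n ↦ (sqrtZeta n : ℂ)) (σ + t * Complex.I) (n + N))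
  generalize ‖u + ∑' n, LSeries.term (fun n ↦ (sqrtZeta n : ℂ)) (σ + t * Complex.I) (n + N)‖ = w
    at h h0 ⊢
  have h1 : w ≤ ‖u‖ + 1 := by linarith
  have h2 := norm_nonneg u
  nlinarith [mul_self_le_mul_self h0 h1, sq_nonneg (‖u‖ - 1)]

lemma sq_sum_sqrtZeta_div_le (X : ℕ) :
    (∑ n ∈ Ioc 0 X, sqrtZeta n / n) ^ 2 ≤ 1 + 2 * Real.log X := by
  let F : ArithmeticFunction ℝ := ⟨fun n ↦ sqrtZeta n / n, by simp⟩
  have hF (n : ℕ) : F n = sqrtZeta n / n := rfl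
  have hF0 (n : ℕ) : 0 ≤ F n := div_nonneg (sqrtZeta_nonneg n) (by positivity)
  have hFF {n : ℕ} (hn : 1 ≤ n) : (F * F) n = ((n : ℝ))⁻¹ := by
    rw [← one_div, ← sqrtZeta_mul_self hn, mul_apply, mul_apply, sum_div]
    refine sum_congr rfl fun x hx ↦ ?_
    rw [hF, hF, ← (Nat.mem_divisorsAntidiagonal.mp hx).1]
    push_cast
    ring
  calc (∑ n ∈ Ioc 0 X, sqrtZeta n / n) ^ 2 = ∑ n ∈ Ioc 0 X, F n * ∑ m ∈ Ioc 0 X, F m := by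
        rw [← sum_mul, sq]; rfl
    _ ≤ ∑ n ∈ Ioc 0 X, F n * ∑ m ∈ Ioc 0 (X * X / n), F m := by
        refine sum_le_sum fun n hn ↦ mul_le_mul_of_nonneg_left ?_ (hF0 n)
        rw [mem_Ioc] at hn
        refine sum_le_sum_of_subset_of_nonneg (Ioc_subset_Ioc_right ?_) fun _ _ _ ↦ hF0 _
        rw [Nat.le_div_iff_mul_le hn.1]
        exact Nat.mul_le_mul_left X hn.2
    _ ≤ ∑ n ∈ Ioc 0 (X * X), F n * ∑ m ∈ Ioc 0 (X * X / n), F m :=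
        sum_le_sum_of_subset_of_nonneg (Ioc_subset_Ioc_right (Nat.le_mul_self X))
          fun _ _ _ ↦ mul_nonneg (hF0 _) (sum_nonneg fun _ _ ↦ hF0 _)
    _ = ∑ n ∈ Ioc 0 (X * X), ((n : ℝ))⁻¹ := by
        rw [← sum_Ioc_mul_eq_sum_sum]
        exact sum_congr rfl fun n hn ↦ hFF (mem_Ioc.mp hn).1
    _ ≤ 1 + Real.log (X * X : ℕ) := by
        have h := harmonic_le_one_add_log (X * X)
        rw [harmonic_eq_sum_Icc] at h
        push_cast at h ⊢
        exact h
    _ = 1 + 2 * Real.log X := by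
        rcases Nat.eq_zero_or_pos X with h | h
        · simp [h]
        · rw [Nat.cast_mul, Real.log_mul (by positivity) (by positivity)]; ring

lemma sum_sqrtZeta_mul_log_le (X : ℕ) :
    ∑ n ∈ Ioc 0 X, sqrtZeta n * Real.log n ≤ 3 * X * ∑ n ∈ Ioc 0 X, sqrtZeta n / n := by
  simp_rw [sqrtZeta_mul_log, mul_comm vonMangoldt sqrtZeta]
  rw [← sum_div, sum_Ioc_mul_eq_sum_sum, sum_div, mul_sum]
  refine sum_le_sum fun n hn ↦ ?_
  have hn0 : 0 < n := (mem_Ioc.mp hn).1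
  have h1 : ∑ m ∈ Ioc 0 (X / n), (vonMangoldt m : ℝ) ≤ 6 * (X / n : ℝ) := by
    have h := Chebyshev.psi_le_const_mul_self (x := (X / n : ℝ)) (by positivity)
    rw [Chebyshev.psi, Nat.floor_div_natCast, Nat.floor_natCast] at h
    have h4 : Real.log 4 ≤ 2 := by
      rw [show (4 : ℝ) = 2 ^ 2 by norm_num, Real.log_pow]
      have := Real.log_two_lt_d9
      norm_num; linarith
    refine h.trans (mul_le_mul_of_nonneg_right (by linarith) (by positivity))
  have h2 := mul_le_mul_of_nonneg_left h1 (sqrtZeta_nonneg n)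
  calc _ ≤ sqrtZeta n * (6 * (X / n : ℝ)) / 2 := by gcongr
    _ = _ := by ring

lemma sq_sum_dyadic_sqrtZeta_div_le (j : ℕ) :
    (∑ n ∈ Ico (2 ^ j) (2 ^ (j + 1)), sqrtZeta n / n) ^ 2 ≤ 800 / (j + 1) := by
  rcases Nat.eq_zero_or_pos j with hj | hj
  · subst hj
    norm_num [sqrtZeta_one]
  set X : ℕ := 2 ^ (j + 1) with hX
  set B := ∑ n ∈ Ico (2 ^ j) X, sqrtZeta n / n with hB
  set H := ∑ n ∈ Ioc 0 X, sqrtZeta n / n with hH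
  have hB0 : 0 ≤ B := sum_nonneg fun n _ ↦ div_nonneg (sqrtZeta_nonneg n) (by positivity)
  have hl := Real.log_two_gt_d9
  have hl' := Real.log_two_lt_d9
  have hj1 : (1 : ℝ) ≤ j := by exact_mod_cast hj
  have h1 : B * (2 ^ j * (j * Real.log 2)) ≤ ∑ n ∈ Ioc 0 X, sqrtZeta n * Real.log n := by
    calc B * (2 ^ j * (j * Real.log 2))
        = ∑ n ∈ Ico (2 ^ j) X, sqrtZeta n / n * (2 ^ j * (j * Real.log 2)) := by rw [hB, sum_mul]
      _ ≤ ∑ n ∈ Ico (2 ^ j) X, sqrtZeta n * Real.log n := by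
          refine sum_le_sum fun n hn ↦ ?_
          have hn1 : ((2 : ℝ)) ^ j ≤ n := by exact_mod_cast (mem_Ico.mp hn).1
          have hn0 : (0 : ℝ) < n := lt_of_lt_of_le (by positivity) hn1
          have hlog : j * Real.log 2 ≤ Real.log n := by
            rw [← Real.log_pow]; exact Real.log_le_log (by positivity) hn1
          have := sqrtZeta_nonneg n
          calc sqrtZeta n / n * (2 ^ j * (j * Real.log 2))
              ≤ sqrtZeta n / n * (n * Real.log n) := by gcongr
            _ = _ := by field_simp
      _ ≤ _ := by
          refine sum_le_sum_of_subset_of_nonneg (fun n hn ↦ ?_) fun n _ _ ↦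
            mul_nonneg (sqrtZeta_nonneg n) (Real.log_natCast_nonneg n)
          rw [mem_Ico] at hn
          rw [mem_Ioc]
          exact ⟨lt_of_lt_of_le (by positivity) hn.1, hn.2.le⟩
  have h2 := h1.trans (sum_sqrtZeta_mul_log_le X)
  have h3 : B * (j * Real.log 2) ≤ 6 * H := by
    have hp : (0 : ℝ) < 2 ^ j := by positivity
    rw [← hH, hX] at h2
    push_cast at h2
    rw [pow_succ] at h2
    refine le_of_mul_le_mul_left ?_ hp
    linarith
  have h4 : H ^ 2 ≤ 5 * j := by
    refine (sq_sum_sqrtZeta_div_le X).trans ?_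
    rw [hX]
    push_cast
    rw [Real.log_pow]
    push_cast
    nlinarith
  have h5 : (B * (j * Real.log 2)) ^ 2 ≤ 180 * j := by
    have h0 : 0 ≤ B * (j * Real.log 2) := by positivity
    calc _ ≤ (6 * H) ^ 2 := by gcongr
      _ ≤ 180 * j := by rw [mul_pow]; linarith
  have h6 : B ^ 2 * (j * (12 / 25)) ≤ 180 := by
    refine le_of_mul_le_mul_right ?_ (show (0 : ℝ) < j by linarith)
    have h7 : (12 / 25 : ℝ) ≤ Real.log 2 ^ 2 := by nlinarith
    calc B ^ 2 * (j * (12 / 25)) * j = B ^ 2 * j ^ 2 * (12 / 25) := by ring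
      _ ≤ B ^ 2 * j ^ 2 * Real.log 2 ^ 2 := by gcongr
      _ = (B * (j * Real.log 2)) ^ 2 := by ring
      _ ≤ _ := h5
  rw [le_div_iff₀ (by positivity)]
  have h8 : 0 ≤ B ^ 2 := sq_nonneg B
  nlinarith

end SqrtZetaSeries

section GaussianMeanSquare
open Finset MeasureTheory

lemma integrable_cos_mul_gaussian (l T : ℝ) :
    Integrable fun t : ℝ ↦ Real.cos (l * t) * Real.exp (-(t - T) ^ 2) := by
  have h : Integrable fun t : ℝ ↦ Real.exp (-(t - T) ^ 2) := by
    have := (integrable_exp_neg_mul_sq one_pos).comp_sub_right T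
    simpa using this
  refine h.mono' (by fun_prop) (Filter.Eventually.of_forall fun t ↦ ?_)
  rw [norm_mul, Real.norm_of_nonneg (Real.exp_pos _).le]
  exact mul_le_of_le_one_left (Real.exp_pos _).le (Real.abs_cos_le_one _)

lemma integral_cos_mul_gaussian_le (l T : ℝ) :
    ∫ t : ℝ, Real.cos (l * t) * Real.exp (-(t - T) ^ 2) ≤
      2 * Real.exp (-(l ^ 2 / 4)) := by
  have h1 : ∫ t : ℝ, Complex.exp (Complex.I * l * t) * Complex.exp (-(1 : ℂ) * t ^ 2) =
      (Real.pi / 1 : ℂ) ^ (1 / 2 : ℂ) * Complex.exp (-(l : ℂ) ^ 2 / (4 * 1)) :=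
    fourierIntegral_gaussian (by simp) (l : ℂ)
  have h2 : ∫ t : ℝ, Complex.exp (Complex.I * l * t) * (Real.exp (-(t - T) ^ 2) : ℂ) =
      phase (l * T) *
        ((Real.pi / 1 : ℂ) ^ (1 / 2 : ℂ) * Complex.exp (-(l : ℂ) ^ 2 / (4 * 1))) := by
    rw [← h1, ← integral_const_mul, ← integral_sub_right_eq_self (fun t : ℝ ↦ phase (l * T) *
      (Complex.exp (Complex.I * l * t) * Complex.exp (-(1 : ℂ) * t ^ 2))) T]
    refine integral_congr_ae (Filter.Eventually.of_forall fun t ↦ ?_)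
    simp only [phase]
    push_cast
    rw [← Complex.exp_add, ← Complex.exp_add, ← Complex.exp_add]
    congr 1
    ring
  have h3 : ∫ t : ℝ, Real.cos (l * t) * Real.exp (-(t - T) ^ 2) =
      (∫ t : ℝ, Complex.exp (Complex.I * l * t) * (Real.exp (-(t - T) ^ 2) : ℂ)).re := by
    have hInt : Integrable fun t : ℝ ↦
        Complex.exp (Complex.I * l * t) * (Real.exp (-(t - T) ^ 2) : ℂ) := by
      have h : Integrable fun t : ℝ ↦ Real.exp (-(t - T) ^ 2) := by
        simpa using integrable_cos_mul_gaussian 0 T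
      refine h.mono' (by fun_prop) (Filter.Eventually.of_forall fun t ↦ ?_)
      rw [norm_mul, Complex.norm_real, Real.norm_of_nonneg (Real.exp_pos _).le,
        show Complex.I * l * t = ((l * t : ℝ) : ℂ) * Complex.I by push_cast; ring,
        Complex.norm_exp_ofReal_mul_I, one_mul]
    rw [← Complex.reCLM_apply, ← ContinuousLinearMap.integral_comp_comm _ hInt]
    refine integral_congr_ae (Filter.Eventually.of_forall fun t ↦ ?_)
    simp only [Complex.reCLM_apply, Complex.re_mul_ofReal]
    rw [show Complex.I * l * t = ((l * t : ℝ) : ℂ) * Complex.I by push_cast; ring,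
      Complex.exp_ofReal_mul_I_re]
  have hpi : ‖(Real.pi / 1 : ℂ) ^ (1 / 2 : ℂ)‖ ≤ 2 := by
    rw [div_one, Complex.norm_cpow_eq_rpow_re_of_pos Real.pi_pos]
    norm_num
    rw [← Real.sqrt_eq_rpow, Real.sqrt_le_left (by norm_num)]
    linarith [Real.pi_le_four]
  rw [h3, h2]
  refine (Complex.re_le_norm _).trans ?_
  rw [norm_mul, norm_mul, norm_phase, one_mul, Complex.norm_exp]
  have : (-(l : ℂ) ^ 2 / (4 * 1)).re = -(l ^ 2 / 4) := by
    rw [show (-(l : ℂ) ^ 2 / (4 * 1)) = ((-(l ^ 2 / 4) : ℝ) : ℂ) by push_cast; ring,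
      Complex.ofReal_re]
  rw [this]
  gcongr

lemma sq_norm_sum_phase_eq (c l : ℕ → ℝ) (N : ℕ) (t : ℝ) :
    ‖∑ n ∈ range N, (c n : ℂ) * phase (-t * l n)‖ ^ 2 =
      ∑ m ∈ range N, ∑ n ∈ range N, c m * c n * Real.cos ((l m - l n) * t) := by
  have h : ((‖∑ n ∈ range N, (c n : ℂ) * phase (-t * l n)‖ ^ 2 : ℝ) : ℂ) =
      ∑ m ∈ range N, ∑ n ∈ range N, (c m * c n : ℝ) * phase ((l n - l m) * t) := by
    rw [← Complex.normSq_eq_norm_sq, ← Complex.mul_conj, map_sum, sum_mul_sum]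
    refine sum_congr rfl fun m _ ↦ sum_congr rfl fun n _ ↦ ?_
    rw [map_mul, conj_phase, Complex.conj_ofReal,
      show (l n - l m) * t = -t * l m + -(-t * l n) by ring, phase_add]
    push_cast
    ring
  have h2 := congrArg Complex.re h
  rw [Complex.ofReal_re] at h2
  rw [h2, Complex.re_sum]
  refine sum_congr rfl fun m _ ↦ ?_
  rw [Complex.re_sum]
  refine sum_congr rfl fun n _ ↦ ?_
  rw [Complex.re_ofReal_mul, phase, Complex.exp_ofReal_mul_I_re, ← Real.cos_neg]
  congr 2
  ring

lemma integral_sq_norm_sum_phase_le {c l : ℕ → ℝ} (hc : ∀ n, 0 ≤ c n) (N : ℕ) (T : ℝ) {δ : ℝ}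
    (hδ : 0 ≤ δ) :
    ∫ t in T..(T + δ), ‖∑ n ∈ range N, (c n : ℂ) * phase (-t * l n)‖ ^ 2 ≤
      2 * Real.exp (δ ^ 2) * ∑ m ∈ range N, ∑ n ∈ range N,
        c m * c n * Real.exp (-((l m - l n) ^ 2 / 4)) := by
  set g : ℝ → ℝ := fun t ↦ ‖∑ n ∈ range N, (c n : ℂ) * phase (-t * l n)‖ ^ 2 with hg
  have hgc : Continuous g := by
    simp only [hg, phase]
    fun_prop
  have heq : (fun t ↦ g t * Real.exp (-(t - T) ^ 2)) = fun t ↦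
      ∑ m ∈ range N, ∑ n ∈ range N,
        c m * c n * (Real.cos ((l m - l n) * t) * Real.exp (-(t - T) ^ 2)) := by
    funext t
    simp only [hg, sq_norm_sum_phase_eq, sum_mul]
    refine sum_congr rfl fun m _ ↦ sum_congr rfl fun n _ ↦ ?_
    ring
  have hInt (m n : ℕ) : Integrable fun t : ℝ ↦
      c m * c n * (Real.cos ((l m - l n) * t) * Real.exp (-(t - T) ^ 2)) :=
    (integrable_cos_mul_gaussian _ T).const_mul _
  have hI : Integrable fun t ↦ g t * Real.exp (-(t - T) ^ 2) := by
    rw [heq]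
    exact integrable_finsetSum _ fun m _ ↦ integrable_finsetSum _ fun n _ ↦ hInt m n
  calc ∫ t in T..(T + δ), g t
      ≤ ∫ t in T..(T + δ), Real.exp (δ ^ 2) * (g t * Real.exp (-(t - T) ^ 2)) := by
        refine intervalIntegral.integral_mono_on (by linarith)
          (hgc.intervalIntegrable _ _)
          (Continuous.intervalIntegrable (by fun_prop) _ _) fun t ht ↦ ?_
        have h1 : 1 ≤ Real.exp (δ ^ 2) * Real.exp (-(t - T) ^ 2) := by
          rw [← Real.exp_add]
          refine Real.one_le_exp ?_
          have h2 : 0 ≤ t - T := by linarith [ht.1]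
          have h3 : t - T ≤ δ := by linarith [ht.2]
          have := pow_le_pow_left₀ h2 h3 2
          linarith
        calc g t = g t * 1 := (mul_one _).symm
          _ ≤ g t * (Real.exp (δ ^ 2) * Real.exp (-(t - T) ^ 2)) :=
            mul_le_mul_of_nonneg_left h1 (by positivity)
          _ = _ := by ring
    _ = Real.exp (δ ^ 2) * ∫ t in Set.Ioc T (T + δ), g t * Real.exp (-(t - T) ^ 2) := by
        rw [intervalIntegral.integral_const_mul, intervalIntegral.integral_of_le (by linarith)]
    _ ≤ Real.exp (δ ^ 2) * ∫ t, g t * Real.exp (-(t - T) ^ 2) := by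
        refine mul_le_mul_of_nonneg_left ?_ (Real.exp_pos _).le
        refine setIntegral_le_integral hI (Filter.Eventually.of_forall fun t ↦ ?_)
        simp only [Pi.zero_apply, hg]
        positivity
    _ ≤ Real.exp (δ ^ 2) * ∑ m ∈ range N, ∑ n ∈ range N,
          c m * c n * (2 * Real.exp (-((l m - l n) ^ 2 / 4))) := by
        gcongr
        rw [heq, integral_finsetSum _ fun m _ ↦ integrable_finsetSum _ fun n _ ↦ hInt m n]
        refine sum_le_sum fun m _ ↦ ?_
        rw [integral_finsetSum _ fun n _ ↦ hInt m n]
        refine sum_le_sum fun n _ ↦ ?_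
        rw [integral_const_mul]
        exact mul_le_mul_of_nonneg_left (integral_cos_mul_gaussian_le _ _)
          (mul_nonneg (hc m) (hc n))
    _ = _ := by
        simp only [mul_sum]
        refine sum_congr rfl fun m _ ↦ sum_congr rfl fun n _ ↦ ?_
        ring

end GaussianMeanSquare

section Dyadic
open Finset

lemma sum_range_two_pow_eq (F : ℕ → ℝ) (J : ℕ) :
    ∑ n ∈ range (2 ^ J), F n = F 0 + ∑ j ∈ range J, ∑ n ∈ Ico (2 ^ j) (2 ^ (j + 1)), F n := by
  induction J with
  | zero => simp
  | succ J ih =>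
    rw [sum_range_succ, ← add_assoc, ← ih, range_eq_Ico, range_eq_Ico,
      sum_Ico_consecutive _ (Nat.zero_le _) (Nat.pow_le_pow_right (by norm_num) (by omega))]

lemma sum_half_pow_dist_le (j J : ℕ) :
    ∑ k ∈ range J, (1 / 2 : ℝ) ^ ((j - k) + (k - j)) ≤ 4 := by
  have hgeo (n : ℕ) : ∑ i ∈ range n, (1 / 2 : ℝ) ^ i ≤ 2 := sum_geometric_two_le n
  calc ∑ k ∈ range J, (1 / 2 : ℝ) ^ ((j - k) + (k - j))
      ≤ ∑ k ∈ range (j + 1 + J), (1 / 2 : ℝ) ^ ((j - k) + (k - j)) :=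
        sum_le_sum_of_subset_of_nonneg (range_mono (by omega)) fun _ _ _ ↦ by positivity
    _ = ∑ k ∈ range (j + 1), (1 / 2 : ℝ) ^ ((j - k) + (k - j)) +
        ∑ i ∈ range J, (1 / 2 : ℝ) ^ ((j - (j + 1 + i)) + (j + 1 + i - j)) :=
        sum_range_add _ _ _
    _ ≤ 2 + 2 := by
        refine add_le_add ?_ ?_
        · refine le_trans (le_of_eq ?_) (hgeo (j + 1))
          rw [← sum_range_reflect]
          refine sum_congr rfl fun k hk ↦ ?_
          rw [mem_range] at hk
          congr 1
          omega
        · refine le_trans (sum_le_sum fun i _ ↦ ?_) (hgeo J)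
          exact pow_le_pow_of_le_one (by norm_num) (by norm_num) (by omega)
    _ = 4 := by norm_num

lemma sum_mul_half_pow_dist_le (A : ℕ → ℝ) (J : ℕ) :
    ∑ j ∈ range J, ∑ k ∈ range J, A j * A k * (1 / 2 : ℝ) ^ ((j - k) + (k - j)) ≤
      4 * ∑ j ∈ range J, A j ^ 2 := by
  set q : ℕ → ℕ → ℝ := fun j k ↦ (1 / 2 : ℝ) ^ ((j - k) + (k - j)) with hq
  have hq0 (j k : ℕ) : 0 ≤ q j k := by positivity
  have hqs (j k : ℕ) : q j k = q k j := by simp only [hq, add_comm]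
  have h1 : ∑ j ∈ range J, ∑ k ∈ range J, A j ^ 2 * q j k ≤ 4 * ∑ j ∈ range J, A j ^ 2 := by
    rw [mul_sum]
    refine sum_le_sum fun j _ ↦ ?_
    rw [← mul_sum, mul_comm]
    exact mul_le_mul_of_nonneg_right (sum_half_pow_dist_le j J) (sq_nonneg _)
  have h2 : ∑ j ∈ range J, ∑ k ∈ range J, A k ^ 2 * q j k =
      ∑ j ∈ range J, ∑ k ∈ range J, A j ^ 2 * q j k := by
    rw [sum_comm]
    exact sum_congr rfl fun j _ ↦ sum_congr rfl fun k _ ↦ by rw [hqs]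
  calc ∑ j ∈ range J, ∑ k ∈ range J, A j * A k * q j k
      ≤ ∑ j ∈ range J, ∑ k ∈ range J, (A j ^ 2 * q j k + A k ^ 2 * q j k) / 2 := by
        refine sum_le_sum fun j _ ↦ sum_le_sum fun k _ ↦ ?_
        rw [← add_mul, mul_div_right_comm]
        refine mul_le_mul_of_nonneg_right ?_ (hq0 j k)
        linarith [two_mul_le_add_sq (A j) (A k)]
    _ = (∑ j ∈ range J, ∑ k ∈ range J, A j ^ 2 * q j k +
        ∑ j ∈ range J, ∑ k ∈ range J, A k ^ 2 * q j k) / 2 := by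
        simp only [← sum_div, sum_add_distrib]
    _ ≤ _ := by rw [h2]; linarith

lemma exp_neg_sq_log_sub_le {j k m n : ℕ} (hm : m ∈ Ico (2 ^ j) (2 ^ (j + 1)))
    (hn : n ∈ Ico (2 ^ k) (2 ^ (k + 1))) :
    Real.exp (-((Real.log m - Real.log n) ^ 2 / 4)) ≤
      6 * (1 / 2 : ℝ) ^ ((j - k) + (k - j)) := by
  have hl := Real.log_two_gt_d9
  have hb {i r : ℕ} (h : r ∈ Ico (2 ^ i) (2 ^ (i + 1))) :
      i * Real.log 2 ≤ Real.log r ∧ Real.log r ≤ (i + 1) * Real.log 2 := by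
    rw [mem_Ico] at h
    have h1 : ((2 : ℝ)) ^ i ≤ r := by exact_mod_cast h.1
    have h2 : (r : ℝ) ≤ 2 ^ (i + 1) := by exact_mod_cast h.2.le
    have h0 : (0 : ℝ) < r := lt_of_lt_of_le (by positivity) h1
    have h3 := Real.log_le_log (by positivity) h1
    have h4 := Real.log_le_log h0 h2
    rw [Real.log_pow] at h3 h4
    push_cast at h4
    exact ⟨h3, h4⟩
  obtain ⟨hm1, hm2⟩ := hb hm
  obtain ⟨hn1, hn2⟩ := hb hn
  have hd : (((j - k) + (k - j) : ℕ) : ℝ) * Real.log 2 ≤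
      |Real.log m - Real.log n| + Real.log 2 := by
    rcases le_total j k with h | h
    · rw [Nat.sub_eq_zero_of_le h, zero_add, Nat.cast_sub h]
      have := neg_abs_le (Real.log m - Real.log n)
      linarith
    · rw [Nat.sub_eq_zero_of_le h, add_zero, Nat.cast_sub h]
      have := le_abs_self (Real.log m - Real.log n)
      linarith
  rw [← sq_abs]
  generalize |Real.log m - Real.log n| = x at hd
  generalize (j - k) + (k - j) = i at hd
  have h1 : (1 / 2 : ℝ) ^ i = Real.exp (-(i * Real.log 2)) := by
    rw [← Real.log_pow, Real.exp_neg, Real.exp_log (by positivity), one_div, inv_pow]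
  have he : 2 * Real.exp 1 ≤ 6 := by linarith [Real.exp_one_lt_d9]
  calc Real.exp (-(x ^ 2 / 4)) ≤ Real.exp (1 + Real.log 2 + -(i * Real.log 2)) := by
        rw [Real.exp_le_exp]
        linarith [sq_nonneg (x - 2)]
    _ = 2 * Real.exp 1 * (1 / 2) ^ i := by
        rw [Real.exp_add, Real.exp_add, Real.exp_log two_pos, h1]; ring
    _ ≤ _ := by gcongr

lemma sum_exp_neg_div_le {b : ℝ} (hb : 0 < b) {M : ℕ} (hM : 1 ≤ M) (hbM : 1 / b ≤ M) (J : ℕ) :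
    ∑ j ∈ range J, Real.exp (-(b * j)) / (j + 1) ≤ 3 + Real.log M := by
  have hM0 : (1 : ℝ) ≤ M := by exact_mod_cast hM
  have hterm (j : ℕ) : Real.exp (-(b * j)) / (j + 1) ≤
      (if j < M then ((j : ℝ) + 1)⁻¹ else 0) + 1 / (M : ℝ) * Real.exp (-(b * j)) := by
    have h1 : Real.exp (-(b * j)) ≤ 1 := Real.exp_le_one_iff.mpr (by simp; positivity)
    split_ifs with h
    · have : Real.exp (-(b * j)) / (j + 1) ≤ ((j : ℝ) + 1)⁻¹ := by
        rw [← one_div]; gcongr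
      have h2 : 0 ≤ 1 / (M : ℝ) * Real.exp (-(b * j)) := by positivity
      linarith
    · have hMj : (M : ℝ) ≤ j := by exact_mod_cast not_lt.mp h
      rw [zero_add, div_eq_mul_inv, mul_comm, ← one_div]
      gcongr
      linarith
  have h1 : ∑ j ∈ range J, (if j < M then ((j : ℝ) + 1)⁻¹ else 0) ≤ 1 + Real.log M := by
    have h := harmonic_le_one_add_log M
    refine le_trans ?_ h
    rw [harmonic, ← sum_filter]
    push_cast
    refine sum_le_sum_of_subset_of_nonneg (fun j hj ↦ ?_) fun _ _ _ ↦ by positivity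
    exact mem_range.mpr (mem_filter.mp hj).2
  have h2 : 1 / (M : ℝ) * ∑ j ∈ range J, Real.exp (-(b * j)) ≤ 2 := by
    calc _ ≤ 1 / (M : ℝ) * (M + M) := by
          gcongr
          exact (sum_exp_neg_le hb J).trans (add_le_add hM0 hbM)
      _ = 2 := by field_simp; norm_num
  calc _ ≤ ∑ j ∈ range J, ((if j < M then ((j : ℝ) + 1)⁻¹ else 0) +
        1 / (M : ℝ) * Real.exp (-(b * j))) := sum_le_sum fun j _ ↦ hterm j
    _ ≤ _ := by rw [sum_add_distrib, ← mul_sum]; linarith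

end Dyadic

section FirstMoment
open Finset MeasureTheory

lemma sum_sum_mul_exp_neg_sq_log_le {c : ℕ → ℝ} (hc : ∀ n, 0 ≤ c n) (hc0 : c 0 = 0) (N : ℕ) :
    ∑ m ∈ range N, ∑ n ∈ range N,
        c m * c n * Real.exp (-((Real.log m - Real.log n) ^ 2 / 4)) ≤
      24 * ∑ j ∈ range N, (∑ n ∈ Ico (2 ^ j) (2 ^ (j + 1)), c n) ^ 2 := by
  set F : ℕ → ℕ → ℝ := fun m n ↦
    c m * c n * Real.exp (-((Real.log m - Real.log n) ^ 2 / 4)) with hF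
  have hF0 (m n : ℕ) : 0 ≤ F m n :=
    mul_nonneg (mul_nonneg (hc m) (hc n)) (Real.exp_pos _).le
  have hsub : range N ⊆ range (2 ^ N) := range_mono Nat.lt_two_pow_self.le
  set I : ℕ → Finset ℕ := fun j ↦ Ico (2 ^ j) (2 ^ (j + 1)) with hI
  calc ∑ m ∈ range N, ∑ n ∈ range N, F m n
      ≤ ∑ m ∈ range (2 ^ N), ∑ n ∈ range (2 ^ N), F m n := by
        refine (sum_le_sum_of_subset_of_nonneg hsub fun m _ _ ↦
          sum_nonneg fun n _ ↦ hF0 m n).trans (sum_le_sum fun m _ ↦ ?_)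
        exact sum_le_sum_of_subset_of_nonneg hsub fun n _ _ ↦ hF0 m n
    _ = ∑ j ∈ range N, ∑ m ∈ I j, ∑ k ∈ range N, ∑ n ∈ I k, F m n := by
        have h1 (m : ℕ) : ∑ n ∈ range (2 ^ N), F m n = ∑ k ∈ range N, ∑ n ∈ I k, F m n := by
          rw [sum_range_two_pow_eq]
          simp [hF, hc0, hI]
        simp only [h1]
        rw [sum_range_two_pow_eq]
        simp [hF, hc0, hI]
    _ ≤ ∑ j ∈ range N, ∑ m ∈ I j, ∑ k ∈ range N, ∑ n ∈ I k,
          c m * c n * (6 * (1 / 2 : ℝ) ^ ((j - k) + (k - j))) := by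
        refine sum_le_sum fun j _ ↦ sum_le_sum fun m hm ↦ sum_le_sum fun k _ ↦
          sum_le_sum fun n hn ↦ ?_
        exact mul_le_mul_of_nonneg_left (exp_neg_sq_log_sub_le hm hn)
          (mul_nonneg (hc m) (hc n))
    _ = 6 * ∑ j ∈ range N, ∑ k ∈ range N, (∑ n ∈ I j, c n) * (∑ n ∈ I k, c n) *
          (1 / 2 : ℝ) ^ ((j - k) + (k - j)) := by
        rw [mul_sum]
        refine sum_congr rfl fun j _ ↦ ?_
        rw [sum_comm, mul_sum]
        refine sum_congr rfl fun k _ ↦ ?_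
        rw [sum_mul_sum]
        simp only [sum_mul, mul_sum]
        refine sum_congr rfl fun m _ ↦ sum_congr rfl fun n _ ↦ ?_
        ring
    _ ≤ 6 * (4 * ∑ j ∈ range N, (∑ n ∈ I j, c n) ^ 2) := by
        gcongr
        exact sum_mul_half_pow_dist_le _ N
    _ = _ := by ring

lemma sum_sq_sum_dyadic_sqrtZeta_le {a : ℝ} (ha : 0 < a) {M : ℕ} (hM : 1 ≤ M)
    (haM : 1 / a ≤ M) (J : ℕ) :
    ∑ j ∈ range J, (∑ n ∈ Ico (2 ^ j) (2 ^ (j + 1)), sqrtZeta n * (n : ℝ) ^ (-(1 + a))) ^ 2 ≤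
      800 * (3 + Real.log M) := by
  have hl := Real.log_two_gt_d9
  have hb : 0 < 2 * a * Real.log 2 := by positivity
  have hbM : 1 / (2 * a * Real.log 2) ≤ M := by
    refine le_trans (one_div_le_one_div_of_le ha ?_) haM
    nlinarith
  refine le_trans (sum_le_sum fun j _ ↦ ?_)
    ((mul_sum _ _ _).symm.trans_le
      (mul_le_mul_of_nonneg_left (sum_exp_neg_div_le hb hM hbM J) (by norm_num : (0 : ℝ) ≤ 800)))
  have h1 : ∑ n ∈ Ico (2 ^ j) (2 ^ (j + 1)), sqrtZeta n * (n : ℝ) ^ (-(1 + a)) ≤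
      (∑ n ∈ Ico (2 ^ j) (2 ^ (j + 1)), sqrtZeta n / n) * Real.exp (-(a * Real.log 2 * j)) := by
    rw [sum_mul]
    refine sum_le_sum fun n hn ↦ ?_
    have hn1 : ((2 : ℝ)) ^ j ≤ n := by exact_mod_cast (mem_Ico.mp hn).1
    have hn0 : (0 : ℝ) < n := lt_of_lt_of_le (by positivity) hn1
    have hlog : j * Real.log 2 ≤ Real.log n := by
      rw [← Real.log_pow]; exact Real.log_le_log (by positivity) hn1
    rw [neg_add, Real.rpow_add hn0, Real.rpow_neg_one, div_eq_mul_inv, mul_assoc]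
    refine mul_le_mul_of_nonneg_left ?_ (sqrtZeta_nonneg n)
    refine mul_le_mul_of_nonneg_left ?_ (by positivity)
    rw [Real.rpow_def_of_pos hn0, Real.exp_le_exp]
    have := mul_le_mul_of_nonneg_left hlog ha.le
    linarith
  have h0 : 0 ≤ ∑ n ∈ Ico (2 ^ j) (2 ^ (j + 1)), sqrtZeta n * (n : ℝ) ^ (-(1 + a)) :=
    sum_nonneg fun n _ ↦ mul_nonneg (sqrtZeta_nonneg n) (by positivity)
  refine (pow_le_pow_left₀ h0 h1 2).trans ?_
  rw [mul_pow, ← Real.exp_nat_mul]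
  calc _ ≤ 800 / ((j : ℝ) + 1) * Real.exp ((2 : ℕ) * -(a * Real.log 2 * j)) :=
        mul_le_mul_of_nonneg_right (sq_sum_dyadic_sqrtZeta_div_le j) (Real.exp_pos _).le
    _ = _ := by
        rw [show ((2 : ℕ) : ℝ) * -(a * Real.log 2 * j) = -(2 * a * Real.log 2 * j) by
          push_cast; ring]
        ring

lemma term_sqrtZeta_eq (σ t : ℝ) (n : ℕ) :
    LSeries.term (fun n ↦ (sqrtZeta n : ℂ)) (σ + t * Complex.I) n =
      ((sqrtZeta n * (n : ℝ) ^ (-σ) : ℝ) : ℂ) * phase (-t * Real.log n) := by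
  rcases Nat.eq_zero_or_pos n with h | h
  · simp [h]
  · rw [LSeries.term_of_ne_zero h.ne', div_eq_mul_inv, ← Complex.cpow_neg,
      natCast_cpow_neg_eq h, Complex.ofReal_mul, mul_assoc]

lemma continuous_norm_riemannZeta {σ : ℝ} (hσ : 1 < σ) :
    Continuous fun t : ℝ ↦ ‖riemannZeta (σ + t * Complex.I)‖ := by
  refine continuous_norm.comp (continuous_iff_continuousAt.mpr fun t ↦ ?_)
  refine ContinuousAt.comp (f := fun t : ℝ ↦ (σ : ℂ) + t * Complex.I) (g := riemannZeta)
    (differentiableAt_riemannZeta fun h ↦ ?_).continuousAt (by fun_prop)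
  have := congrArg Complex.re h
  simp at this
  linarith

lemma integral_norm_riemannZeta_right_le {a δ : ℝ} (ha : 0 < a) (hδ : 0 ≤ δ) {M : ℕ}
    (hM : 1 ≤ M) (haM : 1 / a ≤ M) (T : ℝ) :
    ∫ t in T..(T + δ), ‖riemannZeta ((1 + a : ℝ) + t * Complex.I)‖ ≤
      76800 * Real.exp (δ ^ 2) * (3 + Real.log M) + 2 * δ := by
  obtain ⟨N, hN⟩ := exists_norm_riemannZeta_le_sqrtZeta_sum (σ := 1 + a) (by linarith)
  simp only [term_sqrtZeta_eq] at hN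
  set c : ℕ → ℝ := fun n ↦ sqrtZeta n * (n : ℝ) ^ (-(1 + a)) with hc
  have hc0 (n : ℕ) : 0 ≤ c n := mul_nonneg (sqrtZeta_nonneg n) (by positivity)
  have hcont : Continuous fun t : ℝ ↦
      ‖∑ n ∈ range N, (c n : ℂ) * phase (-t * Real.log n)‖ ^ 2 := by
    simp only [phase]
    fun_prop
  have hbound : ∫ t in T..(T + δ), ‖∑ n ∈ range N, (c n : ℂ) * phase (-t * Real.log n)‖ ^ 2 ≤
      38400 * Real.exp (δ ^ 2) * (3 + Real.log M) := by
    refine (integral_sq_norm_sum_phase_le (l := fun n ↦ Real.log n) hc0 N T hδ).trans ?_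
    have h1 := (sum_sum_mul_exp_neg_sq_log_le hc0 (by simp [hc]) N).trans
      (mul_le_mul_of_nonneg_left (sum_sq_sum_dyadic_sqrtZeta_le ha hM haM N)
        (by norm_num : (0 : ℝ) ≤ 24))
    refine (mul_le_mul_of_nonneg_left h1 (by positivity)).trans_eq ?_
    ring
  calc ∫ t in T..(T + δ), ‖riemannZeta ((1 + a : ℝ) + t * Complex.I)‖
      ≤ ∫ t in T..(T + δ),
          (2 * ‖∑ n ∈ range N, (c n : ℂ) * phase (-t * Real.log n)‖ ^ 2 + 2) :=
        intervalIntegral.integral_mono_on (by linarith)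
          ((continuous_norm_riemannZeta (by linarith)).intervalIntegrable _ _)
          (Continuous.intervalIntegrable (by fun_prop) _ _) fun t _ ↦ hN t
    _ = 2 * (∫ t in T..(T + δ), ‖∑ n ∈ range N, (c n : ℂ) * phase (-t * Real.log n)‖ ^ 2)
          + 2 * δ := by
        rw [intervalIntegral.integral_add (Continuous.intervalIntegrable (by fun_prop) _ _)
          (by simp), intervalIntegral.integral_const_mul, intervalIntegral.integral_const,
          smul_eq_mul]
        ring
    _ ≤ _ := by linarith

lemma norm_riemannZeta_one_add_le_right {a t : ℝ} (ha : 0 < a) (ha' : a ≤ 1) (ht : 2 ≤ t) :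
    ‖riemannZeta (1 + t * Complex.I)‖ ≤
      ‖riemannZeta ((1 + a : ℝ) + t * Complex.I)‖ + 10 +
        a * Real.log t * (1 + Real.log t) := by
  set u := ∑ n ∈ Ioc 0 ⌊t⌋₊, (n : ℂ) ^ (-(((1 : ℝ) : ℂ) + t * Complex.I)) with hu
  set v := ∑ n ∈ Ioc 0 ⌊t⌋₊, (n : ℂ) ^ (-(((1 + a : ℝ) : ℂ) + t * Complex.I)) with hv
  have h1 : ‖riemannZeta (((1 : ℝ) : ℂ) + t * Complex.I) - u‖ ≤ 5 :=
    norm_riemannZeta_sub_sum_floor_le le_rfl one_le_two ht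
  have h2 : ‖riemannZeta (((1 + a : ℝ) : ℂ) + t * Complex.I) - v‖ ≤ 5 :=
    norm_riemannZeta_sub_sum_floor_le (by linarith) (by linarith) ht
  have hfl : (⌊t⌋₊ : ℝ) ≤ t := Nat.floor_le (by linarith)
  have hfl1 : 1 ≤ ⌊t⌋₊ := Nat.le_floor (by norm_num; linarith)
  have hlogt : 0 ≤ Real.log t := Real.log_nonneg (by linarith)
  have h3 : ‖u - v‖ ≤ a * Real.log t * (1 + Real.log t) := by
    rw [hu, hv, ← sum_sub_distrib]
    calc _ ≤ ∑ n ∈ Ioc 0 ⌊t⌋₊, a * Real.log t * ((n : ℝ))⁻¹ := by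
          refine norm_sum_le_of_le _ fun n hn ↦ ?_
          obtain ⟨hn0, hn1⟩ := mem_Ioc.mp hn
          have hn0' : (0 : ℝ) < n := by exact_mod_cast hn0
          rw [natCast_cpow_neg_eq hn0, natCast_cpow_neg_eq hn0, ← sub_mul, norm_mul, norm_phase,
            mul_one, ← Complex.ofReal_sub, Complex.norm_real, neg_add, Real.rpow_add hn0',
            Real.rpow_neg_one]
          have hlog : Real.log n ≤ Real.log t :=
            Real.log_le_log hn0' ((Nat.cast_le.mpr hn1).trans hfl)
          have h4 : (n : ℝ) ^ (-a) ≤ 1 :=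
            Real.rpow_le_one_of_one_le_of_nonpos (by exact_mod_cast hn0) (by linarith)
          have h5 : 1 - a * Real.log t ≤ (n : ℝ) ^ (-a) := by
            rw [Real.rpow_def_of_pos hn0']
            have := Real.add_one_le_exp (Real.log n * -a)
            have h6 := mul_le_mul_of_nonneg_left hlog ha.le
            linarith
          have hinv : 0 ≤ ((n : ℝ))⁻¹ := by positivity
          rw [show ((n : ℝ))⁻¹ - ((n : ℝ))⁻¹ * (n : ℝ) ^ (-a) =
            (1 - (n : ℝ) ^ (-a)) * ((n : ℝ))⁻¹ by ring,
            Real.norm_of_nonneg (mul_nonneg (by linarith) hinv)]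
          exact mul_le_mul_of_nonneg_right (by linarith) hinv
      _ ≤ _ := by
          rw [← mul_sum]
          refine mul_le_mul_of_nonneg_left ?_ (by positivity)
          have h := harmonic_le_one_add_log ⌊t⌋₊
          rw [harmonic_eq_sum_Icc] at h
          push_cast at h
          refine h.trans ?_
          gcongr
  have h4 : riemannZeta (1 + t * Complex.I) =
      riemannZeta (((1 + a : ℝ) : ℂ) + t * Complex.I) +
      (riemannZeta (((1 : ℝ) : ℂ) + t * Complex.I) - u) -
      (riemannZeta (((1 + a : ℝ) : ℂ) + t * Complex.I) - v) + (u - v) := by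
    rw [Complex.ofReal_one]; ring
  rw [h4]
  refine (norm_add_le _ _).trans ?_
  have h5 := norm_sub_le (riemannZeta (((1 + a : ℝ) : ℂ) + t * Complex.I) +
      (riemannZeta (((1 : ℝ) : ℂ) + t * Complex.I) - u))
      (riemannZeta (((1 + a : ℝ) : ℂ) + t * Complex.I) - v)
  have h6 := norm_add_le (riemannZeta (((1 + a : ℝ) : ℂ) + t * Complex.I))
      (riemannZeta (((1 : ℝ) : ℂ) + t * Complex.I) - u)
  linarith

end FirstMoment

section Moment
open MeasureTheory

lemma continuousOn_norm_riemannZeta_one_add :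
    ContinuousOn (fun t : ℝ ↦ ‖riemannZeta (1 + t * Complex.I)‖) (Set.Ioi 0) := by
  intro t ht
  refine ContinuousAt.continuousWithinAt (ContinuousAt.norm ?_)
  refine ContinuousAt.comp (f := fun t : ℝ ↦ 1 + (t : ℂ) * Complex.I) (g := riemannZeta)
    (differentiableAt_riemannZeta fun h ↦ ?_).continuousAt (by fun_prop)
  have := congrArg Complex.im h
  simp at this
  exact (ne_of_gt ht) this

lemma intervalIntegrable_norm_riemannZeta_one_add {T δ : ℝ} (hT : 0 < T) (hδ : 0 ≤ δ) :
    IntervalIntegrable (fun t : ℝ ↦ ‖riemannZeta (1 + t * Complex.I)‖) volume T (T + δ) := by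
  refine ContinuousOn.intervalIntegrable (continuousOn_norm_riemannZeta_one_add.mono ?_)
  rw [Set.uIcc_of_le (by linarith)]
  exact fun t ht ↦ lt_of_lt_of_le hT ht.1

lemma log_le_two_mul_log {T δ t : ℝ} (hT : 2 ≤ T) (hδT : δ ≤ T) (ht : T ≤ t)
    (ht' : t ≤ T + δ) : Real.log t ≤ 2 * Real.log T := by
  calc Real.log t ≤ Real.log (T ^ 2) := Real.log_le_log (by linarith) (by nlinarith)
    _ = _ := by rw [Real.log_pow]; norm_num

lemma exists_integral_norm_riemannZeta_one_add_le {δ : ℝ} (hδ : 0 < δ) :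
    ∃ C > 0, ∀ T : ℝ, 3 ≤ T → δ ≤ T → 1 ≤ Real.log (Real.log T) →
      ∫ t in T..(T + δ), ‖riemannZeta (1 + t * Complex.I)‖ ≤ C * Real.log (Real.log T) := by
  refine ⟨76800 * Real.exp (δ ^ 2) * 6 + 18 * δ, by positivity, fun T hT hδT hLL ↦ ?_⟩
  set L := Real.log T with hL
  have hL0 : 0 < L := Real.log_pos (by linarith)
  have hL1 : 1 ≤ L := by
    have := Real.log_le_sub_one_of_pos hL0
    linarith
  set a : ℝ := 1 / L ^ 2 with ha
  have ha0 : 0 < a := by positivity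
  have haL : a * L ^ 2 = 1 := by rw [ha]; field_simp
  have hL2 : 1 ≤ L ^ 2 := one_le_pow₀ hL1
  have ha1 : a ≤ 1 := by rw [ha, div_le_one (by positivity)]; exact hL2
  set M : ℕ := ⌈L ^ 2⌉₊ with hM
  have hML : L ^ 2 ≤ (M : ℝ) := Nat.le_ceil _
  have hM1 : 1 ≤ M := by exact_mod_cast hL2.trans hML
  have haM : 1 / a ≤ M := by rw [ha, one_div_one_div]; exact hML
  have hlogM : Real.log M ≤ 1 + 2 * Real.log L := by
    have h1 : (M : ℝ) ≤ 2 * L ^ 2 := by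
      have := Nat.ceil_lt_add_one (sq_nonneg L)
      linarith
    have h2 := Real.log_le_log (by exact_mod_cast hM1) h1
    rw [Real.log_mul (by norm_num) (by positivity), Real.log_pow] at h2
    have := Real.log_two_lt_d9
    push_cast at h2
    linarith
  have hpt (t : ℝ) (ht : t ∈ Set.Icc T (T + δ)) : ‖riemannZeta (1 + t * Complex.I)‖ ≤
      ‖riemannZeta ((1 + a : ℝ) + t * Complex.I)‖ + 16 := by
    refine (norm_riemannZeta_one_add_le_right ha0 ha1 (by linarith [ht.1])).trans ?_
    have h1 : Real.log t ≤ 2 * L := log_le_two_mul_log (by linarith) hδT ht.1 ht.2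
    have h0 : 0 ≤ Real.log t := Real.log_nonneg (by linarith [ht.1])
    have h2 : a * Real.log t * (1 + Real.log t) ≤ a * (2 * L) * (L + 2 * L) := by gcongr
    have h3 : a * (2 * L) * (L + 2 * L) = 6 := by linear_combination 6 * haL
    linarith
  have hcont := continuous_norm_riemannZeta (σ := 1 + a) (by linarith)
  have hInt := integral_norm_riemannZeta_right_le ha0 hδ.le hM1 haM T
  calc ∫ t in T..(T + δ), ‖riemannZeta (1 + t * Complex.I)‖
      ≤ ∫ t in T..(T + δ), (‖riemannZeta ((1 + a : ℝ) + t * Complex.I)‖ + 16) :=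
        intervalIntegral.integral_mono_on (by linarith)
          (intervalIntegrable_norm_riemannZeta_one_add (by linarith) hδ.le)
          ((hcont.add continuous_const).intervalIntegrable _ _) hpt
    _ = (∫ t in T..(T + δ), ‖riemannZeta ((1 + a : ℝ) + t * Complex.I)‖) + 16 * δ := by
        rw [intervalIntegral.integral_add (hcont.intervalIntegrable _ _) (by simp),
          intervalIntegral.integral_const, smul_eq_mul]
        ring
    _ ≤ 76800 * Real.exp (δ ^ 2) * (6 * Real.log L) + 18 * δ * Real.log L := by
        have h1 : 76800 * Real.exp (δ ^ 2) * (3 + Real.log M) ≤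
            76800 * Real.exp (δ ^ 2) * (6 * Real.log L) := by
          gcongr
          linarith
        have h2 : 18 * δ * 1 ≤ 18 * δ * Real.log L := by gcongr
        linarith
    _ = _ := by ring

lemma integral_norm_riemannZeta_rpow_le {p T δ K : ℝ} (hp : 1 < p) (hT : 0 < T) (hδ : 0 ≤ δ)
    (hK : ∀ t ∈ Set.Icc T (T + δ), ‖riemannZeta (1 + t * Complex.I)‖ ≤ K) :
    ∫ t in T..(T + δ), ‖riemannZeta (1 + t * Complex.I)‖ ^ p ≤
      K ^ (p - 1) * ∫ t in T..(T + δ), ‖riemannZeta (1 + t * Complex.I)‖ := by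
  rw [← intervalIntegral.integral_const_mul]
  refine intervalIntegral.integral_mono_on (by linarith) ?_
    ((intervalIntegrable_norm_riemannZeta_one_add hT hδ).const_mul _) fun t ht ↦ ?_
  · refine ContinuousOn.intervalIntegrable ?_
    rw [Set.uIcc_of_le (by linarith)]
    exact (continuousOn_norm_riemannZeta_one_add.mono fun t ht ↦ lt_of_lt_of_le hT ht.1).rpow_const
      fun _ _ ↦ Or.inr (by linarith)
  · have h0 := norm_nonneg (riemannZeta (1 + t * Complex.I))
    calc ‖riemannZeta (1 + t * Complex.I)‖ ^ p
        = ‖riemannZeta (1 + t * Complex.I)‖ ^ (p - 1) * ‖riemannZeta (1 + t * Complex.I)‖ := by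
          rw [← Real.rpow_add_one' h0 (by linarith), sub_add_cancel]
      _ ≤ _ := mul_le_mul_of_nonneg_right
          (Real.rpow_le_rpow h0 (hK t ht) (by linarith)) h0

end Moment
end ZetaMoment

open Complex Real Filter MeasureTheory intervalIntegral

theorem stmt_14 (p : ℝ) (hp : 1 < p) (δ : ℝ) (hδ : 0 < δ) :
    ∃ C > (0 : ℝ), ∃ T₀ : ℝ, (3 : ℝ) ≤ T₀ ∧ ∀ T : ℝ, T₀ ≤ T →
      (∫ t in T..(T + δ), ‖riemannZeta (1 + t * Complex.I)‖ ^ (p)) ≤ C * Real.log (Real.log T) * Real.log T ^ ((2 / 3) * (p - 1)) := by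
  obtain ⟨A, hA, hmax⟩ := ZetaMoment.exists_norm_riemannZeta_one_add_le
  obtain ⟨B, hB, hfirst⟩ := ZetaMoment.exists_integral_norm_riemannZeta_one_add_le hδ
  refine ⟨(A * 2 ^ (2 / 3 : ℝ)) ^ (p - 1) * B, by positivity,
    max 3 (max δ (Real.exp (Real.exp 1))), le_max_left _ _, fun T hT ↦ ?_⟩
  obtain ⟨hT3, hT'⟩ := max_le_iff.mp hT
  obtain ⟨hTδ, hTe⟩ := max_le_iff.mp hT'
  have hL : Real.exp 1 ≤ Real.log T := (Real.le_log_iff_exp_le (by linarith)).mpr hTe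
  have hL0 : 0 < Real.log T := (Real.exp_pos 1).trans_le hL
  have hLL : 1 ≤ Real.log (Real.log T) := (Real.le_log_iff_exp_le hL0).mpr hL
  have hK (t : ℝ) (ht : t ∈ Set.Icc T (T + δ)) :
      ‖riemannZeta (1 + t * Complex.I)‖ ≤ A * (2 * Real.log T) ^ (2 / 3 : ℝ) := by
    refine (hmax t (hT3.trans ht.1)).trans ?_
    have h0 : 0 ≤ Real.log t := Real.log_nonneg (by linarith [ht.1])
    have := ZetaMoment.log_le_two_mul_log (by linarith) hTδ ht.1 ht.2
    gcongr
  refine (ZetaMoment.integral_norm_riemannZeta_rpow_le hp (by linarith) hδ.le hK).trans ?_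
  refine (mul_le_mul_of_nonneg_left (hfirst T hT3 hTδ hLL) (by positivity)).trans_eq ?_
  rw [Real.mul_rpow two_pos.le hL0.le, ← mul_assoc A, Real.mul_rpow (by positivity) (by positivity),
    ← Real.rpow_mul hL0.le]
  ring
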